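/- Write the bigraded Poincaré series of the pure trace algebra of two generic 6×6 matrices in lowest terms, P(C_{6,2}; s,t) = N(s,t)/D(s,t), with N and D coprime polynomials normalized so that both have constant term 1. Then D(s,t) = (1 − st)·Π_6(s,t). -/

import Mathlib

open MvPolynomial Matrix

noncomputable section

/-- Index type for the entries of a pair of generic `n × n` matrices:
`Sum.inl (i,j)` indexes the `(i,j)` entry of `x`, `Sum.inr (i,j)` that of `y`. -/
abbrev MatVar (n : ℕ) := (Fin n × Fin n) ⊕ (Fin n × Fin n)

/-- The substitution sending the variables to the entries of the pair `(A, B)`. -/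
def pairSub {K : Type*} [CommSemiring K] {n : ℕ} (A B : Matrix (Fin n) (Fin n) K) :
    MatVar n → K
  | Sum.inl ij => A ij.1 ij.2
  | Sum.inr ij => B ij.1 ij.2

/-- A polynomial function on pairs of `n × n` matrices is `GLₙ`-invariant (for the action
by simultaneous conjugation). -/
def IsMatInvariant {K : Type*} [Field K] {n : ℕ} (f : MvPolynomial (MatVar n) K) : Prop :=
  ∀ (a : GL (Fin n) K) (A B : Matrix (Fin n) (Fin n) K),
    MvPolynomial.eval
        (pairSub ((a : Matrix (Fin n) (Fin n) K) * A * ((a⁻¹ : GL (Fin n) K) : Matrix (Fin n) (Fin n) K))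
          ((a : Matrix (Fin n) (Fin n) K) * B * ((a⁻¹ : GL (Fin n) K) : Matrix (Fin n) (Fin n) K))) f =
      MvPolynomial.eval (pairSub A B) f

/-- The weight giving the bidegree: entries of `x` have weight `(1,0)`,
those of `y` have weight `(0,1)`. -/
def bideg (n : ℕ) : MatVar n → ℕ × ℕ
  | Sum.inl _ => (1, 0)
  | Sum.inr _ => (0, 1)

/-- The bigraded component of bidegree `(p, q)` of the pure trace algebra `C_{n,2}`. -/
def pureComponent (K : Type*) [Field K] (n p q : ℕ) : Set (MvPolynomial (MatVar n) K) :=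
  {f | IsMatInvariant f ∧ f.IsWeightedHomogeneous (bideg n) (p, q)}

/-- `dim_K C_{n,2}^{(p,q)}`. -/
def pureDim (K : Type*) [Field K] (n p q : ℕ) : ℕ :=
  Set.finrank K (pureComponent K n p q)

/-- The bigraded Poincaré series `P(C_{n,2}; s, t)`, with `s` the variable `X 0` and
`t` the variable `X 1`. -/
def purePS2 (K : Type*) [Field K] (n : ℕ) : MvPowerSeries (Fin 2) ℚ :=
  fun d => (pureDim K n (d 0) (d 1) : ℚ)

/-- abbreviation for the power series variable `s`. -/
def ps : MvPowerSeries (Fin 2) ℚ := MvPowerSeries.X 0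

/-- abbreviation for the power series variable `t`. -/
def pt : MvPowerSeries (Fin 2) ℚ := MvPowerSeries.X 1


/-- The polynomial variable `s`. -/
def qs : MvPolynomial (Fin 2) ℚ := MvPolynomial.X 0

/-- The polynomial variable `t`. -/
def qt : MvPolynomial (Fin 2) ℚ := MvPolynomial.X 1

/-- `Π_n(s,t) = ∏_{i=1}^{n} (1−s^i)(1−t^i) ∏_{j=1}^{i−1} (1−s^{i−j} t^j)^{min(i, n+1−i)}`. -/
def PiPoly (n : ℕ) : MvPolynomial (Fin 2) ℚ :=
  ∏ i ∈ Finset.range n,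
    ((1 - qs ^ (i + 1)) * (1 - qt ^ (i + 1)) *
      ∏ j ∈ Finset.range i, (1 - qs ^ (i - j) * qt ^ (j + 1)) ^ min (i + 1) (n - i))

abbrev RQ := MvPolynomial (Fin 2) ℚ
abbrev PSQ := MvPowerSeries (Fin 2) ℚ
def toPS : RQ →+* PSQ := MvPolynomial.coeToMvPowerSeries.ringHom
theorem toPS_apply (a : RQ) : toPS a = (a : PSQ) := rfl
theorem toPS_inj : Function.Injective toPS := MvPolynomial.coe_injective (Fin 2) ℚ
section lead
variable {κ : Type*} [Field κ] (ev : RQ →+* κ) (p0 : RQ)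
def Lead (k : ℕ) (h : PSQ) (c : κ) : Prop :=
  ∃ a b : RQ, ev b ≠ 0 ∧ toPS (p0 ^ k * b) * h = toPS a ∧ ev a = c * ev b
variable {ev p0}
theorem Lead.one : Lead ev p0 0 1 1 := ⟨1, 1, by simp, by simp, by simp⟩
theorem Lead.zero (k : ℕ) : Lead ev p0 k 0 0 := ⟨0, 1, by simp, by simp, by simp⟩
theorem Lead.add {k : ℕ} {h h' : PSQ} {c c' : κ} (H : Lead ev p0 k h c) (H' : Lead ev p0 k h' c') :
    Lead ev p0 k (h + h') (c + c') := by
  obtain ⟨a, b, hb, e, ea⟩ := H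
  obtain ⟨a', b', hb', e', ea'⟩ := H'
  refine ⟨a * b' + a' * b, b * b', by simp [hb, hb'], ?_, ?_⟩
  · simp only [map_add, map_mul] at e e' ⊢
    rw [← e, ← e']; ring
  · simp only [map_add, map_mul, ea, ea']; ring
theorem Lead.mul_poly {k : ℕ} {h : PSQ} {c : κ} (H : Lead ev p0 k h c) (u : RQ) :
    Lead ev p0 k (toPS u * h) (ev u * c) := by
  obtain ⟨a, b, hb, e, ea⟩ := H
  refine ⟨u * a, b, hb, ?_, ?_⟩
  · rw [map_mul toPS u a, ← e]; ring
  · rw [map_mul, ea]; ring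
theorem Lead.sum {ι : Type*} {k : ℕ} (s : Finset ι) {h : ι → PSQ} {c : ι → κ}
    (H : ∀ i ∈ s, Lead ev p0 k (h i) (c i)) : Lead ev p0 k (∑ i ∈ s, h i) (∑ i ∈ s, c i) := by
  classical
  induction s using Finset.induction_on with
  | empty => simpa using Lead.zero k
  | insert i s hi ih =>
    rw [Finset.sum_insert hi, Finset.sum_insert hi]
    exact (H i (Finset.mem_insert_self _ _)).add
      (ih fun j hj => H j (Finset.mem_insert_of_mem hj))
theorem Lead.unique {k : ℕ} {h : PSQ} {c c' : κ} (H : Lead ev p0 k h c)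
    (H' : Lead ev p0 k h c') : c = c' := by
  obtain ⟨a, b, hb, e, ea⟩ := H
  obtain ⟨a', b', hb', e', ea'⟩ := H'
  have : a * b' = a' * b := by
    apply toPS_inj
    simp only [map_mul] at e e' ⊢
    rw [← e, ← e']; ring
  have h2 := congrArg ev this
  simp only [map_mul, ea, ea'] at h2
  have : (c - c') * (ev b * ev b') = 0 := by linear_combination h2
  rcases mul_eq_zero.mp this with h | h
  · exact sub_eq_zero.mp h
  · exact absurd h (mul_ne_zero hb hb')
theorem Lead.succ (h0 : ev p0 = 0) {k : ℕ} {h : PSQ} {c : κ} (H : Lead ev p0 k h c) :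
    Lead ev p0 (k + 1) h 0 := by
  obtain ⟨a, b, hb, e, ea⟩ := H
  refine ⟨p0 * a, b, hb, ?_, by simp [h0]⟩
  rw [map_mul toPS p0 a, ← e, pow_succ]
  simp only [map_mul]; ring
theorem Lead.lt (h0 : ev p0 = 0) {k l : ℕ} (hkl : k < l) {h : PSQ} {c : κ}
    (H : Lead ev p0 k h c) : Lead ev p0 l h 0 := by
  induction l, hkl using Nat.le_induction with
  | base => exact H.succ h0
  | succ l hl ih => exact ih.succ h0
theorem Lead.le_ex (h0 : ev p0 = 0) {k l : ℕ} (hkl : k ≤ l) {h : PSQ}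
    (H : ∃ c, Lead ev p0 k h c) : ∃ c, Lead ev p0 l h c := by
  rcases hkl.eq_or_lt with rfl | hl
  · exact H
  · obtain ⟨c, H⟩ := H
    exact ⟨0, H.lt h0 hl⟩
theorem Lead.div_bad {k : ℕ} {h : PSQ} {c : κ} (u : RQ) (hu : ev u ≠ 0)
    (H : Lead ev p0 k (toPS u * h) c) : Lead ev p0 k h (c / ev u) := by
  obtain ⟨a, b, hb, e, ea⟩ := H
  refine ⟨a, b * u, by simp [hb, hu], ?_, ?_⟩
  · rw [← e]; simp only [map_mul]; ring
  · rw [ea, map_mul]; field_simp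
theorem Lead.div_good {k : ℕ} {h : PSQ} {c : κ} (u v : RQ) (huv : u = p0 * v) (hv : ev v ≠ 0)
    (H : Lead ev p0 k (toPS u * h) c) : Lead ev p0 (k + 1) h (c / ev v) := by
  obtain ⟨a, b, hb, e, ea⟩ := H
  refine ⟨a, b * v, by simp [hb, hv], ?_, ?_⟩
  · rw [← e, huv, pow_succ]; simp only [map_mul]; ring
  · rw [ea, map_mul]; field_simp
end lead
abbrev E6 := MatVar 6
abbrev V6 := Fin 6
def esrc : E6 → V6
  | Sum.inl ij => ij.1
  | Sum.inr ij => ij.1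
def etgt : E6 → V6
  | Sum.inl ij => ij.2
  | Sum.inr ij => ij.2
def inc (e : E6) (v : V6) : ℤ := (if esrc e = v then 1 else 0) - (if etgt e = v then 1 else 0)
def bd (f : E6 → ℕ) (v : V6) : ℤ := ∑ e, (f e : ℤ) * inc e v
def isX : E6 → ℕ
  | Sum.inl _ => 1
  | Sum.inr _ => 0
def isY : E6 → ℕ
  | Sum.inl _ => 0
  | Sum.inr _ => 1
def dgx (f : E6 → ℕ) : ℕ := ∑ e, f e * isX e
def dgy (f : E6 → ℕ) : ℕ := ∑ e, f e * isY e
def ind (c : Finset E6) : E6 → ℕ := fun e => if e ∈ c then 1 else 0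
theorem isX_add_isY (e : E6) : isX e + isY e = 1 := by cases e <;> rfl
theorem dg_add_eq (f : E6 → ℕ) : dgx f + dgy f = ∑ e, f e := by
  unfold dgx dgy
  rw [← Finset.sum_add_distrib]
  exact Finset.sum_congr rfl fun e _ => by rw [← mul_add, isX_add_isY, mul_one]
theorem bd_add (f g : E6 → ℕ) (v : V6) : bd (f + g) v = bd f v + bd g v := by
  simp [bd, add_mul, Finset.sum_add_distrib]
theorem bd_zero : bd 0 = 0 := by
  funext v; simp [bd]
theorem dgx_add (f g : E6 → ℕ) : dgx (f + g) = dgx f + dgx g := by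
  simp [dgx, add_mul, Finset.sum_add_distrib]
theorem dgy_add (f g : E6 → ℕ) : dgy (f + g) = dgy f + dgy g := by
  simp [dgy, add_mul, Finset.sum_add_distrib]
def monos (p q : ℕ) : Finset (E6 → ℕ) :=
  (Fintype.piFinset fun _ : E6 => Finset.range (p + q + 1)).filter fun f => dgx f = p ∧ dgy f = q
theorem mem_monos {p q : ℕ} {f : E6 → ℕ} : f ∈ monos p q ↔ dgx f = p ∧ dgy f = q := by
  simp only [monos, Finset.mem_filter, Fintype.mem_piFinset, Finset.mem_range, and_iff_right_iff_imp]
  rintro ⟨h1, h2⟩ e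
  have := dg_add_eq f
  rw [h1, h2] at this
  rw [this]
  exact Nat.lt_succ_of_le (Finset.single_le_sum (f := f) (fun _ _ => Nat.zero_le _) (Finset.mem_univ e))
open Classical in
def flowsOf (G : Finset E6) (p q : ℕ) : Finset (E6 → ℕ) :=
  (monos p q).filter fun f => bd f = 0 ∧ ∀ e, e ∉ G → f e = 0
theorem mem_flowsOf {G : Finset E6} {p q : ℕ} {f : E6 → ℕ} :
    f ∈ flowsOf G p q ↔ (dgx f = p ∧ dgy f = q) ∧ bd f = 0 ∧ ∀ e, e ∉ G → f e = 0 := by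
  simp only [flowsOf, Finset.mem_filter, mem_monos]
attribute [irreducible] monos flowsOf
def Hf (G : Finset E6) : PSQ := fun d => ((flowsOf G (d 0) (d 1)).card : ℚ)
def IsPC (c : Finset E6) : Prop := c.Nonempty ∧ bd (ind c) = 0 ∧ Set.InjOn esrc (c : Set E6)
def xm (c : Finset E6) : RQ := qs ^ dgx (ind c) * qt ^ dgy (ind c)
theorem sum_powerset_ind (c G : Finset E6) (p q : ℕ) :
    ∑ S ∈ c.powerset, (-1 : ℚ) ^ S.card * ((flowsOf (G \ S) p q).card : ℚ) =
      (((flowsOf G p q).filter fun f => ∀ e ∈ c, f e ≠ 0).card : ℚ) := by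
  have h1 : ∀ S ∈ c.powerset, ((flowsOf (G \ S) p q).card : ℚ) =
      ∑ f ∈ flowsOf G p q, ∏ e ∈ S, (if f e = 0 then (1 : ℚ) else 0) := by
    intro S _
    have : flowsOf (G \ S) p q = (flowsOf G p q).filter fun f => ∀ e ∈ S, f e = 0 := by
      ext f
      simp only [mem_flowsOf, Finset.mem_filter, Finset.mem_sdiff, not_and, not_not]
      constructor
      · rintro ⟨h1, h2, h3⟩
        exact ⟨⟨h1, h2, fun e he => h3 e fun h => absurd h he⟩, fun e he => h3 e fun _ => he⟩
      · rintro ⟨⟨h1, h2, h3⟩, h4⟩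
        refine ⟨h1, h2, fun e he => ?_⟩
        by_cases h : e ∈ G
        · exact h4 e (he h)
        · exact h3 e h
    rw [this, Finset.card_filter]
    push_cast
    refine Finset.sum_congr rfl fun f _ => ?_
    by_cases h : ∀ e ∈ S, f e = 0
    · rw [if_pos h, Finset.prod_eq_one fun e he => if_pos (h e he)]
    · rw [if_neg h]
      push Not at h
      obtain ⟨e, he, hne⟩ := h
      rw [Finset.prod_eq_zero he (if_neg hne)]
  rw [Finset.sum_congr rfl fun S hS => by rw [h1 S hS]]
  simp_rw [Finset.mul_sum]
  rw [Finset.sum_comm, Finset.card_filter]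
  push_cast
  refine Finset.sum_congr rfl fun f _ => ?_
  have h2 : ∑ S ∈ c.powerset, (-1 : ℚ) ^ S.card * ∏ e ∈ S, (if f e = 0 then (1 : ℚ) else 0) =
      ∏ e ∈ c, (1 - (if f e = 0 then (1 : ℚ) else 0)) := by
    have := Finset.prod_add (fun e : E6 => -(if f e = 0 then (1 : ℚ) else 0)) (fun _ => 1) c
    simp only [Finset.prod_const_one, mul_one] at this
    rw [Finset.prod_congr rfl (g := fun e => (-(if f e = 0 then (1 : ℚ) else 0) + 1))
      (fun e _ => by ring), this]
    refine Finset.sum_congr rfl fun S _ => ?_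
    rw [Finset.prod_neg]
  rw [h2]
  by_cases h : ∀ e ∈ c, f e ≠ 0
  · rw [if_pos h, Finset.prod_eq_one fun e he => by rw [if_neg (h e he), sub_zero]]
  · rw [if_neg h]
    push Not at h
    obtain ⟨e, he, hne⟩ := h
    rw [Finset.prod_eq_zero he (by rw [if_pos hne, sub_self])]
theorem card_filter_shift {c G : Finset E6} (hc : bd (ind c) = 0) (hcG : c ⊆ G) (p q : ℕ) :
    ((flowsOf G p q).filter fun f => ∀ e ∈ c, f e ≠ 0).card =
      if dgx (ind c) ≤ p ∧ dgy (ind c) ≤ q then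
        (flowsOf G (p - dgx (ind c)) (q - dgy (ind c))).card else 0 := by
  have key : ∀ f : E6 → ℕ, (∀ e ∈ c, f e ≠ 0) → f = (fun e => f e - ind c e) + ind c := by
    intro f hf
    funext e
    simp only [Pi.add_apply, ind]
    split_ifs with h
    · have := hf e h; omega
    · rfl
  split_ifs with h
  · refine Finset.card_bij' (fun f _ => fun e => f e - ind c e) (fun g _ => g + ind c) ?_ ?_ ?_ ?_
    · intro f hf
      obtain ⟨hf, hfc⟩ := Finset.mem_filter.mp hf
      obtain ⟨⟨h1, h2⟩, h3, h4⟩ := mem_flowsOf.mp hf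
      have hk := key f hfc
      refine mem_flowsOf.mpr ⟨⟨?_, ?_⟩, ?_, ?_⟩
      · have := congrArg dgx hk; rw [dgx_add] at this; omega
      · have := congrArg dgy hk; rw [dgy_add] at this; omega
      · funext v
        have := congrFun (congrArg bd hk) v
        rw [bd_add, h3, hc] at this
        simpa using this.symm
      · intro e he; simp [h4 e he]
    · intro g hg
      obtain ⟨⟨h1, h2⟩, h3, h4⟩ := mem_flowsOf.mp hg
      refine Finset.mem_filter.mpr ⟨mem_flowsOf.mpr ⟨⟨?_, ?_⟩, ?_, ?_⟩, ?_⟩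
      · rw [dgx_add]; omega
      · rw [dgy_add]; omega
      · funext v; rw [bd_add, h3, hc]; simp
      · intro e he
        have : e ∉ c := fun h => he (hcG h)
        simp [h4 e he, ind, this]
      · intro e he; simp [ind, he]
    · intro f hf
      exact (key f (Finset.mem_filter.mp hf).2).symm
    · intro g _
      funext e; simp
  · rw [Finset.card_eq_zero, Finset.filter_eq_empty_iff]
    intro f hf hfc
    obtain ⟨⟨h1, h2⟩, h3, h4⟩ := mem_flowsOf.mp hf
    have hk := key f hfc
    apply h
    constructor
    · have := congrArg dgx hk; rw [dgx_add] at this; omega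
    · have := congrArg dgy hk; rw [dgy_add] at this; omega
theorem toPS_mon (a b : ℕ) : toPS (qs ^ a * qt ^ b) =
    MvPowerSeries.monomial (Finsupp.single 0 a + Finsupp.single 1 b) (1 : ℚ) := by
  rw [map_mul, map_pow, map_pow, toPS_apply, toPS_apply, qs, qt, MvPolynomial.coe_X, MvPolynomial.coe_X,
    MvPowerSeries.X_pow_eq, MvPowerSeries.X_pow_eq, MvPowerSeries.monomial_mul_monomial, one_mul]
theorem coeff_mon_mul (a b : ℕ) (h : PSQ) (d : Fin 2 →₀ ℕ) :
    MvPowerSeries.coeff d (toPS (qs ^ a * qt ^ b) * h) =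
      if a ≤ d 0 ∧ b ≤ d 1 then
        MvPowerSeries.coeff (d - (Finsupp.single 0 a + Finsupp.single 1 b)) h else 0 := by
  rw [toPS_mon, MvPowerSeries.coeff_monomial_mul, one_mul]
  congr 1
  rw [eq_iff_iff, Finsupp.le_def, Fin.forall_fin_two]
  simp
theorem coeff_Hf (G : Finset E6) (d : Fin 2 →₀ ℕ) :
    MvPowerSeries.coeff d (Hf G) = ((flowsOf G (d 0) (d 1)).card : ℚ) := rfl
theorem Hf_rec0 {c G : Finset E6} (hc : bd (ind c) = 0) (hcG : c ⊆ G) :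
    toPS (xm c) * Hf G = ∑ S ∈ c.powerset, toPS ((-1) ^ S.card) * Hf (G \ S) := by
  ext d
  rw [xm, coeff_mon_mul, map_sum]
  have : ∀ S : Finset E6, MvPowerSeries.coeff d (toPS ((-1) ^ S.card) * Hf (G \ S)) =
      (-1 : ℚ) ^ S.card * ((flowsOf (G \ S) (d 0) (d 1)).card : ℚ) := by
    intro S
    have : toPS ((-1) ^ S.card) = MvPowerSeries.C ((-1 : ℚ) ^ S.card) := by simp
    rw [this, MvPowerSeries.coeff_C_mul, coeff_Hf]
  simp_rw [this]
  rw [sum_powerset_ind, card_filter_shift hc hcG]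
  split_ifs with h
  · rw [coeff_Hf]
    simp only [Finsupp.tsub_apply, Finsupp.add_apply, Finsupp.single_apply]
    norm_num
  · norm_num
theorem Hf_rec {c G : Finset E6} (hc : bd (ind c) = 0) (hcG : c ⊆ G) :
    toPS (1 - xm c) * Hf G =
      ∑ S ∈ c.powerset.erase ∅, toPS ((-1) ^ (S.card + 1)) * Hf (G \ S) := by
  rw [map_sub, sub_mul, Hf_rec0 hc hcG, ← Finset.add_sum_erase _ _ (Finset.empty_mem_powerset c)]
  simp [pow_succ]
theorem bd_eq (f : E6 → ℕ) (v : V6) : bd f v =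
    (∑ e with esrc e = v, (f e : ℤ)) - ∑ e with etgt e = v, (f e : ℤ) := by
  simp only [bd, inc, mul_sub, Finset.sum_sub_distrib, mul_ite, mul_one, mul_zero, Finset.sum_filter]
theorem sum_ind_mul (c : Finset E6) (F : E6 → ℤ) :
    ∑ e, ((ind c e : ℕ) : ℤ) * F e = ∑ e ∈ c, F e := by
  simp only [ind, Nat.cast_ite, Nat.cast_one, Nat.cast_zero, ite_mul, one_mul, zero_mul,
    Finset.sum_ite_mem, Finset.univ_inter]
theorem exists_PC {f : E6 → ℕ} (hf : bd f = 0) (hne : f ≠ 0) :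
    ∃ c, IsPC c ∧ ∀ e ∈ c, f e ≠ 0 := by
  classical
  -- vertices with positive outflow
  have hout : ∀ e, f e ≠ 0 → ∃ e', esrc e' = etgt e ∧ f e' ≠ 0 := by
    intro e he
    by_contra! hcon
    have h1 := bd_eq f (etgt e)
    rw [hf] at h1
    have h2 : ∑ e' with esrc e' = etgt e, (f e' : ℤ) = 0 :=
      Finset.sum_eq_zero fun e' he' => by
        rw [hcon e' (Finset.mem_filter.mp he').2]; rfl
    have h3 : (f e : ℤ) ≤ ∑ e' with etgt e' = etgt e, (f e' : ℤ) :=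
      Finset.single_le_sum (f := fun e' => (f e' : ℤ)) (fun _ _ => by positivity)
        (Finset.mem_filter.mpr ⟨Finset.mem_univ _, rfl⟩)
    rw [h2] at h1
    have : 0 < f e := Nat.pos_of_ne_zero he
    simp only [Pi.zero_apply] at h1
    omega
  let S0 : Finset V6 := Finset.univ.filter fun v => ∃ e, esrc e = v ∧ f e ≠ 0
  have hch : ∀ v : V6, ∃ e : E6, v ∈ S0 → (esrc e = v ∧ f e ≠ 0) := by
    intro v
    by_cases hv : v ∈ S0
    · obtain ⟨e, he⟩ := (Finset.mem_filter.mp hv).2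
      exact ⟨e, fun _ => he⟩
    · exact ⟨Sum.inl (v, v), fun h => absurd h hv⟩
  choose ch hch using hch
  let g : V6 → V6 := fun v => etgt (ch v)
  have hg : ∀ v ∈ S0, g v ∈ S0 := fun v hv =>
    Finset.mem_filter.mpr ⟨Finset.mem_univ _, hout _ (hch v hv).2⟩
  have hS0 : S0.Nonempty := by
    obtain ⟨e, he⟩ := Function.ne_iff.mp hne
    exact ⟨esrc e, Finset.mem_filter.mpr ⟨Finset.mem_univ _, e, rfl, he⟩⟩
  let 𝒮 : Finset (Finset V6) := S0.powerset.filter fun T => T.Nonempty ∧ T.image g ⊆ T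
  have h𝒮 : 𝒮.Nonempty := ⟨S0, by
    simp only [𝒮, Finset.mem_filter, Finset.mem_powerset, subset_refl, true_and]
    exact ⟨hS0, Finset.image_subset_iff.mpr hg⟩⟩
  obtain ⟨T, hT, hmin⟩ := Finset.exists_min_image 𝒮 Finset.card h𝒮
  obtain ⟨hTS, hTn, hTg⟩ : T ⊆ S0 ∧ T.Nonempty ∧ T.image g ⊆ T := by
    simpa [𝒮] using hT
  have himg : T.image g ∈ 𝒮 := by
    simp only [𝒮, Finset.mem_filter, Finset.mem_powerset]
    exact ⟨hTg.trans hTS, hTn.image g, Finset.image_subset_image hTg⟩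
  have hcard := hmin _ himg
  have hEq : T.image g = T := Finset.eq_of_subset_of_card_le hTg hcard
  have hinj : Set.InjOn g (T : Set V6) := Finset.card_image_iff.mp (by rw [hEq])
  have hchinj : Set.InjOn ch (T : Set V6) := fun a ha b hb hab => by
    rw [← (hch a (hTS ha)).1, ← (hch b (hTS hb)).1, hab]
  refine ⟨T.image ch, ⟨hTn.image ch, ?_, ?_⟩, ?_⟩
  · funext v
    have : ∀ (F : E6 → ℤ), ∑ e, ((ind (T.image ch) e : ℕ) : ℤ) * F e = ∑ u ∈ T, F (ch u) := by
      intro F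
      rw [← Finset.sum_image hchinj]
      exact sum_ind_mul _ F
    rw [bd, this]
    simp only [inc, Finset.sum_sub_distrib, Pi.zero_apply]
    rw [sub_eq_zero]
    have e1 : ∑ u ∈ T, (if esrc (ch u) = v then (1 : ℤ) else 0) = ∑ u ∈ T, if u = v then 1 else 0 :=
      Finset.sum_congr rfl fun u hu => by rw [(hch u (hTS hu)).1]
    rw [e1]
    nth_rewrite 1 [← hEq]
    rw [Finset.sum_image hinj]
  · intro a ha b hb hab
    simp only [Finset.coe_image, Set.mem_image, Finset.mem_coe] at ha hb
    obtain ⟨u, hu, rfl⟩ := ha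
    obtain ⟨w, hw, rfl⟩ := hb
    rw [(hch u (hTS hu)).1, (hch w (hTS hw)).1] at hab
    rw [hab]
  · intro e he
    obtain ⟨u, hu, rfl⟩ := Finset.mem_image.mp he
    exact (hch u (hTS hu)).2
theorem sum_ind (c : Finset E6) : ∑ e, ind c e = c.card := by
  simp [ind]
theorem IsPC.card_le {c : Finset E6} (hc : IsPC c) : c.card ≤ 6 := by
  have := Finset.card_le_card_of_injOn (t := (Finset.univ : Finset V6)) esrc
    (fun _ _ => Finset.mem_univ _) hc.2.2
  simpa using this
theorem IsPC.dg_le {c : Finset E6} (hc : IsPC c) : dgx (ind c) + dgy (ind c) ≤ 6 := by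
  rw [dg_add_eq, sum_ind]; exact hc.card_le
theorem IsPC.dg_pos {c : Finset E6} (hc : IsPC c) : 0 < dgx (ind c) + dgy (ind c) := by
  rw [dg_add_eq, sum_ind]; exact Finset.card_pos.mpr hc.1
theorem flow_induction {P : (E6 → ℕ) → Prop} (h0 : P 0)
    (hs : ∀ c f, IsPC c → bd f = 0 → P f → P (ind c + f)) (f : E6 → ℕ) (hf : bd f = 0)
    (G : Finset E6) (hG : ∀ e, e ∉ G → f e = 0) :
    (∀ c, IsPC c → c ⊆ G → True) → P f := by
  intro _
  induction hn : ∑ e, f e using Nat.strong_induction_on generalizing f with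
  | _ n ih =>
    by_cases hz : f = 0
    · rw [hz]; exact h0
    obtain ⟨c, hc, hcf⟩ := exists_PC hf hz
    have key : f = ind c + fun e => f e - ind c e := by
      funext e
      simp only [Pi.add_apply, ind]
      split_ifs with h
      · have := hcf e h; omega
      · omega
    have hb : bd (fun e => f e - ind c e) = 0 := by
      funext v
      have := congrFun (congrArg bd key) v
      rw [bd_add, hf, hc.2.1] at this
      simpa using this.symm
    rw [key]
    refine hs c _ hc hb (ih _ ?_ _ hb (fun e he => by rw [hG e he]; simp) rfl)
    have h1 := congrArg (fun F : E6 → ℕ => ∑ e, F e) key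
    simp only [Pi.add_apply, Finset.sum_add_distrib, sum_ind] at h1
    have := Finset.card_pos.mpr hc.1
    omega
theorem flow_induction' {P : (E6 → ℕ) → Prop} (G : Finset E6) (h0 : P 0)
    (hs : ∀ c f, IsPC c → c ⊆ G → P f → P (ind c + f)) (f : E6 → ℕ) (hf : bd f = 0)
    (hG : ∀ e, e ∉ G → f e = 0) : P f := by
  have := flow_induction (P := fun f => (∀ e, e ∉ G → f e = 0) → P f) (fun _ => h0)
    (fun c f hc _ ih h => hs c f hc (fun e he => by
      by_contra hcon
      have := h e hcon
      simp [ind, he] at this) (ih fun e he => by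
        have := h e he
        simp only [Pi.add_apply] at this
        omega)) f hf G hG (fun _ _ _ => trivial)
  exact this hG
theorem Hf_noPC {G : Finset E6} (h : ∀ c, IsPC c → ¬ c ⊆ G) : Hf G = 1 := by
  have hfl : ∀ f : E6 → ℕ, bd f = 0 → (∀ e, e ∉ G → f e = 0) → f = 0 := fun f hf hG =>
    flow_induction' (P := fun f => f = 0) G rfl (fun c f hc hcG _ => absurd hcG (h c hc)) f hf hG
  ext d
  rw [coeff_Hf, MvPowerSeries.coeff_one]
  split_ifs with hd
  · have : flowsOf G (d 0) (d 1) = {0} := by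
      ext f
      rw [mem_flowsOf, Finset.mem_singleton, hd]
      constructor
      · rintro ⟨_, h1, h2⟩; exact hfl f h1 h2
      · rintro rfl; exact ⟨⟨by simp [dgx], by simp [dgy]⟩, bd_zero, fun _ _ => rfl⟩
    rw [this]; simp
  · have : flowsOf G (d 0) (d 1) = ∅ := by
      rw [Finset.eq_empty_iff_forall_notMem]
      intro f hf
      obtain ⟨⟨h1, h2⟩, h3, h4⟩ := mem_flowsOf.mp hf
      have := hfl f h3 h4
      subst this
      apply hd
      ext i
      fin_cases i
      · simpa [dgx] using h1.symm
      · simpa [dgy] using h2.symm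
    rw [this]; simp
theorem sdiff_card_lt {c G S : Finset E6} (hcG : c ⊆ G) (hS : S ∈ c.powerset.erase ∅) :
    (G \ S).card < G.card := by
  obtain ⟨h1, h2⟩ := Finset.mem_erase.mp hS
  refine Finset.card_lt_card (Finset.sdiff_ssubset ((Finset.mem_powerset.mp h2).trans hcG)
    (Finset.nonempty_iff_ne_empty.mpr h1))
def TT : RQ := ∏ ab ∈ ((Finset.range 7 ×ˢ Finset.range 7).filter fun ab => 1 ≤ ab.1 + ab.2 ∧ ab.1 + ab.2 ≤ 6),
  (1 - qs ^ ab.1 * qt ^ ab.2)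
theorem dvd_TT {c : Finset E6} (hc : IsPC c) : 1 - xm c ∣ TT := by
  have h1 := hc.dg_le
  have h2 := hc.dg_pos
  refine Finset.dvd_prod_of_mem (fun ab : ℕ × ℕ => (1 - qs ^ ab.1 * qt ^ ab.2 : RQ))
    (a := (dgx (ind c), dgy (ind c))) ?_
  simp only [Finset.mem_filter, Finset.mem_product, Finset.mem_range]
  omega
theorem Hf_den (G : Finset E6) : ∃ (N : ℕ) (a : RQ), toPS (TT ^ N) * Hf G = toPS a := by
  induction hn : G.card using Nat.strong_induction_on generalizing G with
  | _ n ih =>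
    by_cases h : ∀ c, IsPC c → ¬ c ⊆ G
    · exact ⟨0, 1, by rw [Hf_noPC h]; simp⟩
    push Not at h
    obtain ⟨c, hc, hcG⟩ := h
    have hrec := Hf_rec hc.2.1 hcG
    have : ∃ (N : ℕ) (a : RQ), toPS (TT ^ N) *
        ∑ S ∈ c.powerset.erase ∅, toPS ((-1) ^ (S.card + 1)) * Hf (G \ S) = toPS a := by
      have : ∀ s ⊆ c.powerset.erase ∅, ∃ (N : ℕ) (a : RQ), toPS (TT ^ N) *
        ∑ S ∈ s, toPS ((-1) ^ (S.card + 1)) * Hf (G \ S) = toPS a := by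
        intro s
        induction s using Finset.induction_on with
        | empty => intro _; exact ⟨0, 0, by simp⟩
        | insert S s hS ihs =>
          intro hsub
          obtain ⟨N, a, h1⟩ := ihs ((Finset.subset_insert _ _).trans hsub)
          obtain ⟨M, b, h2⟩ := ih _ (hn ▸ sdiff_card_lt hcG (hsub (Finset.mem_insert_self _ _))) _ rfl
          refine ⟨N + M, TT ^ M * a + TT ^ N * (-1) ^ (S.card + 1) * b, ?_⟩
          rw [Finset.sum_insert hS, map_add, map_mul _ _ a, map_mul _ _ b, ← h1, ← h2, pow_add]
          simp only [map_mul]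
          ring
      exact this _ subset_rfl
    obtain ⟨N, a, ha⟩ := this
    rw [← hrec] at ha
    obtain ⟨v, hv⟩ := dvd_TT hc
    refine ⟨N + 1, v * a, ?_⟩
    rw [pow_succ, map_mul toPS v a, ← ha, map_mul]
    nth_rewrite 2 [hv]
    simp only [map_mul]
    ring
structure Loc (κ : Type*) [Field κ] where
  ev : RQ →+* κ
  p0 : RQ
  h0 : ev p0 = 0
  hs : ev qs ≠ 0
  ht : ev qt ≠ 0
  hgood : ∀ a b : ℕ, a + b ≤ 6 → 0 < a + b → ev (qs ^ a * qt ^ b) = 1 →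
    ∃ v, 1 - qs ^ a * qt ^ b = p0 * v ∧ ev v ≠ 0
  xs : ℤ → ℤ
  ys : ℤ → ℤ
  val : ℤ → κ
  val0 : val 0 = 1
  valx : ∀ c, val (xs c) = ev qs * val c
  valy : ∀ c, val (ys c) = ev qt * val c
  valinj : Function.Injective val
  valne : ∀ c, val c ≠ 0
section flows
theorem bd_single (e : E6) (v : V6) : bd (Pi.single e 1) v = inc e v := by
  rw [bd, Finset.sum_eq_single e]
  · simp
  · intro b _ hb; simp [hb]
  · simp
def PathFn (G : Finset E6) (u v : V6) (d : E6 → ℕ) : Prop :=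
  (∀ e, e ∉ G → d e = 0) ∧ ∀ w, bd d w = (if u = w then 1 else 0) - (if v = w then 1 else 0)
theorem PathFn.refl (G : Finset E6) (u : V6) : PathFn G u u 0 :=
  ⟨fun _ _ => rfl, fun w => by rw [bd_zero]; simp⟩
theorem PathFn.trans {G : Finset E6} {u v w : V6} {d d' : E6 → ℕ} (h : PathFn G u v d)
    (h' : PathFn G v w d') : PathFn G u w (d + d') :=
  ⟨fun e he => by simp [h.1 e he, h'.1 e he], fun x => by rw [bd_add, h.2, h'.2]; ring⟩
theorem PathFn.edge {G : Finset E6} {e : E6} (he : e ∈ G) :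
    PathFn G (esrc e) (etgt e) (Pi.single e 1) :=
  ⟨fun e' he' => by
    have : e' ≠ e := fun h => he' (h ▸ he)
    simp [this], fun w => by rw [bd_single]; rfl⟩
theorem PathFn.flow {G : Finset E6} {u : V6} {d : E6 → ℕ} (h : PathFn G u u d) : bd d = 0 := by
  funext w; rw [h.2]; simp
theorem PathFn.leave {G : Finset E6} {u v : V6} {d : E6 → ℕ} (h : PathFn G u v d)
    (T : Finset V6) (hu : u ∈ T) (hv : v ∉ T) : ∃ e ∈ G, d e ≠ 0 ∧ esrc e ∈ T ∧ etgt e ∉ T := by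
  by_contra! hcon
  have h1 : ∑ w ∈ T, bd d w = 1 := by
    simp only [h.2, Finset.sum_sub_distrib, Finset.sum_ite_eq, if_pos hu, if_neg hv, sub_zero]
  have h2 : ∑ w ∈ T, bd d w ≤ 0 := by
    simp only [bd]
    rw [Finset.sum_comm]
    refine Finset.sum_nonpos fun e _ => ?_
    rw [← Finset.mul_sum]
    by_cases hz : d e = 0
    · simp [hz]
    have heG : e ∈ G := by by_contra h'; exact hz (h.1 e h')
    refine mul_nonpos_of_nonneg_of_nonpos (by positivity) ?_
    simp only [inc, Finset.sum_sub_distrib, Finset.sum_ite_eq]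
    have := hcon e heG hz
    split_ifs <;> first | omega | (exfalso; tauto)
  omega
theorem PathFn.enter {G : Finset E6} {u v : V6} {d : E6 → ℕ} (h : PathFn G u v d)
    (T : Finset V6) (hu : u ∉ T) (hv : v ∈ T) : ∃ e ∈ G, d e ≠ 0 ∧ esrc e ∉ T ∧ etgt e ∈ T := by
  obtain ⟨e, h1, h2, h3, h4⟩ := h.leave Tᶜ (by simpa using hu) (by simpa using hv)
  exact ⟨e, h1, h2, by simpa using h3, by simpa using h4⟩
open Classical in
def core (G : Finset E6) : Finset E6 :=
  G.filter fun e => ∃ f : E6 → ℕ, bd f = 0 ∧ (∀ e, e ∉ G → f e = 0) ∧ f e ≠ 0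
theorem mem_core {G : Finset E6} {e : E6} : e ∈ core G ↔
    e ∈ G ∧ ∃ f : E6 → ℕ, bd f = 0 ∧ (∀ e, e ∉ G → f e = 0) ∧ f e ≠ 0 := by
  simp [core]
theorem core_sub (G : Finset E6) : core G ⊆ G := fun _ he => (mem_core.mp he).1
theorem flow_core {G : Finset E6} {f : E6 → ℕ} (hf : bd f = 0) (hG : ∀ e, e ∉ G → f e = 0) :
    ∀ e, e ∉ core G → f e = 0 := by
  intro e he
  by_contra hne
  exact he (mem_core.mpr ⟨by by_contra h; exact hne (hG e h), f, hf, hG, hne⟩)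
theorem PathFn.back_edge {G : Finset E6} {e : E6} (he : e ∈ core G) :
    ∃ d, PathFn (core G) (etgt e) (esrc e) d := by
  obtain ⟨_, f, hf, hG, hne⟩ := mem_core.mp he
  have hfc := flow_core hf hG
  have key : f = Pi.single e 1 + fun e' => f e' - Pi.single (M := fun _ => ℕ) e 1 e' := by
    funext e'
    simp only [Pi.add_apply]
    by_cases h : e' = e
    · subst h; simp; omega
    · simp [h]
  refine ⟨fun e' => f e' - Pi.single (M := fun _ => ℕ) e 1 e', fun e' he' => by simp [hfc e' he'], fun w => ?_⟩
  have := congrFun (congrArg bd key) w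
  rw [bd_add, hf, bd_single] at this
  simp only [inc, Pi.zero_apply] at this
  linarith
def rel (G : Finset E6) (u v : V6) : Prop := ∃ d, PathFn (core G) u v d
theorem rel.refl (G : Finset E6) (u : V6) : rel G u u := ⟨0, PathFn.refl _ _⟩
theorem rel.trans {G : Finset E6} {u v w : V6} (h : rel G u v) (h' : rel G v w) : rel G u w := by
  obtain ⟨d, h⟩ := h
  obtain ⟨d', h'⟩ := h'
  exact ⟨_, h.trans h'⟩
theorem rel.symm {G : Finset E6} {u v : V6} (h : rel G u v) : rel G v u := by
  classical
  by_contra hcon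
  obtain ⟨d, h⟩ := h
  obtain ⟨e, he, _, h1, h2⟩ := h.leave (Finset.univ.filter fun w => ¬ rel G v w ∧ rel G w u) 
    (by simp [hcon, rel.refl]) (by simp [rel.refl])
  simp only [Finset.mem_filter, Finset.mem_univ, true_and, not_and] at h1 h2
  have hb : rel G (etgt e) (esrc e) := PathFn.back_edge he
  have hf : rel G (esrc e) (etgt e) := ⟨_, PathFn.edge he⟩
  exact h2 (fun h => h1.1 (h.trans hb)) (hb.trans h1.2)
end flows
section W
def Wsp (G : Finset E6) : Submodule ℚ (E6 → ℚ) :=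
  Submodule.span ℚ {g | ∃ f : E6 → ℕ, bd f = 0 ∧ (∀ e, e ∉ G → f e = 0) ∧ g = fun e => (f e : ℚ)}
theorem Wsp_mono {G G' : Finset E6} (h : G ⊆ G') : Wsp G ≤ Wsp G' :=
  Submodule.span_mono fun _ ⟨f, h1, h2, h3⟩ => ⟨f, h1, fun e he => h2 e fun h' => he (h h'), h3⟩
theorem Wsp_supp {G : Finset E6} {g : E6 → ℚ} (hg : g ∈ Wsp G) {e : E6} (he : e ∉ G) : g e = 0 := by
  have : Wsp G ≤ LinearMap.ker (LinearMap.proj (R := ℚ) (φ := fun _ : E6 => ℚ) e) := by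
    refine Submodule.span_le.mpr ?_
    rintro _ ⟨f, h1, h2, rfl⟩
    simp [h2 e he]
  exact this hg
theorem Wsp_lt {c G S : Finset E6} (hc : bd (ind c) = 0) (hcG : c ⊆ G) (hS : S ∈ c.powerset.erase ∅) :
    Module.finrank ℚ (Wsp (G \ S)) < Module.finrank ℚ (Wsp G) := by
  apply Submodule.finrank_lt_finrank_of_lt
  refine lt_of_le_of_ne (Wsp_mono Finset.sdiff_subset) fun h => ?_
  obtain ⟨h1, h2⟩ := Finset.mem_erase.mp hS
  obtain ⟨e, he⟩ := Finset.nonempty_iff_ne_empty.mpr h1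
  have hm : (fun e => ((ind c e : ℕ) : ℚ)) ∈ Wsp G := Submodule.subset_span
    ⟨ind c, hc, fun e he => by
      have : e ∉ c := fun h => he (hcG h)
      simp [ind, this], rfl⟩
  rw [← h] at hm
  have := Wsp_supp hm (e := e) (by simp [he])
  simp [ind, Finset.mem_powerset.mp h2 he] at this
end W
section loc
variable {κ : Type*} [Field κ] (L : Loc κ)
def AllGood (G : Finset E6) : Prop := ∀ c, IsPC c → c ⊆ G → L.ev (xm c) = 1
variable {L}
theorem AllGood.mono {G G' : Finset E6} (h : AllGood L G') (hs : G ⊆ G') : AllGood L G :=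
  fun c hc hcG => h c hc (hcG.trans hs)
theorem AllGood.lead {G : Finset E6} (hG : AllGood L G) :
    ∃ c, Lead L.ev L.p0 (Module.finrank ℚ (Wsp G)) (Hf G) c := by
  induction hn : G.card using Nat.strong_induction_on generalizing G with
  | _ n ih =>
    by_cases h : ∀ c, IsPC c → ¬ c ⊆ G
    · rw [Hf_noPC h]
      exact Lead.le_ex L.h0 (Nat.zero_le _) ⟨1, Lead.one⟩
    push Not at h
    obtain ⟨c, hc, hcG⟩ := h
    have hr : 0 < Module.finrank ℚ (Wsp G) :=
      lt_of_le_of_lt (Nat.zero_le _) (Wsp_lt hc.2.1 hcG (S := c)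
        (Finset.mem_erase.mpr ⟨Finset.nonempty_iff_ne_empty.mp hc.1, Finset.mem_powerset_self c⟩))
    have h1 : ∀ S : Finset E6, ∃ a, S ∈ c.powerset.erase ∅ →
        Lead L.ev L.p0 (Module.finrank ℚ (Wsp G) - 1) (Hf (G \ S)) a := by
      intro S
      by_cases hS : S ∈ c.powerset.erase ∅
      · obtain ⟨a, ha⟩ := Lead.le_ex L.h0 (Nat.le_sub_one_of_lt (Wsp_lt hc.2.1 hcG hS))
          (ih _ (hn ▸ sdiff_card_lt hcG hS) (hG.mono Finset.sdiff_subset) rfl)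
        exact ⟨a, fun _ => ha⟩
      · exact ⟨0, fun h => absurd h hS⟩
    choose a ha using h1
    obtain ⟨v, hv, hv0⟩ := L.hgood _ _ hc.dg_le hc.dg_pos (hG c hc hcG)
    have h2 := Lead.sum _ fun S hS => (ha S hS).mul_poly ((-1) ^ (S.card + 1))
    rw [← Hf_rec hc.2.1 hcG] at h2
    have h3 := Lead.div_good _ v hv hv0 h2
    rw [Nat.sub_add_cancel hr] at h3
    exact ⟨_, h3⟩
variable (L)
def me : E6 → κ
  | Sum.inl _ => L.ev qs
  | Sum.inr _ => L.ev qt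
def evf (f : E6 → ℕ) : κ := ∏ e, me L e ^ f e
def step : E6 → ℤ → ℤ
  | Sum.inl _ => L.xs
  | Sum.inr _ => L.ys
variable {L}
theorem me_ne (e : E6) : me L e ≠ 0 := by
  cases e
  · exact L.hs
  · exact L.ht
theorem val_step (e : E6) (c : ℤ) : L.val (step L e c) = me L e * L.val c := by
  cases e
  · exact L.valx c
  · exact L.valy c
theorem evf_add (f g : E6 → ℕ) : evf L (f + g) = evf L f * evf L g := by
  simp [evf, pow_add, Finset.prod_mul_distrib]
theorem evf_ne (f : E6 → ℕ) : evf L f ≠ 0 :=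
  Finset.prod_ne_zero_iff.mpr fun e _ => pow_ne_zero _ (me_ne e)
theorem evf_zero : evf L 0 = 1 := by simp [evf]
theorem evf_single (e : E6) : evf L (Pi.single e 1) = me L e := by
  rw [evf, Finset.prod_eq_single e]
  · simp
  · intro b _ hb; simp [hb]
  · simp
theorem evf_eq (f : E6 → ℕ) : evf L f = L.ev (qs ^ dgx f * qt ^ dgy f) := by
  have : ∀ e, me L e = L.ev qs ^ isX e * L.ev qt ^ isY e := by
    intro e; cases e <;> simp [me, isX, isY]
  simp only [evf, this, mul_pow, ← pow_mul, Finset.prod_mul_distrib, Finset.prod_pow_eq_pow_sum,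
    map_mul, map_pow, dgx, dgy]
  simp only [mul_comm]
theorem evf_ind (c : Finset E6) : evf L (ind c) = L.ev (xm c) := evf_eq _
theorem AllGood.evf_flow {G : Finset E6} (hG : AllGood L G) {f : E6 → ℕ} (hf : bd f = 0)
    (hfG : ∀ e, e ∉ G → f e = 0) : evf L f = 1 :=
  flow_induction' (P := fun f => evf L f = 1) G evf_zero
    (fun c f hc hcG ih => by rw [evf_add, evf_ind, hG c hc hcG, ih, one_mul]) f hf hfG
theorem exists_code (f : E6 → ℕ) : ∃ c, L.val c = evf L f := by
  have hx : ∀ a : ℕ, ∀ c, ∃ c', L.val c' = L.ev qs ^ a * L.val c := by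
    intro a
    induction a with
    | zero => intro c; exact ⟨c, by simp⟩
    | succ a ih =>
      intro c
      obtain ⟨c', h⟩ := ih c
      exact ⟨L.xs c', by rw [L.valx, h]; ring⟩
  have hy : ∀ a : ℕ, ∀ c, ∃ c', L.val c' = L.ev qt ^ a * L.val c := by
    intro a
    induction a with
    | zero => intro c; exact ⟨c, by simp⟩
    | succ a ih =>
      intro c
      obtain ⟨c', h⟩ := ih c
      exact ⟨L.ys c', by rw [L.valy, h]; ring⟩
  obtain ⟨c, hc⟩ := hy (dgy f) 0
  obtain ⟨c', hc'⟩ := hx (dgx f) c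
  exact ⟨c', by rw [hc', hc, L.val0, evf_eq]; simp⟩
theorem AllGood.path_eq {G : Finset E6} (hG : AllGood L G) {u v : V6} {d d' : E6 → ℕ}
    (h : PathFn (core G) u v d) (h' : PathFn (core G) u v d') : evf L d = evf L d' := by
  obtain ⟨b, hb⟩ := rel.symm ⟨d, h⟩
  have e1 := (h.trans hb)
  have e2 := (h'.trans hb)
  have f1 := (hG.mono (core_sub G)).evf_flow e1.flow e1.1
  have f2 := (hG.mono (core_sub G)).evf_flow e2.flow e2.1
  rw [evf_add] at f1 f2
  exact mul_right_cancel₀ (evf_ne b) (f1.trans f2.symm)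
open Classical in
def root (G : Finset E6) (u : V6) : V6 :=
  (Finset.univ.filter fun w => rel G w u).min' ⟨u, by simp [rel.refl]⟩
theorem root_rel (G : Finset E6) (u : V6) : rel G (root G u) u := by
  classical
  have := Finset.min'_mem (Finset.univ.filter fun w => rel G w u) ⟨u, by simp [rel.refl]⟩
  exact (Finset.mem_filter.mp this).2
theorem root_eq {G : Finset E6} {u v : V6} (h : rel G u v) : root G u = root G v := by
  classical
  have : (Finset.univ.filter fun w => rel G w u) = Finset.univ.filter fun w => rel G w v := by
    ext w
    simp only [Finset.mem_filter, Finset.mem_univ, true_and]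
    exact ⟨fun h' => h'.trans h, fun h' => h'.trans h.symm⟩
  simp only [root, this]
theorem root_root (G : Finset E6) (u : V6) : root G (root G u) = root G u := root_eq (root_rel G u)
theorem root_eq_iff {G : Finset E6} {u v : V6} : root G u = root G v ↔ rel G u v :=
  ⟨fun h => ((root_rel G u).symm).trans (h ▸ root_rel G v), root_eq⟩
theorem AllGood.exists_codes {G : Finset E6} (hG : AllGood L G) : ∃ c : V6 → ℤ,
    (∀ u, c (root G u) = 0) ∧ ∀ e ∈ core G, c (etgt e) = step L e (c (esrc e)) := by
  choose d hd using fun u => root_rel G u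
  choose c hc using fun u => exists_code (L := L) (d u)
  refine ⟨c, fun u => L.valinj ?_, fun e he => L.valinj ?_⟩
  · rw [hc, L.val0]
    have := hd (root G u)
    rw [root_root] at this
    exact (hG.mono (core_sub G)).evf_flow this.flow this.1
  · rw [val_step, hc, hc]
    have hr : root G (esrc e) = root G (etgt e) := root_eq ⟨_, PathFn.edge he⟩
    have h1 := (hd (esrc e)).trans (PathFn.edge he)
    rw [hr] at h1
    rw [hG.path_eq (hd (etgt e)) h1, evf_add, evf_single, mul_comm]
end loc
def bdQ : (E6 → ℚ) →ₗ[ℚ] (V6 → ℚ) where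
  toFun g := fun v => ∑ e, g e * (inc e v : ℚ)
  map_add' g h := by funext v; simp only [Pi.add_apply, add_mul, Finset.sum_add_distrib]
  map_smul' r g := by
    funext v; simp only [Pi.smul_apply, smul_eq_mul, mul_assoc, Finset.mul_sum, RingHom.id_apply]
theorem bdQ_cast (f : E6 → ℕ) (v : V6) : bdQ (fun e => (f e : ℚ)) v = (bd f v : ℚ) := by
  simp only [bdQ, bd, LinearMap.coe_mk, AddHom.coe_mk]
  push_cast
  rfl
open Classical in
theorem rank_bound (G : Finset E6) :
    Module.finrank ℚ (Wsp G) + (Finset.univ.filter fun u => root G u ≠ u).card ≤ (core G).card := by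
  let V' := {u : V6 // root G u ≠ u}
  let E' := {e : E6 // e ∉ core G}
  let r1 : (V6 → ℚ) →ₗ[ℚ] (V' → ℚ) := LinearMap.funLeft ℚ ℚ Subtype.val
  let r2 : (E6 → ℚ) →ₗ[ℚ] (E' → ℚ) := LinearMap.funLeft ℚ ℚ Subtype.val
  let Φ : (E6 → ℚ) →ₗ[ℚ] (V' → ℚ) × (E' → ℚ) := (r1 ∘ₗ bdQ).prod r2
  have hsurj : Function.Surjective Φ := by
    choose d hd using fun u => root_rel G u
    rintro ⟨a, b⟩
    let g0 : E6 → ℚ := fun e => if h : e ∉ core G then b ⟨e, h⟩ else 0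
    let k : V' → ℚ := fun u => a u - bdQ g0 u.1
    refine ⟨g0 - ∑ u : V', k u • (fun e => ((d u.1 e : ℕ) : ℚ)), ?_⟩
    have hbd : ∀ u w : V', bdQ (fun e => ((d u.1 e : ℕ) : ℚ)) w.1 = - if u = w then 1 else 0 := by
      intro u w
      rw [bdQ_cast, (hd u.1).2]
      have h1 : root G u.1 ≠ w.1 := by
        intro h
        apply w.2
        rw [← h, root_root]
      rw [if_neg h1]
      by_cases huw : u = w
      · simp [huw]
      · have : u.1 ≠ w.1 := fun h => huw (Subtype.ext h)
        simp [huw, this]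
    refine Prod.ext ?_ ?_
    · funext w
      show bdQ (g0 - ∑ u : V', k u • (fun e => ((d u.1 e : ℕ) : ℚ))) w.1 = a w
      rw [map_sub, map_sum]
      simp only [map_smul, Pi.sub_apply, Finset.sum_apply, Pi.smul_apply, hbd, smul_eq_mul,
        mul_neg, mul_ite, mul_one, mul_zero, Finset.sum_neg_distrib, k]
      rw [Finset.sum_eq_single w (fun x _ hx => if_neg hx) (fun h => absurd (Finset.mem_univ _) h), if_pos rfl]
      ring
    · funext e
      show (g0 - ∑ u : V', k u • (fun e => ((d u.1 e : ℕ) : ℚ))) e.1 = b e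
      have : ∀ u, d u e.1 = 0 := fun u => (hd u).1 e.1 e.2
      simp [g0, e.2, this]
  have hW : Wsp G ≤ LinearMap.ker Φ := by
    refine Submodule.span_le.mpr ?_
    rintro _ ⟨f, h1, h2, rfl⟩
    refine LinearMap.mem_ker.mpr (Prod.ext ?_ ?_)
    · funext w
      show bdQ (fun e => (f e : ℚ)) w.1 = 0
      rw [bdQ_cast, h1]; simp
    · funext e
      show (f e.1 : ℚ) = 0
      rw [flow_core h1 h2 e.1 e.2]; simp
  have h1 := Submodule.finrank_mono hW
  have h2 := LinearMap.finrank_range_add_finrank_ker Φ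
  rw [LinearMap.range_eq_top.mpr hsurj, finrank_top, Module.finrank_prod,
    Module.finrank_fintype_fun_eq_card, Module.finrank_fintype_fun_eq_card,
    Module.finrank_fintype_fun_eq_card] at h2
  have h3 : Fintype.card V' = (Finset.univ.filter fun u => root G u ≠ u).card :=
    Fintype.card_subtype _
  have h4 : Fintype.card E' + (core G).card = Fintype.card E6 := by
    have h5 : Fintype.card E' = ((core G)ᶜ).card :=
      Fintype.card_of_subtype _ (fun e => by simp)
    rw [h5]
    exact Finset.card_compl_add_card _
  omega
def Gs (σ : Equiv.Perm V6) : Finset E6 :=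
  Finset.univ.image (fun i => Sum.inl (i, σ i)) ∪ Finset.univ.image Sum.inr
theorem mem_Gs_inl {σ : Equiv.Perm V6} {i j : V6} : (Sum.inl (i, j) : E6) ∈ Gs σ ↔ j = σ i := by
  simp [Gs, eq_comm]
theorem mem_Gs_inr {σ : Equiv.Perm V6} {ij : V6 × V6} : (Sum.inr ij : E6) ∈ Gs σ := by
  simp [Gs]
section cnt
def cntM (xs ys : ℤ → ℤ) (M : Multiset ℤ) : ℕ :=
  (M.map fun a => M.count (ys a)).sum + (M.map xs ∩ M).card
variable {κ : Type*} [Field κ] {L : Loc κ}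
def Cc (L : Loc κ) (σ : Equiv.Perm V6) (c : V6 → ℤ) : Finset E6 :=
  (Gs σ).filter fun e => c (etgt e) = step L e (c (esrc e))
theorem card_compat_le (σ : Equiv.Perm V6) (c : V6 → ℤ) (U : Finset V6) :
    ((Cc L σ c).filter fun e => esrc e ∈ U ∧ etgt e ∈ U).card ≤ cntM L.xs L.ys (U.val.map c) := by
  classical
  let X := U.filter fun i => σ i ∈ U ∧ c (σ i) = L.xs (c i)
  let Y := (U ×ˢ U).filter fun ij => c ij.2 = L.ys (c ij.1)
  have hX : X.card ≤ (((U.val.map c).map L.xs) ∩ (U.val.map c)).card := by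
    have e1 : X.val.map (c ∘ σ) = X.val.map (L.xs ∘ c) :=
      Multiset.map_congr rfl fun i hi => (Finset.mem_filter.mp hi).2.2
    have h1 : X.val.map (c ∘ σ) ≤ (U.val.map c).map L.xs := by
      rw [e1, Multiset.map_map]
      exact Multiset.map_le_map (Finset.val_le_iff.mpr (Finset.filter_subset _ _))
    have h2 : X.val.map (c ∘ σ) ≤ U.val.map c := by
      have : X.val.map (c ∘ σ) = (X.map σ.toEmbedding).val.map c := by
        rw [Finset.map_val, Multiset.map_map]; rfl
      rw [this]
      refine Multiset.map_le_map (Finset.val_le_iff.mpr ?_)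
      intro j hj
      obtain ⟨i, hi, rfl⟩ := Finset.mem_map.mp hj
      exact (Finset.mem_filter.mp hi).2.1
    have := Multiset.card_le_card (Multiset.le_inter h1 h2)
    rwa [Multiset.card_map] at this
  have hY : Y.card = ((U.val.map c).map fun a => (U.val.map c).count (L.ys a)).sum := by
    rw [Multiset.map_map]
    show Y.card = ∑ i ∈ U, (U.val.map c).count (L.ys (c i))
    rw [Finset.card_filter, Finset.sum_product]
    refine Finset.sum_congr rfl fun i _ => ?_
    rw [Multiset.count_map, ← Finset.card_filter]
    show (U.filter _).card = (U.filter _).card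
    congr 1
    ext j; simp [eq_comm]
  have hsub : ((Cc L σ c).filter fun e => esrc e ∈ U ∧ etgt e ∈ U) ⊆
      (Y.map ⟨Sum.inr, Sum.inr_injective⟩) ∪ X.image fun i => Sum.inl (i, σ i) := by
    intro e he
    simp only [Cc, Finset.mem_filter] at he
    obtain ⟨⟨h1, h2⟩, h3, h4⟩ := he
    rcases e with ⟨i, j⟩ | ⟨i, j⟩
    · simp only [esrc, etgt, step] at h2 h3 h4
      obtain rfl := mem_Gs_inl.mp h1
      refine Finset.mem_union_right _ (Finset.mem_image.mpr ⟨i, ?_, rfl⟩)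
      exact Finset.mem_filter.mpr ⟨h3, h4, h2⟩
    · simp only [esrc, etgt, step] at h2 h3 h4
      refine Finset.mem_union_left _ (Finset.mem_map.mpr ⟨(i, j), ?_, rfl⟩)
      exact Finset.mem_filter.mpr ⟨Finset.mem_product.mpr ⟨h3, h4⟩, h2⟩
  refine (Finset.card_le_card hsub).trans ((Finset.card_union_le _ _).trans ?_)
  rw [cntM, Finset.card_map, hY]
  exact Nat.add_le_add_left (Finset.card_image_le.trans hX) _
end cnt
section enum
def insL (a : ℤ) : List ℤ → List ℤ
  | [] => [a]
  | b :: l => if a ≤ b then a :: b :: l else b :: insL a l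
theorem insL_coe (a : ℤ) (l : List ℤ) : ((insL a l : List ℤ) : Multiset ℤ) = a ::ₘ (l : Multiset ℤ) := by
  induction l with
  | nil => rfl
  | cons b l ih =>
    rw [insL]
    split_ifs
    · rfl
    · rw [← Multiset.cons_coe, ih, ← Multiset.cons_coe, Multiset.cons_swap]
def dedupL : List (List ℤ) → List (List ℤ)
  | [] => []
  | a :: l => if a ∈ l then dedupL l else a :: dedupL l
theorem mem_dedupL {a : List ℤ} {l : List (List ℤ)} : a ∈ dedupL l ↔ a ∈ l := by
  induction l with
  | nil => simp [dedupL]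
  | cons b l ih =>
    rw [dedupL]
    split_ifs with h
    · rw [ih, List.mem_cons]
      constructor
      · exact Or.inr
      · rintro (rfl | h')
        · exact h
        · exact h'
    · rw [List.mem_cons, List.mem_cons, ih]
def Lst (xs ys : ℤ → ℤ) : ℕ → List (List ℤ)
  | 0 => [[0]]
  | k + 1 => dedupL ((Lst xs ys k).flatMap fun l => l.flatMap fun a => [insL (xs a) l, insL (ys a) l])
def okL (xs ys : ℤ → ℤ) (l : List ℤ) : Bool :=
  l.all fun a => (decide (xs a ∈ l) || decide (ys a ∈ l)) && l.any fun b => decide (xs b = a) || decide (ys b = a)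
theorem Lst_step {xs ys : ℤ → ℤ} {k : ℕ} {l : List ℤ} {a b : ℤ} (hl : l ∈ Lst xs ys k) (ha : a ∈ l)
    (hb : b = xs a ∨ b = ys a) : ∃ l' ∈ Lst xs ys (k + 1), (l' : Multiset ℤ) = b ::ₘ (l : Multiset ℤ) := by
  refine ⟨insL b l, ?_, insL_coe b l⟩
  rw [Lst, mem_dedupL]
  refine List.mem_flatMap.mpr ⟨l, hl, List.mem_flatMap.mpr ⟨a, ha, ?_⟩⟩
  rcases hb with rfl | rfl <;> simp
end enum
section tight
variable {κ : Type*} [Field κ] {L : Loc κ}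
theorem step_or (e : E6) (c : ℤ) : step L e c = L.xs c ∨ step L e c = L.ys c := by
  cases e
  · exact Or.inl rfl
  · exact Or.inr rfl
def cmpt (G : Finset E6) (r : V6) : Finset V6 := Finset.univ.filter fun u => root G u = r
theorem comp_list {G : Finset E6} {c : V6 → ℤ} (hroot : ∀ u, c (root G u) = 0)
    (hc : ∀ e ∈ core G, c (etgt e) = step L e (c (esrc e))) (r : V6) (hr : root G r = r) :
    ∃ l ∈ Lst L.xs L.ys ((cmpt G r).card - 1), (l : Multiset ℤ) = (cmpt G r).val.map c ∧
      (2 ≤ (cmpt G r).card → okL L.xs L.ys l = true) := by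
  classical
  have hrU : r ∈ cmpt G r := by simp [cmpt, hr]
  have hpos : 0 < (cmpt G r).card := Finset.card_pos.mpr ⟨r, hrU⟩
  have grow : ∀ j, j < (cmpt G r).card → ∃ T ⊆ cmpt G r, r ∈ T ∧ T.card = j + 1 ∧
      ∃ l ∈ Lst L.xs L.ys j, (l : Multiset ℤ) = T.val.map c := by
    intro j
    induction j with
    | zero =>
      intro _
      refine ⟨{r}, by simpa using hrU, by simp, by simp, [0], by simp [Lst], ?_⟩
      have := hroot r
      rw [hr] at this
      simp [this]
    | succ j ih =>
      intro hj
      obtain ⟨T, hTU, hrT, hTc, l, hl, hlT⟩ := ih (by omega)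
      have : ∃ v ∈ cmpt G r, v ∉ T := by
        by_contra! hcon
        have := Finset.card_le_card (show cmpt G r ⊆ T from hcon)
        omega
      obtain ⟨v, hv, hvT⟩ := this
      have hrv : rel G r v := root_eq_iff.mp (by rw [hr, (Finset.mem_filter.mp hv).2])
      obtain ⟨d, hd⟩ := hrv
      obtain ⟨e, he, -, h1, h2⟩ := hd.leave T hrT hvT
      have hstep := hc e he
      obtain ⟨l', hl', hl'c⟩ := Lst_step (a := c (esrc e)) (b := c (etgt e)) hl
        (by
          rw [← Multiset.mem_coe, hlT]
          exact Multiset.mem_map_of_mem c h1)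
        (by rw [hstep]; exact step_or e _)
      refine ⟨insert (etgt e) T, ?_, Finset.mem_insert_of_mem hrT,
        by rw [Finset.card_insert_of_notMem h2, hTc], l', hl', ?_⟩
      · refine Finset.insert_subset ?_ hTU
        have h3 : root G (esrc e) = r := (Finset.mem_filter.mp (hTU h1)).2
        have h4 : root G (esrc e) = root G (etgt e) := root_eq ⟨_, PathFn.edge he⟩
        simp only [cmpt, Finset.mem_filter, Finset.mem_univ, true_and]
        rw [← h4, h3]
      · rw [hl'c, hlT, Finset.insert_val_of_notMem h2, Multiset.map_cons]
  obtain ⟨T, hTU, hrT, hTc, l, hl, hlT⟩ := grow ((cmpt G r).card - 1) (by omega)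
  have hT : T = cmpt G r := Finset.eq_of_subset_of_card_le hTU (by omega)
  rw [hT] at hlT
  refine ⟨l, hl, hlT, fun h2 => ?_⟩
  have hmem : ∀ a, a ∈ l ↔ ∃ u ∈ cmpt G r, c u = a := by
    intro a
    rw [← Multiset.mem_coe, hlT, Multiset.mem_map]
    rfl
  simp only [okL, List.all_eq_true, Bool.and_eq_true, Bool.or_eq_true, decide_eq_true_eq,
    List.any_eq_true]
  intro a ha
  obtain ⟨u, hu, rfl⟩ := (hmem a).mp ha
  obtain ⟨v, hv, hvu⟩ : ∃ v ∈ cmpt G r, v ≠ u := Finset.exists_mem_ne (by omega) u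
  have hru : root G u = r := (Finset.mem_filter.mp hu).2
  have hrv : root G v = r := (Finset.mem_filter.mp hv).2
  have hedge : ∀ e ∈ core G, root G (esrc e) = root G (etgt e) := fun e he =>
    root_eq ⟨_, PathFn.edge he⟩
  constructor
  · obtain ⟨d, hd⟩ := root_eq_iff.mp (hru.trans hrv.symm)
    obtain ⟨e, he, -, h1, h2⟩ := hd.leave {u} (by simp) (by simpa using hvu)
    rw [Finset.mem_singleton] at h1
    have h3 : c (etgt e) ∈ l := (hmem _).mpr ⟨etgt e, by
      simp only [cmpt, Finset.mem_filter, Finset.mem_univ, true_and]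
      rw [← hedge e he, h1, hru], rfl⟩
    rw [hc e he, h1] at h3
    rcases step_or (L := L) e (c u) with h | h
    · left; rwa [h] at h3
    · right; rwa [h] at h3
  · obtain ⟨d, hd⟩ := root_eq_iff.mp (hrv.trans hru.symm)
    obtain ⟨e, he, -, h1, h2⟩ := hd.enter {u} (by simpa using hvu) (by simp)
    rw [Finset.mem_singleton] at h2
    refine ⟨c (esrc e), (hmem _).mpr ⟨esrc e, by
      simp only [cmpt, Finset.mem_filter, Finset.mem_univ, true_and]
      rw [hedge e he, h2, hru], rfl⟩, ?_⟩
    have := hc e he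
    rw [h2] at this
    rw [this]
    rcases step_or (L := L) e (c (esrc e)) with h | h
    · left; exact h.symm
    · right; exact h.symm
def TableOK (xs ys : ℤ → ℤ) (m : ℕ) : Prop :=
  ∀ k < 6, ∀ l ∈ Lst xs ys k, (1 ≤ k → okL xs ys l = true) →
    (k < 5 → 6 * (cntM xs ys l + 1) < m * (k + 1) + 6 * (k + 1)) ∧ cntM xs ys l ≤ m + 5 
theorem core_card_sum (G : Finset E6) : (core G).card =
    ∑ r ∈ Finset.univ.filter (fun r => root G r = r),
      ((core G).filter fun e => esrc e ∈ cmpt G r ∧ etgt e ∈ cmpt G r).card := by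
  classical
  rw [Finset.card_eq_sum_card_fiberwise (f := fun e => root G (esrc e))
    (t := Finset.univ.filter (fun r => root G r = r))]
  · refine Finset.sum_congr rfl fun r _ => ?_
    congr 1
    refine Finset.filter_congr fun e he => ?_
    simp only [cmpt, Finset.mem_filter, Finset.mem_univ, true_and]
    have : root G (esrc e) = root G (etgt e) := root_eq ⟨_, PathFn.edge he⟩
    rw [← this, and_self]
  · intro e _
    simp [root_root]
theorem comp_card_sum (G : Finset E6) : ∑ r ∈ Finset.univ.filter (fun r => root G r = r),
      (cmpt G r).card = 6 := by
  classical
  have := Finset.card_eq_sum_card_fiberwise (s := (Finset.univ : Finset V6)) (f := root G)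
    (t := Finset.univ.filter (fun r => root G r = r)) (fun u _ => by simp [root_root])
  have h6 : (Finset.univ : Finset V6).card = 6 := by simp
  exact this.symm.trans h6
theorem main_bound {σ : Equiv.Perm V6} {m : ℕ} (htab : TableOK L.xs L.ys m) {G : Finset E6}
    (hGs : G ⊆ Gs σ) (hG : AllGood L G) :
    Module.finrank ℚ (Wsp G) ≤ m ∧ (Module.finrank ℚ (Wsp G) = m → ∃ c : V6 → ℤ, c 0 = 0 ∧
      (∃ l ∈ Lst L.xs L.ys 5, okL L.xs L.ys l = true ∧ (l : Multiset ℤ) = Finset.univ.val.map c) ∧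
      (Cc L σ c).card = m + 5 ∧ G = Cc L σ c ∧ ∀ c' : V6 → ℤ, c' 0 = 0 → Cc L σ c' = G → c' = c) := by
  classical
  obtain ⟨c, hroot, hc⟩ := hG.exists_codes
  have hcore : core G ⊆ Cc L σ c := fun e he =>
    Finset.mem_filter.mpr ⟨hGs (core_sub G he), hc e he⟩
  have hb := rank_bound G
  set Rt := Finset.univ.filter (fun r => root G r = r) with hRt
  have hRc : Rt.card + (Finset.univ.filter fun u => root G u ≠ u).card = 6 := by
    have := Finset.card_filter_add_card_filter_not (s := (Finset.univ : Finset V6))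
      (fun r => root G r = r)
    simpa using this
  have hk6 : ∀ r, (cmpt G r).card ≤ 6 := fun r => (Finset.card_le_univ _).trans (by simp)
  -- per component bound
  have hcomp : ∀ r ∈ Rt,
      6 * (((core G).filter fun e => esrc e ∈ cmpt G r ∧ etgt e ∈ cmpt G r).card + 1) ≤
        m * (cmpt G r).card + 6 * (cmpt G r).card ∧ ((cmpt G r).card < 6 →
      6 * (((core G).filter fun e => esrc e ∈ cmpt G r ∧ etgt e ∈ cmpt G r).card + 1) <
        m * (cmpt G r).card + 6 * (cmpt G r).card) := by
    intro r hr
    have hr' : root G r = r := (Finset.mem_filter.mp hr).2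
    have hpos : 0 < (cmpt G r).card := Finset.card_pos.mpr ⟨r, by simp [cmpt, hr']⟩
    obtain ⟨l, hl, hlm, hok⟩ := comp_list hroot hc r hr'
    have h1 := card_compat_le (L := L) σ c (cmpt G r)
    rw [← hlm] at h1
    have h2 : ((core G).filter fun e => esrc e ∈ cmpt G r ∧ etgt e ∈ cmpt G r).card ≤
        cntM L.xs L.ys l :=
      (Finset.card_le_card (Finset.filter_subset_filter _ hcore)).trans h1
    have h6 := hk6 r
    obtain ⟨t1, t2⟩ := htab ((cmpt G r).card - 1) (by omega) l hl (fun h => hok (by omega))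
    rw [Nat.sub_add_cancel hpos] at t1
    constructor
    · by_cases h : (cmpt G r).card = 6
      · rw [h]; omega
      · have := t1 (by omega)
        omega
    · intro h
      have := t1 (by omega)
      omega
  have hsum := Finset.sum_le_sum fun r hr => (hcomp r hr).1
  have hS1 : ∑ r ∈ Rt, 6 * (((core G).filter fun e => esrc e ∈ cmpt G r ∧ etgt e ∈ cmpt G r).card + 1)
      = 6 * ((core G).card + Rt.card) := by
    rw [← Finset.mul_sum, Finset.sum_add_distrib, ← core_card_sum]
    simp
  have hS2 : ∑ r ∈ Rt, (m * (cmpt G r).card + 6 * (cmpt G r).card) = m * 6 + 6 * 6 := by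
    rw [Finset.sum_add_distrib, ← Finset.mul_sum, ← Finset.mul_sum, comp_card_sum]
  refine ⟨by rw [hS1, hS2] at hsum; omega, fun heq => ?_⟩
  have hall : ∀ r ∈ Rt, (cmpt G r).card = 6 := by
    intro r hr
    by_contra hne
    have hlt := Finset.sum_lt_sum (fun r hr => (hcomp r hr).1)
      ⟨r, hr, (hcomp r hr).2 (lt_of_le_of_ne (hk6 r) hne)⟩
    rw [hS1, hS2] at hlt
    omega
  have huniv : cmpt G (root G 0) = Finset.univ := by
    apply Finset.eq_univ_of_card
    rw [hall _ (Finset.mem_filter.mpr ⟨Finset.mem_univ _, root_root G 0⟩)]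
    simp
  have hr0 : root G 0 = 0 := by
    have h1 : root G (0 : V6) ≤ 0 := by
      refine Finset.min'_le _ _ ?_
      simp [rel.refl]
    simpa using h1
  rw [hr0] at huniv
  have hc0 : c 0 = 0 := by have := hroot 0; rwa [hr0] at this
  have hrel : ∀ u v, rel G u v := by
    intro u v
    have : ∀ w, root G w = 0 := by
      intro w
      have : w ∈ cmpt G 0 := by rw [huniv]; simp
      exact (Finset.mem_filter.mp this).2
    exact root_eq_iff.mp (by rw [this, this])
  obtain ⟨l, hl, hlm, hok⟩ := comp_list hroot hc 0 hr0
  rw [huniv] at hl hlm hok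
  have hc6 : (Finset.univ : Finset V6).card = 6 := by simp
  rw [hc6] at hl hok
  have hCle : (Cc L σ c).card ≤ m + 5 := by
    have h1 := card_compat_le (L := L) σ c Finset.univ
    rw [← hlm] at h1
    have h2 : (Cc L σ c).filter (fun e => esrc e ∈ Finset.univ ∧ etgt e ∈ Finset.univ) = Cc L σ c := by
      simp
    rw [h2] at h1
    exact h1.trans (htab 5 (by omega) l hl (fun _ => hok (by omega))).2
  have hRt1 : Rt.card = 1 := by
    have := comp_card_sum G
    rw [Finset.sum_congr rfl hall, Finset.sum_const, smul_eq_mul] at this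
    have h' : Rt.card * 6 = 6 := this
    omega
  have hcore_eq : core G = Cc L σ c := Finset.eq_of_subset_of_card_le hcore (by omega)
  have hGcore : G = core G := by
    refine Finset.Subset.antisymm (fun e he => ?_) (core_sub G)
    obtain ⟨d, hd⟩ := hrel (etgt e) (esrc e)
    have hd' : PathFn G (etgt e) (esrc e) d :=
      ⟨fun e' he' => hd.1 e' fun h => he' (core_sub G h), hd.2⟩
    have hfl := (PathFn.edge he).trans hd'
    exact mem_core.mpr ⟨he, _, hfl.flow, hfl.1, by simp⟩
  refine ⟨c, hc0, ⟨l, hl, hok (by omega), hlm⟩, ?_, hGcore.trans hcore_eq, ?_⟩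
  · have := Finset.card_le_card hcore
    omega
  · intro c' hc'0 hc'
    by_contra hne
    obtain ⟨v, hv⟩ := Function.ne_iff.mp hne
    obtain ⟨d, hd⟩ := hrel 0 v
    obtain ⟨e, he, -, h1, h2⟩ := hd.leave (Finset.univ.filter fun w => c' w = c w)
      (by simp [hc0, hc'0]) (by simpa using hv)
    simp only [Finset.mem_filter, Finset.mem_univ, true_and] at h1 h2
    have he' : e ∈ Cc L σ c' := by rw [hc']; exact core_sub G he
    apply h2
    rw [(Finset.mem_filter.mp he').2, hc e he, h1]
theorem mem_Gs {σ : Equiv.Perm V6} {e : E6} : e ∈ Gs σ ↔ isX e = 0 ∨ etgt e = σ (esrc e) := by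
  rcases e with ⟨i, j⟩ | ij
  · rw [mem_Gs_inl]; simp [isX, esrc, etgt]
  · simp [mem_Gs_inr, isX]
theorem mem_Cc {σ : Equiv.Perm V6} {c : V6 → ℤ} {e : E6} : e ∈ Cc L σ c ↔
    e ∈ Gs σ ∧ c (etgt e) = step L e (c (esrc e)) := by
  simp only [Cc, Finset.mem_filter]
end tight
attribute [irreducible] Gs Cc
section lead
variable {κ : Type*} [Field κ] (L : Loc κ)
def yv (c : V6 → ℤ) (e : E6) : κ := me L e * L.val (c (esrc e)) / L.val (c (etgt e))
variable {L}
theorem yv_eq_one {c : V6 → ℤ} {e : E6} : yv L c e = 1 ↔ c (etgt e) = step L e (c (esrc e)) := by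
  rw [yv, div_eq_one_iff_eq (L.valne _), ← val_step, eq_comm]
  exact L.valinj.eq_iff
theorem prod_src_tgt {p : Finset E6} (hp : bd (ind p) = 0) (g : V6 → κ) :
    ∏ e ∈ p, g (esrc e) = ∏ e ∈ p, g (etgt e) := by
  rw [← Finset.prod_fiberwise p esrc, ← Finset.prod_fiberwise p etgt]
  refine Finset.prod_congr rfl fun v _ => ?_
  rw [Finset.prod_congr rfl (g := fun _ => g v) (fun e he => by rw [(Finset.mem_filter.mp he).2]),
    Finset.prod_congr rfl (s₁ := p.filter fun e => etgt e = v) (g := fun _ => g v)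
      (fun e he => by rw [(Finset.mem_filter.mp he).2]), Finset.prod_const, Finset.prod_const]
  congr 1
  have h := congrFun hp v
  rw [bd, sum_ind_mul] at h
  simp only [inc, Finset.sum_sub_distrib, Finset.sum_boole, Pi.zero_apply] at h
  have := sub_eq_zero.mp h
  exact_mod_cast this
theorem prod_yv {p : Finset E6} (hp : bd (ind p) = 0) (c : V6 → ℤ) :
    ∏ e ∈ p, yv L c e = L.ev (xm p) := by
  simp only [yv]
  rw [Finset.prod_div_distrib, Finset.prod_mul_distrib, prod_src_tgt hp fun v => L.val (c v),
    mul_div_assoc, div_self (Finset.prod_ne_zero_iff.mpr fun e _ => L.valne _), mul_one, ← evf_ind,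
    evf, ← Finset.prod_subset (Finset.subset_univ p)]
  · exact Finset.prod_congr rfl fun e he => by simp [ind, he]
  · intro e _ he; simp [ind, he]
theorem Cc_good (σ : Equiv.Perm V6) (c : V6 → ℤ) : AllGood L (Cc L σ c) := by
  intro p hp hpC
  rw [← prod_yv hp.2.1 c]
  exact Finset.prod_eq_one fun e he => yv_eq_one.mpr (mem_Cc.mp (hpC he)).2
variable (L)
open Classical in
def vC (m : ℕ) (C : Finset E6) : κ :=
  if h : ∃ a, Lead L.ev L.p0 m (Hf C) a then h.choose else 0
open Classical in
def Phi : Finset (V6 → ℤ) :=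
  (Fintype.piFinset fun _ => ((Lst L.xs L.ys 5).flatten).toFinset).filter fun c => c 0 = 0 ∧
    ∃ l ∈ Lst L.xs L.ys 5, okL L.xs L.ys l = true ∧ (l : Multiset ℤ) = Finset.univ.val.map c
variable {L}
theorem vC_eq {m : ℕ} {C : Finset E6} {a : κ} (h : Lead L.ev L.p0 m (Hf C) a) : vC L m C = a := by
  have h' : ∃ a, Lead L.ev L.p0 m (Hf C) a := ⟨a, h⟩
  rw [vC, dif_pos h']
  exact h'.choose_spec.unique h
theorem mem_Phi {c : V6 → ℤ} : c ∈ Phi L ↔ c 0 = 0 ∧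
    ∃ l ∈ Lst L.xs L.ys 5, okL L.xs L.ys l = true ∧ (l : Multiset ℤ) = Finset.univ.val.map c := by
  simp only [Phi, Finset.mem_filter, Fintype.mem_piFinset, List.mem_toFinset, List.mem_flatten,
    and_iff_right_iff_imp]
  rintro ⟨_, l, hl, -, h⟩ v
  refine ⟨l, hl, ?_⟩
  rw [← Multiset.mem_coe, h]
  exact Multiset.mem_map_of_mem c (Finset.mem_univ v)
variable (L)
def wC (m : ℕ) (σ : Equiv.Perm V6) (G : Finset E6) (c : V6 → ℤ) : κ :=
  if Cc L σ c ⊆ G then (if (Cc L σ c).card = m + 5 then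
    vC L m (Cc L σ c) * ∏ e ∈ G \ Cc L σ c, (1 - yv L c e)⁻¹ else 0) else 0
variable {L}
theorem wC_pos {m : ℕ} {σ : Equiv.Perm V6} {G : Finset E6} {c : V6 → ℤ} (h1 : Cc L σ c ⊆ G)
    (h2 : (Cc L σ c).card = m + 5) : wC L m σ G c =
      vC L m (Cc L σ c) * ∏ e ∈ G \ (Cc L σ c), (1 - yv L c e)⁻¹ := by
  rw [wC, if_pos h1, if_pos h2]
theorem wC_card {m : ℕ} {σ : Equiv.Perm V6} {G : Finset E6} {c : V6 → ℤ}
    (h2 : (Cc L σ c).card ≠ m + 5) : wC L m σ G c = 0 := by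
  rw [wC, if_neg h2, ite_self]
theorem wC_sub {m : ℕ} {σ : Equiv.Perm V6} {G : Finset E6} {c : V6 → ℤ} (h1 : ¬ Cc L σ c ⊆ G) :
    wC L m σ G c = 0 := by
  rw [wC, if_neg h1]
attribute [irreducible] Phi vC wC
theorem sdiff_aux {α : Type*} [DecidableEq α] {S G C : Finset α} (h1 : S ⊆ G) (h2 : Disjoint S C) :
    G \ C = ((G \ S) \ C) ∪ S := by
  ext e
  have h3 : e ∈ S → e ∉ C := fun h => Finset.disjoint_left.mp h2 h
  have h4 : e ∈ S → e ∈ G := fun h => h1 h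
  simp only [Finset.mem_sdiff, Finset.mem_union]
  tauto
theorem sub_identity {c C : Finset E6} (y : E6 → κ) (hC : ∀ e ∈ C, y e = 1) :
    ∑ S ∈ c.powerset.erase ∅, (-1) ^ (S.card + 1) * (if Disjoint S C then ∏ e ∈ S, (1 - y e) else 0) =
      1 - ∏ e ∈ c, y e := by
  classical
  have h1 : ∀ S : Finset E6, (if Disjoint S C then ∏ e ∈ S, (1 - y e) else 0) = ∏ e ∈ S, (1 - y e) := by
    intro S
    split_ifs with h
    · rfl
    · obtain ⟨e, he, heC⟩ := Finset.not_disjoint_iff.mp h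
      rw [Finset.prod_eq_zero he]
      rw [hC e heC, sub_self]
  simp only [h1]
  have h2 : ∏ e ∈ c, y e = ∑ S ∈ c.powerset, (-1) ^ S.card * ∏ e ∈ S, (1 - y e) := by
    have := Finset.prod_sub (fun _ => (1 : κ)) (fun e => 1 - y e) c
    simpa using this
  rw [h2, ← Finset.add_sum_erase _ _ (Finset.empty_mem_powerset c)]
  simp [pow_succ]
theorem leadG {σ : Equiv.Perm V6} {m : ℕ} (htab : TableOK L.xs L.ys m) {G : Finset E6}
    (hGs : G ⊆ Gs σ) : Lead L.ev L.p0 m (Hf G) (∑ c ∈ Phi L, wC L m σ G c) := by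
  classical
  induction hn : G.card using Nat.strong_induction_on generalizing G with
  | _ n ih =>
    by_cases hgood : AllGood L G
    · obtain ⟨hle, heq⟩ := main_bound htab hGs hgood
      obtain ⟨a, ha⟩ := hgood.lead
      rcases hle.lt_or_eq with hlt | hEq
      · have h0 : ∑ c ∈ Phi L, wC L m σ G c = 0 := by
          refine Finset.sum_eq_zero fun c _ => ?_
          by_cases h1 : Cc L σ c ⊆ G
          · by_cases h2 : (Cc L σ c).card = m + 5
            · obtain ⟨b, hb⟩ := (Cc_good (L := L) σ c).lead
              have hr := (Submodule.finrank_mono (Wsp_mono h1)).trans_lt hlt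
              rw [wC_pos h1 h2, vC_eq (hb.lt L.h0 hr), zero_mul]
            · exact wC_card h2
          · exact wC_sub h1
        rw [h0]
        exact ha.lt L.h0 hlt
      · obtain ⟨c, hc0, hcl, hcard, hGC, huniq⟩ := heq hEq
        rw [hEq] at ha
        have hsum : ∑ c ∈ Phi L, wC L m σ G c = a := by
          rw [Finset.sum_eq_single c]
          · rw [wC_pos (le_of_eq hGC.symm) hcard, ← hGC, vC_eq ha, Finset.sdiff_self,
              Finset.prod_empty, mul_one]
          · intro c' hc' hne
            by_cases h1 : Cc L σ c' ⊆ G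
            · by_cases h2 : (Cc L σ c').card = m + 5
              · exfalso
                refine hne (huniq c' (mem_Phi.mp hc').1 (Finset.eq_of_subset_of_card_le h1 ?_))
                rw [h2, hGC, hcard]
              · exact wC_card h2
            · exact wC_sub h1
          · exact fun h => absurd (mem_Phi.mpr ⟨hc0, hcl⟩) h
        rw [hsum]
        exact ha
    · simp only [AllGood, not_forall] at hgood
      obtain ⟨p, hp, hpG, hbad⟩ := hgood
      have hu : L.ev (1 - xm p) ≠ 0 := by
        rw [map_sub, map_one]
        exact sub_ne_zero.mpr (Ne.symm hbad)
      have h2 := Lead.sum (p.powerset.erase ∅) fun S hS =>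
        (ih _ (hn ▸ sdiff_card_lt hpG hS) (Finset.sdiff_subset.trans hGs) rfl).mul_poly
          ((-1) ^ (S.card + 1))
      rw [← Hf_rec hp.2.1 hpG] at h2
      have h3 := Lead.div_bad _ hu h2
      convert h3 using 1
      rw [eq_div_iff hu]
      simp only [Finset.mul_sum, map_pow, map_neg, map_one]
      rw [Finset.sum_comm, Finset.sum_mul]
      refine Finset.sum_congr rfl fun c _ => ?_
      have hC : ∀ e ∈ Cc L σ c, yv L c e = 1 := fun e he => yv_eq_one.mpr (mem_Cc.mp he).2
      by_cases h1 : Cc L σ c ⊆ G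
      · by_cases h4 : (Cc L σ c).card = m + 5
        · rw [map_sub, map_one, ← prod_yv hp.2.1 c, ← sub_identity _ hC, Finset.mul_sum]
          refine Finset.sum_congr rfl fun S hS => ?_
          have hSG : S ⊆ G := (Finset.mem_powerset.mp (Finset.mem_erase.mp hS).2).trans hpG
          rw [wC_pos h1 h4]
          by_cases h5 : Disjoint S (Cc L σ c)
          · have h6 : Cc L σ c ⊆ G \ S := Finset.subset_sdiff.mpr ⟨h1, h5.symm⟩
            rw [if_pos h5, wC_pos h6 h4]
            have h7 := sdiff_aux hSG h5
            have h8 : Disjoint ((G \ S) \ (Cc L σ c)) S :=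
              Finset.disjoint_left.mpr fun e he heS =>
                (Finset.mem_sdiff.mp (Finset.mem_sdiff.mp he).1).2 heS
            rw [h7, Finset.prod_union h8, Finset.prod_inv_distrib (s := S)]
            have h9 : ∏ e ∈ S, (1 - yv L c e) ≠ 0 := Finset.prod_ne_zero_iff.mpr fun e he => by
              rw [sub_ne_zero]
              intro h
              refine Finset.disjoint_left.mp h5 he (mem_Cc.mpr ⟨hGs (hSG he), ?_⟩)
              exact yv_eq_one.mp h.symm
            field_simp
          · have h6 : ¬ Cc L σ c ⊆ G \ S := fun h => h5 (Finset.subset_sdiff.mp h).2.symm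
            rw [if_neg h5, wC_sub h6]
            simp
        · simp [wC_card h4]
      · have : ∀ S : Finset E6, ¬ Cc L σ c ⊆ G \ S := fun S h => h1 (h.trans Finset.sdiff_subset)
        simp [wC_sub h1, fun S => wC_sub (m := m) (this S)]
end lead
section relabel
def pE (π : Equiv.Perm V6) : E6 ≃ E6 := Equiv.sumCongr (Equiv.prodCongr π π) (Equiv.prodCongr π π)
theorem esrc_pE (π : Equiv.Perm V6) (e : E6) : esrc (pE π e) = π (esrc e) := by cases e <;> rfl
theorem etgt_pE (π : Equiv.Perm V6) (e : E6) : etgt (pE π e) = π (etgt e) := by cases e <;> rfl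
theorem isX_pE (π : Equiv.Perm V6) (e : E6) : isX (pE π e) = isX e := by cases e <;> rfl
theorem isY_pE (π : Equiv.Perm V6) (e : E6) : isY (pE π e) = isY e := by cases e <;> rfl
theorem inc_pE (π : Equiv.Perm V6) (e : E6) (v : V6) : inc (pE π e) (π v) = inc e v := by
  simp only [inc, esrc_pE, etgt_pE, EmbeddingLike.apply_eq_iff_eq]
theorem Hf_map (π : Equiv.Perm V6) (G : Finset E6) : Hf (G.map (pE π).toEmbedding) = Hf G := by
  ext d
  rw [coeff_Hf, coeff_Hf]
  congr 1
  symm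
  refine Finset.card_equiv (Equiv.arrowCongr (pE π) (Equiv.refl ℕ)) fun f => ?_
  rw [mem_flowsOf, mem_flowsOf]
  set f' : E6 → ℕ := Equiv.arrowCongr (pE π) (Equiv.refl ℕ) f with hf'
  have hf : ∀ e, f' (pE π e) = f e := fun e => by simp [hf', Equiv.arrowCongr]
  have h1 : dgx f' = dgx f := by
    rw [dgx, dgx, ← Equiv.sum_comp (pE π)]
    simp only [hf, isX_pE]
  have h2 : dgy f' = dgy f := by
    rw [dgy, dgy, ← Equiv.sum_comp (pE π)]
    simp only [hf, isY_pE]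
  have h3 : ∀ v, bd f' (π v) = bd f v := fun v => by
    rw [bd, bd, ← Equiv.sum_comp (pE π)]
    simp only [hf, inc_pE]
  have h4 : bd f' = 0 ↔ bd f = 0 := by
    constructor
    · intro h; funext v; rw [← h3, h]; rfl
    · intro h; funext v
      have := h3 (π.symm v)
      rw [Equiv.apply_symm_apply] at this
      rw [this, h]; rfl
  have h5 : (∀ e, e ∉ G.map (pE π).toEmbedding → f' e = 0) ↔ ∀ e, e ∉ G → f e = 0 := by
    constructor
    · intro h e he
      rw [← hf]
      refine h _ fun h' => he ?_
      rwa [← Equiv.coe_toEmbedding, Finset.mem_map'] at h'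
    · intro h e he
      have := hf ((pE π).symm e)
      rw [Equiv.apply_symm_apply] at this
      rw [this]
      refine h _ fun h' => he ?_
      exact Finset.mem_map.mpr ⟨_, h', by simp⟩
  rw [h1, h2, h4, h5]
variable {κ : Type*} [Field κ] {L : Loc κ}
theorem vC_map (m : ℕ) (π : Equiv.Perm V6) (C : Finset E6) :
    vC L m (C.map (pE π).toEmbedding) = vC L m C := by
  unfold vC
  rw [Hf_map]
theorem step_pE (π : Equiv.Perm V6) (e : E6) (a : ℤ) : step L (pE π e) a = step L e a := by
  cases e <;> rfl
theorem yv_pE (π : Equiv.Perm V6) (c : V6 → ℤ) (e : E6) : yv L c (pE π e) = yv L (c ∘ π) e := by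
  rw [yv, yv, esrc_pE, etgt_pE]
  cases e <;> rfl
theorem Gs_map (π σ : Equiv.Perm V6) :
    Gs (π * σ * π⁻¹) = (Gs σ).map (pE π).toEmbedding := by
  ext e
  obtain ⟨e, rfl⟩ := (pE π).surjective e
  rw [← Equiv.coe_toEmbedding, Finset.mem_map', mem_Gs, mem_Gs]
  simp [esrc_pE, etgt_pE, isX_pE]
theorem Cc_map (π σ : Equiv.Perm V6) (c : V6 → ℤ) :
    Cc L (π * σ * π⁻¹) c = (Cc L σ (c ∘ π)).map (pE π).toEmbedding := by
  ext e
  obtain ⟨e, rfl⟩ := (pE π).surjective e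
  rw [← Equiv.coe_toEmbedding, Finset.mem_map', mem_Cc, mem_Cc, Gs_map,
    Finset.mem_map', Equiv.coe_toEmbedding, esrc_pE, etgt_pE, step_pE]
  rfl
theorem Cc_sub (σ : Equiv.Perm V6) (c : V6 → ℤ) : Cc L σ c ⊆ Gs σ := fun _ he => (mem_Cc.mp he).1
theorem wC_map (m : ℕ) (π σ : Equiv.Perm V6) (c : V6 → ℤ) :
    wC L m (π * σ * π⁻¹) (Gs (π * σ * π⁻¹)) c = wC L m σ (Gs σ) (c ∘ π) := by
  by_cases h : (Cc L σ (c ∘ π)).card = m + 5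
  · rw [wC_pos (Cc_sub _ _) h, wC_pos (Cc_sub _ _) (by rw [Cc_map, Finset.card_map, h]), Gs_map,
      Cc_map, vC_map, ← Finset.map_sdiff, Finset.prod_map]
    simp only [Equiv.coe_toEmbedding, yv_pE]
  · rw [wC_card h, wC_card]
    rwa [Cc_map, Finset.card_map]
variable (L) in
def Ctr (m : ℕ) (c : V6 → ℤ) : κ :=
  ∑ σ : Equiv.Perm V6, ((Equiv.Perm.sign σ : ℤ) : κ) * wC L m σ (Gs σ) c
theorem Ctr_map (m : ℕ) (π : Equiv.Perm V6) (c : V6 → ℤ) : Ctr L m (c ∘ π) = Ctr L m c := by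
  unfold Ctr
  refine Fintype.sum_equiv (MulAut.conj π).toEquiv _ _ fun σ => ?_
  have : (MulAut.conj π).toEquiv σ = π * σ * π⁻¹ := rfl
  rw [this, wC_map]
  congr 2
  simp only [map_mul, map_inv]
  rw [mul_comm (Equiv.Perm.sign π), mul_assoc, mul_inv_cancel, mul_one]
theorem prod_Gs (σ : Equiv.Perm V6) (F : E6 → κ) :
    ∏ e ∈ Gs σ, F e = (∏ i, F (Sum.inl (i, σ i))) * ∏ ij, F (Sum.inr ij) := by
  have : Gs σ = Finset.univ.map ⟨fun i => (Sum.inl (i, σ i) : E6), fun i j h => by simpa using h⟩ ∪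
      Finset.univ.map ⟨Sum.inr, Sum.inr_injective⟩ := by
    ext e
    rcases e with ⟨i, j⟩ | ij
    · rw [mem_Gs_inl]
      simp only [Finset.mem_union, Finset.mem_map, Finset.mem_univ, true_and,
        Function.Embedding.coeFn_mk]
      constructor
      · rintro rfl
        exact Or.inl ⟨i, rfl⟩
      · rintro (⟨a, h⟩ | ⟨a, h⟩)
        · cases h; rfl
        · cases h
    · simp [mem_Gs_inr]
  rw [this, Finset.prod_union, Finset.prod_map, Finset.prod_map]
  · rfl
  · rw [Finset.disjoint_left]
    intro e h1 h2
    obtain ⟨i, -, rfl⟩ := Finset.mem_map.mp h1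
    obtain ⟨ij, -, h⟩ := Finset.mem_map.mp h2
    cases h
def iv (L : Loc κ) (c : V6 → ℤ) (e : E6) : κ :=
  if c (etgt e) = step L e (c (esrc e)) then 1 else (1 - yv L c e)⁻¹
theorem iv_inl (c : V6 → ℤ) (i j : V6) : iv L c (Sum.inl (i, j)) =
    if c j = L.xs (c i) then 1 else (1 - L.ev qs * L.val (c i) / L.val (c j))⁻¹ := rfl
theorem iv_inr (c : V6 → ℤ) (i j : V6) : iv L c (Sum.inr (i, j)) =
    if c j = L.ys (c i) then 1 else (1 - L.ev qt * L.val (c i) / L.val (c j))⁻¹ := rfl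
theorem wC_full (m : ℕ) (σ : Equiv.Perm V6) (c : V6 → ℤ) : wC L m σ (Gs σ) c =
    if (Cc L σ c).card = m + 5 then vC L m (Cc L σ c) *
      ((∏ i, iv L c (Sum.inl (i, σ i))) * ∏ ij, iv L c (Sum.inr ij)) else 0 := by
  split_ifs with h
  · rw [wC_pos (Cc_sub σ c) h, ← prod_Gs]
    congr 1
    rw [← Finset.prod_sdiff (Cc_sub (L := L) σ c)]
    rw [Finset.prod_congr rfl (s₁ := Cc L σ c) (g := fun _ => 1), Finset.prod_const_one, mul_one]
    · refine Finset.prod_congr rfl fun e he => ?_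
      rw [iv, if_neg]
      intro h'
      obtain ⟨h1, h2⟩ := Finset.mem_sdiff.mp he
      exact h2 (mem_Cc.mpr ⟨h1, h'⟩)
    · intro e he
      rw [iv, if_pos (mem_Cc.mp he).2]
  · exact wC_card h
theorem Ctr_zero_of [CharZero κ] {m : ℕ} {c : V6 → ℤ} (T : Equiv.Perm V6 ≃ Equiv.Perm V6)
    (hT : ∀ σ, Equiv.Perm.sign (T σ) = - Equiv.Perm.sign σ)
    (h1 : ∀ σ, Cc L (T σ) c = Cc L σ c)
    (h2 : ∀ σ, ∏ i, iv L c (Sum.inl (i, T σ i)) = ∏ i, iv L c (Sum.inl (i, σ i))) :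
    Ctr L m c = 0 := by
  have : Ctr L m c = - Ctr L m c := by
    conv_lhs => rw [Ctr, ← Equiv.sum_comp T]
    rw [Ctr, ← Finset.sum_neg_distrib]
    refine Finset.sum_congr rfl fun σ _ => ?_
    rw [hT, wC_full, wC_full, h1, h2]
    push_cast
    ring
  exact self_eq_neg.mp this
theorem Ctr_zero1 [CharZero κ] {m : ℕ} {c : V6 → ℤ} {i j : V6} (hij : i ≠ j) (hc : c i = c j)
    (h : ∀ k, L.xs (c k) ≠ c i) : Ctr L m c = 0 := by
  have hcs : ∀ k, c (Equiv.swap i j k) = c k := by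
    intro k
    by_cases h1 : k = i
    · rw [h1, Equiv.swap_apply_left, hc]
    by_cases h2 : k = j
    · rw [h2, Equiv.swap_apply_right, hc]
    rw [Equiv.swap_apply_of_ne_of_ne h1 h2]
  refine Ctr_zero_of (Equiv.mulLeft (Equiv.swap i j)) (fun σ => ?_) (fun σ => ?_) fun σ => ?_
  · simp [Equiv.Perm.sign_swap hij]
  · ext e
    rw [mem_Cc, mem_Cc, mem_Gs, mem_Gs]
    refine and_congr_left fun hce => or_congr_right' fun hx => ?_
    have hx' : step L e (c (esrc e)) = L.xs (c (esrc e)) := by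
      cases e
      · rfl
      · exact absurd rfl hx
    rw [hx'] at hce
    have hne : ∀ a, c a = c i → etgt e ≠ a := fun a ha h' => h (esrc e) (by rw [← hce, h', ha])
    have h1 := hne i rfl
    have h2 := hne j hc.symm
    simp only [Equiv.coe_mulLeft, Equiv.Perm.mul_apply]
    rw [eq_comm, Equiv.swap_apply_eq_iff, Equiv.swap_apply_of_ne_of_ne h1 h2, eq_comm]
  · refine Finset.prod_congr rfl fun k _ => ?_
    simp only [iv_inl, Equiv.coe_mulLeft, Equiv.Perm.mul_apply, hcs]
theorem Ctr_zero2 [CharZero κ] {m : ℕ} {c : V6 → ℤ} {i j : V6} (hij : i ≠ j) (hc : c i = c j)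
    (h : ∀ k, c k ≠ L.xs (c i)) : Ctr L m c = 0 := by
  have hcs : ∀ k, c (Equiv.swap i j k) = c k := by
    intro k
    by_cases h1 : k = i
    · rw [h1, Equiv.swap_apply_left, hc]
    by_cases h2 : k = j
    · rw [h2, Equiv.swap_apply_right, hc]
    rw [Equiv.swap_apply_of_ne_of_ne h1 h2]
  refine Ctr_zero_of (Equiv.mulRight (Equiv.swap i j)) (fun σ => ?_) (fun σ => ?_) fun σ => ?_
  · simp [Equiv.Perm.sign_swap hij]
  · ext e
    rw [mem_Cc, mem_Cc, mem_Gs, mem_Gs]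
    refine and_congr_left fun hce => or_congr_right' fun hx => ?_
    have hx' : step L e (c (esrc e)) = L.xs (c (esrc e)) := by
      cases e
      · rfl
      · exact absurd rfl hx
    rw [hx'] at hce
    have hne : ∀ a, c a = c i → esrc e ≠ a := fun a ha h' => h (etgt e) (by rw [hce, h', ha])
    have h1 := hne i rfl
    have h2 := hne j hc.symm
    simp only [Equiv.coe_mulRight, Equiv.Perm.mul_apply]
    rw [Equiv.swap_apply_of_ne_of_ne h1 h2]
  · rw [← Equiv.prod_comp (Equiv.swap i j)]
    refine Finset.prod_congr rfl fun k _ => ?_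
    simp only [iv_inl, Equiv.coe_mulRight, Equiv.Perm.mul_apply, hcs,
      Equiv.swap_apply_self]
def SS : PSQ := ∑ σ : Equiv.Perm V6, toPS ((Equiv.Perm.sign σ : ℤ) : RQ) * Hf (Gs σ)
theorem lead_SS {m : ℕ} (htab : TableOK L.xs L.ys m) :
    Lead L.ev L.p0 m SS (∑ c ∈ Phi L, Ctr L m c) := by
  have h := Lead.sum Finset.univ fun (σ : Equiv.Perm V6) _ =>
    (leadG (L := L) htab (Finset.Subset.refl (Gs σ))).mul_poly ((Equiv.Perm.sign σ : ℤ) : RQ)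
  simp only [Ctr, SS]
  rw [Finset.sum_comm]
  simp only [map_intCast, Finset.mul_sum] at h ⊢
  exact h
end relabel
section bits
def idx : E6 → ℕ
  | Sum.inl ij => 6 * ij.1.val + ij.2.val
  | Sum.inr ij => 36 + (6 * ij.1.val + ij.2.val)
def dec (n : ℕ) : E6 :=
  if n < 36 then Sum.inl (⟨n % 36 / 6, by omega⟩, ⟨n % 6, by omega⟩)
  else Sum.inr (⟨n % 36 / 6, by omega⟩, ⟨n % 6, by omega⟩)
def nsrc (n : ℕ) : ℕ := (n % 36) / 6
def ntgt (n : ℕ) : ℕ := n % 6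
theorem dec_idx (e : E6) : dec (idx e) = e := by
  rcases e with ⟨i, j⟩ | ⟨i, j⟩
  · have : 6 * i.val + j.val < 36 := by omega
    refine (if_pos this).trans ?_
    congr 2 <;> apply Fin.ext <;> simp only [idx] <;> omega
  · have : ¬ (36 + (6 * i.val + j.val) < 36) := by omega
    refine (if_neg this).trans ?_
    congr 2 <;> apply Fin.ext <;> simp only [idx] <;> omega
theorem idx_dec {n : ℕ} (hn : n < 72) : idx (dec n) = n := by
  unfold dec
  split_ifs <;> simp only [idx] <;> omega
theorem idx_inj {e e' : E6} (h : idx e = idx e') : e = e' := by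
  rw [← dec_idx e, h, dec_idx]
theorem esrc_dec (n : ℕ) : (esrc (dec n)).val = nsrc n := by
  unfold dec
  split_ifs <;> rfl
theorem etgt_dec (n : ℕ) : (etgt (dec n)).val = ntgt n := by
  unfold dec
  split_ifs <;> rfl
def setOf' (G : ℕ) : Finset E6 := Finset.univ.filter fun e => G.testBit (idx e) = true
theorem mem_setOf' {G : ℕ} {e : E6} : e ∈ setOf' G ↔ G.testBit (idx e) = true := by simp [setOf']
def del (G n : ℕ) : ℕ := Nat.xor G (Nat.land G (2 ^ n))
theorem testBit_diff (G M n : ℕ) : (Nat.xor G (Nat.land G M)).testBit n = (G.testBit n && !M.testBit n) := by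
  have h1 : Nat.xor G (Nat.land G M) = G ^^^ (G &&& M) := rfl
  rw [h1, Nat.testBit_xor, Nat.testBit_and]
  cases G.testBit n <;> cases M.testBit n <;> rfl
theorem setOf'_del (G : ℕ) {n : ℕ} (hn : n < 72) : setOf' (del G n) = setOf' G \ {dec n} := by
  ext e
  rw [Finset.mem_sdiff, mem_setOf', mem_setOf', del, testBit_diff, Finset.mem_singleton,
    Bool.and_eq_true, Bool.not_eq_true', Nat.testBit_two_pow]
  refine and_congr_right fun _ => ?_
  rw [decide_eq_false_iff_not]
  refine not_congr ⟨fun h => ?_, fun h => ?_⟩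
  · rw [h, dec_idx]
  · rw [h, idx_dec hn]
def prn (o i G : ℕ) : ℕ := bif Nat.beq (Nat.land G o) 0 then Nat.xor G (Nat.land G i) else G
def prn6 (G : ℕ) : ℕ := prn 4329327034431 74958198140788019265 (prn 277076930203584 149916396281576038530
  (prn 17732923533029376 299832792563152077060 (prn 1134907106113880064 599665585126304154120
  (prn 72634054791288324096 1199331170252608308240 (prn 4648579506642452742144 2398662340505216616480 G)))))
def force {α : Type} (n : ℕ) (f : ℕ → α) : α := Nat.rec (f 0) (fun k _ => f (k+1)) n
theorem force_eq {α : Type} (n : ℕ) (f : ℕ → α) : force n f = f n := by cases n <;> rfl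
def acycF : ℕ → ℕ → Bool
  | 0, G => Nat.beq G 0
  | n + 1, G => bif Nat.beq G 0 then true else force (prn6 G) (acycF n)
theorem prn_pc {o i G : ℕ} (v : V6) (ho : ∀ e : E6, esrc e = v → o.testBit (idx e) = true)
    (hi : ∀ e : E6, i.testBit (idx e) = true → etgt e = v) {p : Finset E6} (hp : IsPC p)
    (hpG : p ⊆ setOf' G) : p ⊆ setOf' (prn o i G) := by
  unfold prn
  cases hb : Nat.beq (Nat.land G o) 0 with
  | false => exact hpG
  | true =>
    have hz : G &&& o = 0 := Nat.eq_of_beq_eq_true hb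
    have hout : ∀ e ∈ p, esrc e ≠ v := by
      intro e he h
      have h1 := ho e h
      have h2 := mem_setOf'.mp (hpG he)
      have h3 : (G &&& o).testBit (idx e) = true := by rw [Nat.testBit_and, h1, h2]; rfl
      rw [hz] at h3
      simp at h3
    have hin : ∀ e ∈ p, etgt e ≠ v := by
      have h := congrFun hp.2.1 v
      rw [bd, sum_ind_mul] at h
      simp only [inc, Finset.sum_sub_distrib, Pi.zero_apply] at h
      rw [Finset.sum_eq_zero (s := p) (f := fun e => if esrc e = v then (1 : ℤ) else 0)
        (fun e he => if_neg (hout e he)), zero_sub, neg_eq_zero] at h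
      intro e he hev
      have := (Finset.sum_eq_zero_iff_of_nonneg (fun e _ => by split_ifs <;> simp)).mp h e he
      rw [if_pos hev] at this
      exact one_ne_zero this
    intro e he
    show e ∈ setOf' (Nat.xor G (Nat.land G i))
    rw [mem_setOf', testBit_diff, mem_setOf'.mp (hpG he)]
    cases hi' : i.testBit (idx e) with
    | false => rfl
    | true => exact absurd (hi e hi') (hin e he)
theorem prn6_pc {G : ℕ} {p : Finset E6} (hp : IsPC p) (hpG : p ⊆ setOf' G) : p ⊆ setOf' (prn6 G) := by
  unfold prn6
  refine prn_pc 0 (by decide +kernel) (by decide +kernel) hp ?_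
  refine prn_pc 1 (by decide +kernel) (by decide +kernel) hp ?_
  refine prn_pc 2 (by decide +kernel) (by decide +kernel) hp ?_
  refine prn_pc 3 (by decide +kernel) (by decide +kernel) hp ?_
  refine prn_pc 4 (by decide +kernel) (by decide +kernel) hp ?_
  exact prn_pc 5 (by decide +kernel) (by decide +kernel) hp hpG
theorem setOf'_zero : setOf' 0 = ∅ := by
  ext e; simp [mem_setOf']
theorem acycF_noPC {n G : ℕ} (h : acycF n G = true) : ∀ p, IsPC p → ¬ p ⊆ setOf' G := by
  intro p hp hpG
  have h0 : ∀ G, Nat.beq G 0 = true → p ⊆ setOf' G → False := by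
    intro G hG hs
    rw [Nat.eq_of_beq_eq_true hG, setOf'_zero, Finset.subset_empty] at hs
    exact hp.1.ne_empty hs
  induction n generalizing G with
  | zero => exact h0 G h hpG
  | succ n ih =>
    rw [acycF] at h
    cases hb : Nat.beq G 0 with
    | true => exact h0 G hb hpG
    | false =>
      rw [hb, cond_false, force_eq] at h
      exact ih h (prn6_pc hp hpG)
end bits
section vol
def addO : Option ℤ → Option ℤ → Option ℤ
  | some a, some b => some (a + b)
  | _, _ => none
def subO : Option ℤ → Option ℤ → Option ℤ
  | some a, some b => some (a - b)
  | _, _ => none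
def mulO (k : ℤ) : Option ℤ → Option ℤ
  | none => none
  | some z => some (k * z)
theorem addO_eq {x y : Option ℤ} {z : ℤ} (h : addO x y = some z) : ∃ a b, x = some a ∧ y = some b ∧ z = a + b := by
  cases x with
  | none => cases h
  | some a => cases y with
    | none => cases h
    | some b => exact ⟨a, b, rfl, rfl, by simpa [addO] using h.symm⟩
theorem subO_eq {x y : Option ℤ} {z : ℤ} (h : subO x y = some z) : ∃ a b, x = some a ∧ y = some b ∧ z = a - b := by
  cases x with
  | none => cases h
  | some a => cases y with
    | none => cases h
    | some b => exact ⟨a, b, rfl, rfl, by simpa [subO] using h.symm⟩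
theorem mulO_eq {x : Option ℤ} {k z : ℤ} (h : mulO k x = some z) : ∃ a, x = some a ∧ z = k * a := by
  cases x with
  | none => cases h
  | some a => exact ⟨a, rfl, by simpa [mulO] using h.symm⟩
def DLv (f : ℕ → Option ℤ) : List ℕ → ℕ → Option ℤ
  | [], G => f G
  | n :: l, G => subO (DLv f l G) (DLv f l (del G n))
def ELv (f : ℕ → Option ℤ) : List ℕ → ℕ → Option ℤ
  | [], _ => some 0
  | n :: l, G => addO (ELv f l G) (DLv f l (del G n))
def findC : List (List ℕ × ℤ × ℕ) → ℕ → Option (List ℕ × ℤ)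
  | [], _ => none
  | (l, k, M) :: cs, G => bif Nat.beq (Nat.land G M) M then some (l, k) else findC cs G
def Wv (cs : List (List ℕ × ℤ × ℕ)) (m : ℕ) : ℕ → Option ℤ :=
  Nat.rec (fun _ => some 1) (fun m ih G => force G fun G => match findC cs G with
    | none => bif acycF 6 G then some 0 else none
    | some (l, k) => bif Nat.beq m 0 then some k else mulO k (ELv ih l G)) m
theorem Wv_succ (cs : List (List ℕ × ℤ × ℕ)) (m G : ℕ) : Wv cs (m + 1) G = match findC cs G with
    | none => bif acycF 6 G then some 0 else none
    | some (l, k) => bif Nat.beq m 0 then some k else mulO k (ELv (Wv cs m) l G) := by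
  have := force_eq G (fun G => match findC cs G with
    | none => bif acycF 6 G then some 0 else none
    | some (l, k) => bif Nat.beq m 0 then some k else mulO k (ELv (Wv cs m) l G))
  exact this
def mkMask : List ℕ → ℕ
  | [] => 0
  | n :: l => Nat.lor (2 ^ n) (mkMask l)
def okC (A B : ℕ) (x : List ℕ × ℤ × ℕ) : Bool :=
  (x.1.all fun n => Nat.blt n 72 && x.2.2.testBit n) && decide ((x.1.map nsrc).Nodup) &&
    decide ((x.1.map nsrc).Perm (x.1.map ntgt)) && (match x.2.1 with
      | Int.ofNat k => Nat.beq (k * (x.1.countP fun n => Nat.blt n 36)) (A * 6) &&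
        Nat.beq (k * (x.1.countP fun n => !Nat.blt n 36)) (B * 6) && 
        (Nat.beq k 1 || Nat.beq k 2 || Nat.beq k 3 || Nat.beq k 6)
      | Int.negSucc _ => false)
theorem testBit_of_land {G M n : ℕ} (h : Nat.beq (Nat.land G M) M = true) (hn : M.testBit n = true) :
    G.testBit n = true := by
  have h1 : G &&& M = M := Nat.eq_of_beq_eq_true h
  rw [← h1, Nat.testBit_and] at hn
  exact (Bool.and_eq_true_iff.mp hn).1
theorem findC_spec {cs : List (List ℕ × ℤ × ℕ)} {G : ℕ} {l : List ℕ} {k : ℤ} (h : findC cs G = some (l, k)) :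
    ∃ M, (l, k, M) ∈ cs ∧ Nat.beq (Nat.land G M) M = true := by
  induction cs with
  | nil => cases h
  | cons x cs ih =>
    obtain ⟨l', k', M⟩ := x
    rw [findC] at h
    cases hb : Nat.beq (Nat.land G M) M with
    | true =>
      rw [hb, cond_true, Option.some.injEq, Prod.mk.injEq] at h
      obtain ⟨rfl, rfl⟩ := h
      exact ⟨M, List.mem_cons_self, hb⟩
    | false =>
      rw [hb, cond_false] at h
      obtain ⟨M', h1, h2⟩ := ih h
      exact ⟨M', List.mem_cons_of_mem _ h1, h2⟩
def DHf : List E6 → Finset E6 → PSQ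
  | [], G => Hf G
  | n :: l, G => DHf l G - DHf l (G \ {n})
def EHf : List E6 → Finset E6 → PSQ
  | [], _ => 0
  | n :: l, G => EHf l G + DHf l (G \ {n})
theorem EHf_eq (l : List E6) (G : Finset E6) : EHf l G = Hf G - DHf l G := by
  induction l with
  | nil => simp [EHf, DHf]
  | cons n l ih => rw [EHf, DHf, ih]; ring
theorem DHf_eq {l : List E6} (hl : l.Nodup) (G : Finset E6) :
    DHf l G = ∑ S ∈ l.toFinset.powerset, toPS ((-1) ^ S.card) * Hf (G \ S) := by
  induction l generalizing G with
  | nil => simp [DHf]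
  | cons n l ih =>
    obtain ⟨h1, h2⟩ := List.nodup_cons.mp hl
    have h1' : n ∉ l.toFinset := by simpa using h1
    rw [DHf, ih h2, ih h2, List.toFinset_cons, Finset.sum_powerset_insert h1', sub_eq_add_neg,
      ← Finset.sum_neg_distrib]
    congr 1
    refine Finset.sum_congr rfl fun S hS => ?_
    have : n ∉ S := fun h => h1' (Finset.mem_powerset.mp hS h)
    rw [Finset.card_insert_of_notMem this, sdiff_sdiff_left, pow_succ]
    have h3 : ({n} ⊔ S : Finset E6) = insert n S := rfl
    rw [h3]
    simp
theorem EHf_rec {l : List E6} (hl : l.Nodup) {G : Finset E6} (hc : bd (ind l.toFinset) = 0)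
    (hcG : l.toFinset ⊆ G) : toPS (1 - xm l.toFinset) * Hf G = EHf l G := by
  rw [EHf_eq, DHf_eq hl, ← Hf_rec0 hc hcG, map_sub, map_one]
  ring
variable {κ : Type*} [Field κ] [CharZero κ] {L : Loc κ}
theorem Lead.sub {ev : RQ →+* κ} {p0 : RQ} {k : ℕ} {h h' : PSQ} {c c' : κ} (H : Lead ev p0 k h c)
    (H' : Lead ev p0 k h' c') : Lead ev p0 k (h - h') (c - c') := by
  have := H.add (H'.mul_poly (-1))
  simp only [map_neg, map_one, neg_mul, one_mul] at this
  rwa [← sub_eq_add_neg, ← sub_eq_add_neg] at this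
theorem DLv_lead {m : ℕ} {f : ℕ → Option ℤ} {l : List ℕ} {G : ℕ} {z : ℤ} (hl : ∀ n ∈ l, n < 72)
    (H : ∀ G' z', setOf' G' ⊆ setOf' G → f G' = some z' → Lead L.ev L.p0 m (Hf (setOf' G')) (z' / 6 ^ m))
    (h : DLv f l G = some z) : Lead L.ev L.p0 m (DHf (l.map dec) (setOf' G)) (z / 6 ^ m) := by
  induction l generalizing G z with
  | nil => exact H G z (Finset.Subset.refl _) h
  | cons n l ih =>
    obtain ⟨a, b, ha, hb, rfl⟩ := subO_eq h
    rw [List.map_cons, DHf]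
    have hn := hl n List.mem_cons_self
    have hl' : ∀ n ∈ l, n < 72 := fun k hk => hl k (List.mem_cons_of_mem _ hk)
    have h1 := ih hl' H ha
    have h2 := ih (G := del G n) hl' (fun G' z' hs => H G' z' (hs.trans (by
      rw [setOf'_del G hn]; exact Finset.sdiff_subset))) hb
    rw [setOf'_del G hn] at h2
    have := h1.sub h2
    push_cast
    rwa [sub_div]
theorem ELv_lead {m : ℕ} {f : ℕ → Option ℤ} {l : List ℕ} {G : ℕ} {z : ℤ} (hl : ∀ n ∈ l, n < 72)
    (H : ∀ n ∈ l, ∀ G' z', setOf' G' ⊆ setOf' G \ {dec n} → f G' = some z' →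
      Lead L.ev L.p0 m (Hf (setOf' G')) (z' / 6 ^ m))
    (h : ELv f l G = some z) : Lead L.ev L.p0 m (EHf (l.map dec) (setOf' G)) (z / 6 ^ m) := by
  induction l generalizing z with
  | nil =>
    have : z = 0 := by simpa [ELv] using h.symm
    subst this
    simpa [EHf] using Lead.zero m
  | cons n l ih =>
    obtain ⟨a, b, ha, hb, rfl⟩ := addO_eq h
    rw [List.map_cons, EHf]
    have hn := hl n List.mem_cons_self
    have hl' : ∀ n ∈ l, n < 72 := fun k hk => hl k (List.mem_cons_of_mem _ hk)
    have h1 := ih hl' (fun k hk => H k (List.mem_cons_of_mem _ hk)) ha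
    have h2 := DLv_lead (L := L) (m := m) (f := f) (G := del G n) hl' (fun G' z' hs => H n List.mem_cons_self G' z' (by
      rwa [setOf'_del G hn] at hs)) hb
    rw [setOf'_del G hn] at h2
    have := h1.add h2
    push_cast
    rwa [add_div]
theorem DLv_const {l : List ℕ} (hl : l ≠ []) (G : ℕ) : DLv (fun _ => some 1) l G = some 0 := by
  induction l generalizing G with
  | nil => exact absurd rfl hl
  | cons n l ih =>
    rw [DLv]
    cases l with
    | nil => rfl
    | cons k l => rw [ih (by simp), ih (by simp)]; rfl
theorem ELv_const {l : List ℕ} (hl : l ≠ []) (G : ℕ) : ELv (fun _ => some 1) l G = some 1 := by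
  induction l with
  | nil => exact absurd rfl hl
  | cons n l ih =>
    rw [ELv]
    cases l with
    | nil => rfl
    | cons k l => rw [ih (by simp), DLv_const (by simp)]; rfl
theorem okC_bd {l : List ℕ} (h1 : (l.map nsrc).Nodup) (h2 : (l.map nsrc).Perm (l.map ntgt)) :
    (l.map dec).Nodup ∧ bd (ind (l.map dec).toFinset) = 0 := by
  have e1 : l.map nsrc = (l.map dec).map fun e => (esrc e).val := by
    rw [List.map_map]; exact List.map_congr_left fun n _ => (esrc_dec n).symm
  have e2 : l.map ntgt = (l.map dec).map fun e => (etgt e).val := by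
    rw [List.map_map]; exact List.map_congr_left fun n _ => (etgt_dec n).symm
  rw [e1] at h1 h2
  rw [e2] at h2
  have hnd := h1.of_map
  refine ⟨hnd, ?_⟩
  funext v
  rw [bd, sum_ind_mul, List.sum_toFinset _ hnd]
  have h3 := (h2.map fun x => if x = v.val then (1 : ℤ) else 0).sum_eq
  have h4 : (List.map (fun e => inc e v) (l.map dec)).sum =
      (List.map (fun e => if esrc e = v then (1 : ℤ) else 0) (l.map dec)).sum -
      (List.map (fun e => if etgt e = v then (1 : ℤ) else 0) (l.map dec)).sum := by
    generalize l.map dec = l'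
    induction l' with
    | nil => rfl
    | cons e l' ih => rw [List.map_cons, List.sum_cons, ih, List.map_cons, List.map_cons, List.sum_cons, List.sum_cons, inc]; ring
  rw [h4, Pi.zero_apply, sub_eq_zero]
  simpa only [List.map_map, Function.comp_def, Fin.val_inj] using h3
theorem dg_list {l : List ℕ} (hl : ∀ n ∈ l, n < 72) (hnd : (l.map dec).Nodup) :
    dgx (ind (l.map dec).toFinset) = l.countP (fun n => Nat.blt n 36) ∧
    dgy (ind (l.map dec).toFinset) = l.countP (fun n => !Nat.blt n 36) := by
  have key : ∀ F : E6 → ℕ, ∑ e, ind (l.map dec).toFinset e * F e = (l.map fun n => F (dec n)).sum := by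
    intro F
    have : ∑ e, ind (l.map dec).toFinset e * F e = ∑ e ∈ (l.map dec).toFinset, F e := by
      simp only [ind, ite_mul, one_mul, zero_mul, Finset.sum_ite_mem, Finset.univ_inter]
    rw [this, List.sum_toFinset _ hnd, List.map_map]
    rfl
  rw [dgx, dgy, key, key]
  clear key hnd hl
  constructor
  · induction l with
    | nil => rfl
    | cons n l ih =>
      rw [List.map_cons, List.sum_cons, List.countP_cons, ih, add_comm]
      congr 1
      by_cases h : n < 36
      · simp [dec, h, isX]
      · simp [dec, h, isX]
  · induction l with
    | nil => rfl
    | cons n l ih =>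
      rw [List.map_cons, List.sum_cons, List.countP_cons, ih, add_comm]
      congr 1
      by_cases h : n < 36
      · simp [dec, h, isY]
      · simp [dec, h, isY]
theorem finrank_pos_of_PC {c G : Finset E6} (hc : IsPC c) (hcG : c ⊆ G) : 0 < Module.finrank ℚ (Wsp G) :=
  lt_of_le_of_lt (Nat.zero_le _) (Wsp_lt hc.2.1 hcG (S := c)
    (Finset.mem_erase.mpr ⟨hc.1.ne_empty, Finset.mem_powerset_self c⟩))
theorem Wv_lead {A B : ℕ} (hp0 : L.p0 = 1 - qs ^ A * qt ^ B) (hAB : 0 < A) {cs : List (List ℕ × ℤ × ℕ)}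
    (hcs : ∀ x ∈ cs, okC A B x = true) {m G : ℕ} {z : ℤ}
    (hr : Module.finrank ℚ (Wsp (setOf' G)) ≤ m) (h : Wv cs m G = some z) :
    Lead L.ev L.p0 m (Hf (setOf' G)) (z / 6 ^ m) := by
  induction m generalizing G z with
  | zero =>
    have hz : z = 1 := by
      have : some (1 : ℤ) = some z := h
      simpa using this.symm
    rw [Hf_noPC fun c hc hcG => by have := finrank_pos_of_PC hc hcG; omega, hz]
    simpa using Lead.one
  | succ m ih =>
    rw [Wv_succ] at h
    cases hf : findC cs G with
    | none =>
      rw [hf] at h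
      cases ha : acycF 6 G with
      | false => simp [ha] at h
      | true =>
        simp only [ha, cond_true, Option.some.injEq] at h
        subst h
        rw [Hf_noPC (acycF_noPC ha)]
        simpa using (Lead.one (ev := L.ev) (p0 := L.p0)).lt L.h0 (Nat.succ_pos m)
    | some x =>
      obtain ⟨l, k⟩ := x
      rw [hf] at h
      obtain ⟨M, hM, hG⟩ := findC_spec hf
      have hok := hcs _ hM
      simp only [okC, Bool.and_eq_true, List.all_eq_true, decide_eq_true_eq] at hok
      obtain ⟨⟨⟨h1, h2⟩, h3⟩, h4⟩ := hok
      cases k with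
      | negSucc k => simp at h4
      | ofNat k =>
      simp only [Bool.and_eq_true, Bool.or_eq_true] at h4
      obtain ⟨⟨h4, h5⟩, h6⟩ := h4
      have h4 := Nat.eq_of_beq_eq_true h4
      have h5 := Nat.eq_of_beq_eq_true h5
      have hl : ∀ n ∈ l, n < 72 := fun n hn => by simpa using (h1 n hn).1
      obtain ⟨hnd, hbd⟩ := okC_bd h2 h3
      obtain ⟨hdx, hdy⟩ := dg_list hl hnd
      have hsub : (l.map dec).toFinset ⊆ setOf' G := by
        intro e he
        obtain ⟨n, hn, rfl⟩ := List.mem_map.mp (List.mem_toFinset.mp he)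
        rw [mem_setOf', idx_dec (hl n hn)]
        exact testBit_of_land hG (h1 n hn).2
      have hne : l ≠ [] := by
        rintro rfl
        simp at h4
        omega
      have hEL : ∃ z', ELv (Wv cs m) l G = some z' ∧ z = (k : ℤ) * z' := by
        cases hm : Nat.beq m 0 with
        | true =>
          simp only [hm, cond_true, Option.some.injEq] at h
          have hm0 : m = 0 := Nat.eq_of_beq_eq_true hm
          subst hm0
          exact ⟨1, ELv_const hne G, by simpa using h.symm⟩
        | false =>
          simp only [hm, cond_false] at h
          exact mulO_eq h
      obtain ⟨z', hz', rfl⟩ := hEL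
      have hlead := ELv_lead (L := L) (m := m) hl (fun n hn G' z'' hs hz => by
        refine ih ?_ hz
        have h7 := Submodule.finrank_mono (Wsp_mono hs)
        have h8 := Wsp_lt hbd hsub (S := {dec n}) (by simpa using ⟨n, hn, rfl⟩)
        omega) hz'
      rw [← EHf_rec hnd hbd hsub] at hlead
      obtain ⟨j, hj, hk⟩ : ∃ j : ℕ, 0 < j ∧ k * j = 6 := by
        rcases h6 with ((h6 | h6) | h6) | h6 <;> have h6 := Nat.eq_of_beq_eq_true h6 <;> subst h6
        exacts [⟨6, by norm_num⟩, ⟨3, by norm_num⟩, ⟨2, by norm_num⟩, ⟨1, by norm_num⟩]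
      have hk0 : 0 < k := Nat.pos_of_ne_zero (by rintro rfl; simp at hk)
      have hx : dgx (ind (l.map dec).toFinset) = A * j := by
        rw [hdx]; apply Nat.eq_of_mul_eq_mul_left hk0; rw [h4, ← hk]; ring
      have hy : dgy (ind (l.map dec).toFinset) = B * j := by
        rw [hdy]; apply Nat.eq_of_mul_eq_mul_left hk0; rw [h5, ← hk]; ring
      have hu1 : L.ev (qs ^ A * qt ^ B) = 1 := by
        have := L.h0
        rw [hp0, map_sub, map_one, sub_eq_zero] at this
        exact this.symm
      have hgeom : 1 - xm (l.map dec).toFinset =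
          L.p0 * ∑ i ∈ Finset.range j, (qs ^ A * qt ^ B) ^ i := by
        rw [xm, hx, hy, hp0, pow_mul, pow_mul, ← mul_pow, mul_neg_geom_sum]
      have hevv : L.ev (∑ i ∈ Finset.range j, (qs ^ A * qt ^ B) ^ i) = j := by
        rw [map_sum]
        simp [map_pow, hu1]
      have hj' : (j : κ) ≠ 0 := by exact_mod_cast hj.ne'
      have := Lead.div_good _ _ hgeom (by rw [hevv]; exact hj') hlead
      rw [hevv] at this
      convert this using 1
      have h6' : (6 : κ) = k * j := by exact_mod_cast hk.symm
      have hkk : (k : κ) ≠ 0 := by exact_mod_cast hk0.ne'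
      push_cast
      rw [pow_succ, div_div]
      rw [show (6 : κ) ^ m * 6 = (k : κ) * (6 ^ m * j) by rw [mul_left_comm, ← h6']]
      rw [mul_div_mul_left _ _ hkk]
end vol
section mkloc
variable (A B g : ℕ) (w η : ℂ)
def pev : RQ →+* ℂ := (MvPolynomial.aeval ![w ^ (B / g), η * (w ^ (A / g))⁻¹]).toRingHom
theorem pev_s : pev A B g w η qs = w ^ (B / g) := by
  simp [pev, qs]
theorem pev_t : pev A B g w η qt = η * (w ^ (A / g))⁻¹ := by
  simp [pev, qt]
def xsZ (c : ℤ) : ℤ := c + B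
def ysZ (c : ℤ) : ℤ := (c / g) * g + (c + 1) % g - A
def pval (c : ℤ) : ℂ := w ^ (c / (g : ℤ)) * η ^ c
def finOK : Prop := ∀ a < 7, ∀ b < 7, a + b ≤ 6 → 0 < a + b → B / g * a = A / g * b → g ∣ b →
  ∃ j < 7, 0 < j ∧ a = A * j ∧ b = B * j
variable {A B g w η}
theorem zpow_norm_inj (hw : 1 < ‖w‖) {a b : ℤ} (h : ‖w‖ ^ a = ‖w‖ ^ b) : a = b :=
  zpow_right_injective₀ (by linarith) (by linarith) h
def mkLoc (hw : 1 < ‖w‖) (hη : IsPrimitiveRoot η g) (hg : 0 < g) (hA : g ∣ A) (hB : g ∣ B)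
    (hfin : finOK A B g) : Loc ℂ where
  ev := pev A B g w η
  p0 := 1 - qs ^ A * qt ^ B
  h0 := by
    have hw0 : w ≠ 0 := fun h => by rw [h, norm_zero] at hw; linarith
    obtain ⟨A', rfl⟩ := hA
    obtain ⟨B', rfl⟩ := hB
    simp only [map_sub, map_one, map_mul, map_pow, pev_s, pev_t, Nat.mul_div_cancel_left _ hg]
    rw [mul_pow, pow_mul η, hη.pow_eq_one, one_pow, one_mul, ← pow_mul, inv_pow, ← pow_mul,
      show B' * (g * A') = A' * (g * B') by ring, mul_inv_cancel₀ (pow_ne_zero _ hw0), sub_self]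
  hs := by
    have hw0 : w ≠ 0 := fun h => by rw [h, norm_zero] at hw; linarith
    rw [pev_s]; exact pow_ne_zero _ hw0
  ht := by
    have hw0 : w ≠ 0 := fun h => by rw [h, norm_zero] at hw; linarith
    rw [pev_t]; exact mul_ne_zero (hη.ne_zero hg.ne') (inv_ne_zero (pow_ne_zero _ hw0))
  hgood := by
    have hw0 : w ≠ 0 := fun h => by rw [h, norm_zero] at hw; linarith
    intro a b hab hab0 h
    have h' := h
    have hn : ‖η‖ = 1 := hη.norm'_eq_one hg.ne'
    rw [map_mul, map_pow, map_pow, pev_s, pev_t, mul_pow, inv_pow, ← pow_mul, ← pow_mul] at h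
    have h1 : w ^ (B / g * a) * η ^ b = w ^ (A / g * b) := by
      have h2 : w ^ (A / g * b) ≠ 0 := pow_ne_zero _ hw0
      field_simp at h
      linear_combination h
    have h2 := congrArg norm h1
    rw [norm_mul, norm_pow, norm_pow, norm_pow, hn, one_pow, mul_one] at h2
    have h3 : B / g * a = A / g * b := pow_right_injective₀ (by linarith) (by linarith) h2
    rw [h3] at h1
    have h4 : η ^ b = 1 := by
      have h2 : w ^ (A / g * b) ≠ 0 := pow_ne_zero _ hw0
      exact mul_left_cancel₀ h2 (by rw [h1, mul_one])
    have h5 : g ∣ b := (hη.pow_eq_one_iff_dvd b).mp h4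
    obtain ⟨j, -, hj, rfl, rfl⟩ := hfin a (by omega) b (by omega) hab hab0 h3 h5
    obtain ⟨A', rfl⟩ := hA
    obtain ⟨B', rfl⟩ := hB
    have hu : pev (g * A') (g * B') g w η (qs ^ (g * A') * qt ^ (g * B')) = 1 := by
      simp only [map_mul, map_pow, pev_s, pev_t, Nat.mul_div_cancel_left _ hg]
      rw [mul_pow, pow_mul η, hη.pow_eq_one, one_pow, one_mul, ← pow_mul, inv_pow, ← pow_mul,
        show B' * (g * A') = A' * (g * B') by ring, mul_inv_cancel₀ (pow_ne_zero _ hw0)]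
    refine ⟨∑ i ∈ Finset.range j, (qs ^ (g * A') * qt ^ (g * B')) ^ i, ?_, ?_⟩
    · rw [mul_neg_geom_sum, pow_mul qs _ j, pow_mul qt _ j, mul_pow]
    · rw [map_sum]
      simp only [map_pow _ _ _, hu, one_pow, Finset.sum_const, Finset.card_range, nsmul_eq_mul, mul_one]
      exact_mod_cast hj.ne'
  xs := xsZ B
  ys := ysZ A g
  val := pval g w η
  val0 := by simp [pval]
  valx := by
    intro c
    have hw0 : w ≠ 0 := fun h => by rw [h, norm_zero] at hw; linarith
    have hη0 := hη.ne_zero hg.ne'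
    have hgz : (g : ℤ) ≠ 0 := by exact_mod_cast hg.ne'
    obtain ⟨B', rfl⟩ := hB
    rw [pev_s, Nat.mul_div_cancel_left _ hg, pval, pval, xsZ]
    push_cast
    rw [Int.add_mul_ediv_left _ _ hgz, zpow_add₀ hw0, zpow_add₀ hη0, _root_.zpow_mul]
    simp [hη.pow_eq_one]
    ring
  valy := by
    intro c
    have hw0 : w ≠ 0 := fun h => by rw [h, norm_zero] at hw; linarith
    have hη0 := hη.ne_zero hg.ne'
    have hgz : (g : ℤ) ≠ 0 := by exact_mod_cast hg.ne'
    have hgp : (0 : ℤ) < g := by exact_mod_cast hg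
    obtain ⟨A', rfl⟩ := hA
    have e1 : ysZ (g * A') g c / (g : ℤ) = c / g - A' := by
      have : ysZ (g * A') g c = (c + 1) % g + g * (c / g - A') := by rw [ysZ]; push_cast; ring
      rw [this, Int.add_mul_ediv_left _ _ hgz,
        Int.ediv_eq_zero_of_lt (Int.emod_nonneg _ hgz) (Int.emod_lt_of_pos _ hgp), zero_add]
    have e2 : ysZ (g * A') g c = c + 1 + g * (c / g - (c + 1) / g - A') := by
      rw [ysZ]
      have := Int.emod_add_mul_ediv (c + 1) g
      push_cast
      linear_combination this
    rw [pev_t, Nat.mul_div_cancel_left _ hg, pval, pval, e1, e2, zpow_add₀ hη0, _root_.zpow_mul η g,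
      zpow_sub₀ hw0, zpow_add₀ hη0, zpow_natCast, zpow_natCast, hη.pow_eq_one, _root_.one_zpow, zpow_one]
    field_simp
  valinj := by
    have hw0 : w ≠ 0 := fun h => by rw [h, norm_zero] at hw; linarith
    have hη0 := hη.ne_zero hg.ne'
    have hn : ‖η‖ = 1 := hη.norm'_eq_one hg.ne'
    intro c c' h
    have h2 := congrArg norm h
    simp only [pval, norm_mul, norm_zpow, hn, _root_.one_zpow, mul_one] at h2
    have h3 := zpow_norm_inj hw h2
    rw [pval, pval, h3] at h
    have h4 := mul_left_cancel₀ (zpow_ne_zero _ hw0) h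
    have h5 : η ^ (c - c') = 1 := by rw [zpow_sub₀ hη0, h4, div_self (zpow_ne_zero _ hη0)]
    have h6 := (hη.zpow_eq_one_iff_dvd _).mp h5
    have h7 : c % g = c' % g := Int.emod_eq_emod_iff_emod_sub_eq_zero.mpr (Int.emod_eq_zero_of_dvd h6)
    rw [← Int.emod_add_mul_ediv c g, ← Int.emod_add_mul_ediv c' g, h3, h7]
  valne := by
    have hw0 : w ≠ 0 := fun h => by rw [h, norm_zero] at hw; linarith
    have hη0 := hη.ne_zero hg.ne'
    intro c
    exact mul_ne_zero (zpow_ne_zero _ hw0) (zpow_ne_zero _ hη0)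
end mkloc
section natlists
variable (A B g off : ℕ)
def xsN (n : ℕ) : ℕ := n + B
def ysN (n : ℕ) : ℕ := n / g * g + (n + 1) % g - A
def sh (n : ℕ) : ℤ := (n : ℤ) - off
variable {A B g off}
theorem sh_inj : Function.Injective (sh off) := by
  intro a b h; simp only [sh] at h; omega
theorem sh_xs (n : ℕ) : sh off (xsN B n) = xsZ B (sh off n) := by
  simp only [sh, xsN, xsZ]; push_cast; ring
theorem sh_ys (hg : 0 < g) (hoff : g ∣ off) (hA : g ∣ A) {n : ℕ} (hn : A ≤ n) :
    sh off (ysN A g n) = ysZ A g (sh off n) := by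
  obtain ⟨o, rfl⟩ := hoff
  obtain ⟨A', rfl⟩ := hA
  have hgz : (g : ℤ) ≠ 0 := by exact_mod_cast hg.ne'
  have h1 : g * A' ≤ n / g * g := by
    have : A' ≤ n / g := (Nat.le_div_iff_mul_le hg).mpr (by rwa [mul_comm])
    nlinarith
  simp only [sh, ysN, ysZ]
  have h2 : ((n : ℤ) - ((g * o : ℕ) : ℤ)) / g = n / g - o := by
    push_cast
    rw [sub_eq_add_neg, ← mul_neg, Int.add_mul_ediv_left _ _ hgz]; ring
  have h3 : ((n : ℤ) - ((g * o : ℕ) : ℤ) + 1) % g = (n + 1) % g := by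
    push_cast
    rw [show (n : ℤ) - g * o + 1 = n + 1 + g * (-o) by ring, Int.add_mul_emod_self_left]
  rw [h2, h3, Nat.cast_sub (by omega)]
  push_cast
  ring
def insN (a : ℕ) : List ℕ → List ℕ
  | [] => [a]
  | b :: l => bif Nat.ble a b then a :: b :: l else b :: insN a l
theorem insN_sh (a : ℕ) (l : List ℕ) : (insN a l).map (sh off) = insL (sh off a) (l.map (sh off)) := by
  induction l with
  | nil => rfl
  | cons b l ih =>
    rw [List.map_cons, insN, insL]
    by_cases h : a ≤ b
    · have h1 : Nat.ble a b = true := Nat.ble_eq.mpr h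
      have h2 : sh off a ≤ sh off b := by simp only [sh]; omega
      rw [h1, if_pos h2]; rfl
    · have h1 : Nat.ble a b = false := by
        cases hb : Nat.ble a b with
        | false => rfl
        | true => exact absurd (Nat.ble_eq.mp hb) h
      have h2 : ¬ sh off a ≤ sh off b := by simp only [sh]; omega
      rw [h1, if_neg h2, cond_false, List.map_cons, ih]
def eqN : List ℕ → List ℕ → Bool
  | [], [] => true
  | a :: l, b :: l' => Nat.beq a b && eqN l l'
  | _, _ => false
theorem eqN_eq {l l' : List ℕ} (h : eqN l l' = true) : l = l' := by
  induction l generalizing l' with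
  | nil => cases l' with
    | nil => rfl
    | cons b l' => cases h
  | cons a l ih => cases l' with
    | nil => cases h
    | cons b l' =>
      rw [eqN, Bool.and_eq_true] at h
      rw [Nat.eq_of_beq_eq_true h.1, ih h.2]
def dedN : List (List ℕ) → List (List ℕ)
  | [] => []
  | a :: l => bif l.any (eqN a) then dedN l else a :: dedN l
theorem mem_dedN {a : List ℕ} {l : List (List ℕ)} : a ∈ dedN l ↔ a ∈ l := by
  induction l with
  | nil => simp [dedN]
  | cons b l ih =>
    rw [dedN]
    cases h : l.any (eqN b) with
    | true =>
      obtain ⟨x, hx, hbx⟩ := List.any_eq_true.mp h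
      rw [cond_true, ih, List.mem_cons]
      refine ⟨Or.inr, ?_⟩
      rintro (rfl | h)
      · rw [eqN_eq hbx]; exact hx
      · exact h
    | false => rw [cond_false, List.mem_cons, List.mem_cons, ih]
variable (A B g off) in
def stN (L0 : List (List ℕ)) : List (List ℕ) :=
  L0.flatMap fun l => l.flatMap fun a => [insN (xsN B a) l, insN (ysN A g a) l]
def Cov (A B g off k : ℕ) (T : List (List ℕ)) : Prop :=
  ∀ l : List ℤ, l ∈ Lst (xsZ B) (ysZ A g) k ↔ ∃ n ∈ T, n.map (sh off) = l
theorem Cov_zero : Cov A B g off 0 [[off]] := by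
  intro l
  simp [Lst, sh, eq_comm]
theorem Cov_ded {k : ℕ} {T : List (List ℕ)} (h : Cov A B g off k T) : Cov A B g off k (dedN T) := by
  intro l; rw [h l]; simp only [mem_dedN]
theorem Cov_succ (hg : 0 < g) (hoff : g ∣ off) (hA : g ∣ A) {k : ℕ} {T : List (List ℕ)}
    (h : Cov A B g off k T) (hT : (T.all fun l => l.all fun n => Nat.ble A n) = true) :
    Cov A B g off (k + 1) (stN A B g T) := by
  have hT' : ∀ l ∈ T, ∀ n ∈ l, A ≤ n := by
    intro l hl n hn
    exact Nat.ble_eq.mp (List.all_eq_true.mp (List.all_eq_true.mp hT l hl) n hn)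
  intro l
  rw [Lst, mem_dedupL, List.mem_flatMap]
  constructor
  · rintro ⟨l0, hl0, h1⟩
    obtain ⟨n0, hn0, rfl⟩ := (h l0).mp hl0
    obtain ⟨a, ha, h1⟩ := List.mem_flatMap.mp h1
    obtain ⟨n, hn, rfl⟩ := List.mem_map.mp ha
    rw [← sh_xs, ← sh_ys hg hoff hA (hT' n0 hn0 n hn), ← insN_sh, ← insN_sh] at h1
    simp only [List.mem_cons, List.not_mem_nil, or_false] at h1
    rcases h1 with rfl | rfl
    · exact ⟨_, List.mem_flatMap.mpr ⟨n0, hn0, List.mem_flatMap.mpr ⟨n, hn, by simp⟩⟩, rfl⟩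
    · exact ⟨_, List.mem_flatMap.mpr ⟨n0, hn0, List.mem_flatMap.mpr ⟨n, hn, List.mem_cons_of_mem _ List.mem_cons_self⟩⟩, rfl⟩
  · rintro ⟨m, hm, rfl⟩
    obtain ⟨n0, hn0, h1⟩ := List.mem_flatMap.mp hm
    obtain ⟨n, hn, h1⟩ := List.mem_flatMap.mp h1
    refine ⟨n0.map (sh off), (h _).mpr ⟨n0, hn0, rfl⟩, List.mem_flatMap.mpr ⟨sh off n, List.mem_map_of_mem hn, ?_⟩⟩
    rw [← sh_xs, ← sh_ys hg hoff hA (hT' n0 hn0 n hn), ← insN_sh, ← insN_sh]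
    simp only [List.mem_cons, List.not_mem_nil, or_false] at h1 ⊢
    rcases h1 with rfl | rfl
    · exact Or.inl rfl
    · exact Or.inr rfl
def memN (a : ℕ) (l : List ℕ) : Bool := l.any (Nat.beq a)
theorem memN_iff {a : ℕ} {l : List ℕ} : memN a l = true ↔ a ∈ l := by
  rw [memN, List.any_eq_true]
  constructor
  · rintro ⟨x, hx, h⟩; rw [Nat.eq_of_beq_eq_true h]; exact hx
  · intro h; exact ⟨a, h, by simp⟩
theorem memN_sh {a : ℕ} {l : List ℕ} : memN a l = true ↔ sh off a ∈ l.map (sh off) := by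
  rw [memN_iff, List.mem_map_of_injective sh_inj]
variable (A B g) in
def okN (l : List ℕ) : Bool :=
  l.all fun a => (memN (xsN B a) l || memN (ysN A g a) l) &&
    l.any fun b => Nat.beq (xsN B b) a || Nat.beq (ysN A g b) a
theorem okN_of (hg : 0 < g) (hoff : g ∣ off) (hA : g ∣ A) {l : List ℕ} (hl : ∀ n ∈ l, A ≤ n) :
    okL (xsZ B) (ysZ A g) (l.map (sh off)) = okN A B g l := by
  rw [Bool.eq_iff_iff, okL, okN, List.all_eq_true, List.all_eq_true]
  simp only [List.forall_mem_map]
  refine forall₂_congr fun a ha => ?_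
  simp only [Bool.and_eq_true, Bool.or_eq_true, decide_eq_true_eq, List.any_eq_true, List.mem_map,
    exists_exists_and_eq_and]
  have h1 : memN (xsN B a) l = true ↔ ∃ b ∈ l, sh off b = xsZ B (sh off a) := by
    rw [memN_sh (off := off), sh_xs, List.mem_map]
  have h2 : memN (ysN A g a) l = true ↔ ∃ b ∈ l, sh off b = ysZ A g (sh off a) := by
    rw [memN_sh (off := off), sh_ys hg hoff hA (hl a ha), List.mem_map]
  rw [h1, h2]
  refine and_congr Iff.rfl (exists_congr fun b => and_congr_right fun hb => ?_)
  rw [← sh_xs, ← sh_ys hg hoff hA (hl b hb), sh_inj.eq_iff, sh_inj.eq_iff, Nat.beq_eq, Nat.beq_eq]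
def interN : List ℕ → List ℕ → ℕ
  | [], _ => 0
  | a :: s, t => bif memN a t then interN s (t.erase a) + 1 else interN s t
theorem interN_eq (s t : List ℕ) : ((s : Multiset ℕ) ∩ (t : Multiset ℕ)).card = interN s t := by
  induction s generalizing t with
  | nil => simp [interN]
  | cons a s ih =>
    rw [interN]
    cases h : memN a t with
    | true =>
      have h' : a ∈ (t : Multiset ℕ) := memN_iff.mp h
      rw [← Multiset.cons_coe, Multiset.cons_inter_of_pos _ h', Multiset.card_cons, Multiset.coe_erase, ih]; rfl
    | false =>
      have h' : a ∉ (t : Multiset ℕ) := fun h' => by rw [memN_iff.mpr h'] at h; cases h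
      rw [← Multiset.cons_coe, Multiset.cons_inter_of_neg _ h', ih]; rfl
def cntP (a : ℕ) : List ℕ → ℕ
  | [] => 0
  | b :: l => bif Nat.beq a b then cntP a l + 1 else cntP a l
theorem cntP_eq (a : ℕ) (l : List ℕ) : cntP a l = l.count a := by
  induction l with
  | nil => rfl
  | cons b l ih =>
    rw [cntP, List.count_cons, ih]
    cases h : Nat.beq a b with
    | true => have := Nat.eq_of_beq_eq_true h; subst this; simp
    | false => 
      have : ¬ (b = a) := fun h' => by rw [h'] at h; simp at h
      simp [this]
theorem card_map_inter {f : ℕ → ℤ} (hf : Function.Injective f) (s t : Multiset ℕ) :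
    (s.map f ∩ t.map f).card = (s ∩ t).card := by
  induction s using Multiset.induction_on generalizing t with
  | empty => simp
  | cons a s ih =>
    by_cases h : a ∈ t
    · rw [Multiset.map_cons, Multiset.cons_inter_of_pos _ (Multiset.mem_map_of_mem f h),
        Multiset.cons_inter_of_pos _ h, Multiset.card_cons, Multiset.card_cons, ← ih,
        Multiset.map_erase _ hf]
    · rw [Multiset.map_cons, Multiset.cons_inter_of_neg _ h, ← ih, Multiset.cons_inter_of_neg]
      rwa [Multiset.mem_map_of_injective hf]
variable (A g) in
def nyN (l : List ℕ) : ℕ := (l.map fun a => cntP (ysN A g a) l).sum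
variable (A B g) in
def cntN (l : List ℕ) : ℕ := nyN A g l + interN (l.map (xsN B)) l
theorem cntN_eq (hg : 0 < g) (hoff : g ∣ off) (hA : g ∣ A) {l : List ℕ} (hl : ∀ n ∈ l, A ≤ n) :
    cntM (xsZ B) (ysZ A g) ((l.map (sh off) : List ℤ) : Multiset ℤ) = cntN A B g l := by
  rw [cntM, cntN, nyN]
  congr 1
  · rw [Multiset.map_coe, Multiset.sum_coe, List.map_map]
    congr 1
    refine List.map_congr_left fun a ha => ?_
    rw [Function.comp_apply, ← sh_ys hg hoff hA (hl a ha), Multiset.coe_count,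
      List.count_map_of_injective _ _ sh_inj, cntP_eq]
  · rw [← interN_eq, Multiset.map_coe, List.map_map]
    have : (xsZ B ∘ sh off) = sh off ∘ xsN B := by funext a; exact (sh_xs a).symm
    rw [this, ← List.map_map]
    exact card_map_inter (sh_inj (off := off)) (l.map (xsN B) : List ℕ) (l : List ℕ)
end natlists
section perms
theorem exists_perm_of_map_eq {c c' : V6 → ℤ} (h : Finset.univ.val.map c = Finset.univ.val.map c') :
    ∃ π : Equiv.Perm V6, c = c' ∘ π := by
  have hcard : ∀ a : ℤ, Fintype.card {i // c i = a} = Fintype.card {i // c' i = a} := by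
    intro a
    have h1 := congrArg (Multiset.count a) h
    rw [Multiset.count_map, Multiset.count_map] at h1
    rw [Fintype.card_subtype, Fintype.card_subtype, Finset.card_def, Finset.card_def, Finset.filter_val,
      Finset.filter_val]
    simpa only [eq_comm (a := a)] using h1
  refine ⟨Equiv.ofFiberEquiv fun a => Fintype.equivOfCardEq (hcard a), ?_⟩
  funext i
  exact (Equiv.ofFiberEquiv_map (f := c) (g := c') (fun a => Fintype.equivOfCardEq (hcard a)) i).symm
def i6 : List ℕ := [0, 1, 2, 3, 4, 5]
def nf (σ : Equiv.Perm V6) (n : ℕ) : ℕ := (σ (Fin.ofNat 6 n)).val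
theorem nf_val (σ : Equiv.Perm V6) (i : V6) : nf σ i.val = (σ i).val := by
  rw [nf]
  congr 2
  apply Fin.ext
  simp [Fin.ofNat]
def imgs (σ : Equiv.Perm V6) : List ℕ := i6.map (nf σ)
theorem mem_i6 {n : ℕ} : n ∈ i6 ↔ n < 6 := by
  simp only [i6, List.mem_cons, List.not_mem_nil, or_false]; omega
theorem imgs_getD (σ : Equiv.Perm V6) {n : ℕ} (hn : n < 6) : (imgs σ).getD n 0 = nf σ n := by
  interval_cases n <;> rfl
theorem imgs_inj : Function.Injective imgs := by
  intro σ τ h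
  ext i
  rw [← nf_val, ← nf_val, ← imgs_getD σ i.isLt, ← imgs_getD τ i.isLt, h]
theorem nf_inj (σ : Equiv.Perm V6) {a b : ℕ} (ha : a < 6) (hb : b < 6) (h : nf σ a = nf σ b) : a = b := by
  have h1 := nf_val σ ⟨a, ha⟩
  have h2 := nf_val σ ⟨b, hb⟩
  simp only at h1 h2
  rw [h1, h2] at h
  exact congrArg Fin.val (σ.injective (Fin.ext h))
theorem imgs_surj {p : List ℕ} (hp : p.Perm i6) : ∃ σ, imgs σ = p := by
  have hl : p.length = 6 := hp.length_eq
  have hnd : p.Nodup := hp.nodup_iff.mpr (by decide)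
  have hlt : ∀ i : V6, p[i.val]'(by omega) < 6 := fun i => mem_i6.mp (hp.mem_iff.mp (List.getElem_mem _))
  let f : V6 → V6 := fun i => ⟨p[i.val]'(by omega), hlt i⟩
  have hf : Function.Injective f := by
    intro i j h
    have : p[i.val]'(by omega) = p[j.val]'(by omega) := congrArg Fin.val h
    exact Fin.ext ((hnd.getElem_inj_iff).mp this)
  refine ⟨Equiv.ofBijective f (Finite.injective_iff_bijective.mp hf), ?_⟩
  apply List.ext_getElem
  · rw [hl]; rfl
  · intro n h1 h2
    have hn : n < 6 := by omega
    have := imgs_getD (Equiv.ofBijective f (Finite.injective_iff_bijective.mp hf)) hn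
    rw [List.getD_eq_getElem _ _ h1] at this
    rw [this]
    have h3 := nf_val (Equiv.ofBijective f (Finite.injective_iff_bijective.mp hf)) ⟨n, hn⟩
    simp only at h3
    rw [h3]
    rfl
theorem sum_perm {κ : Type*} [AddCommMonoid κ] (F : List ℕ → κ) {P : List (List ℕ)} (hnd : P.Nodup)
    (hP : ∀ p ∈ P, p.Perm i6) (hF : ∀ σ, imgs σ ∉ P → F (imgs σ) = 0) :
    ∑ σ : Equiv.Perm V6, F (imgs σ) = (P.map F).sum := by
  classical
  rw [← List.sum_toFinset F hnd, ← Finset.sum_image (s := Finset.univ) (g := imgs) (f := F) (fun a _ b _ h => imgs_inj h)]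
  symm
  refine Finset.sum_subset ?_ ?_
  · intro p hp
    obtain ⟨σ, rfl⟩ := imgs_surj (hP p (List.mem_toFinset.mp hp))
    exact Finset.mem_image_of_mem _ (Finset.mem_univ _)
  · intro p hp hn
    obtain ⟨σ, -, rfl⟩ := Finset.mem_image.mp hp
    exact hF σ fun h => hn (List.mem_toFinset.mpr h)
def sgnL : List ℕ → ℤ
  | [] => 1
  | a :: l => (l.map fun b => bif Nat.blt a b then (1 : ℤ) else -1).prod * sgnL l
theorem sgnL_imgs (σ : Equiv.Perm V6) : sgnL (imgs σ) = (Equiv.Perm.sign σ : ℤ) := by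
  have h := Equiv.Perm.sign_eq_prod_prod_Ioi σ
  have hb : ∀ i j : V6, (bif Nat.blt (nf σ i) (nf σ j) then (1 : ℤ) else -1) =
      (((if σ i < σ j then 1 else -1 : ℤˣ)) : ℤ) := by
    intro i j
    rw [nf_val, nf_val]
    by_cases h : σ i < σ j
    · rw [if_pos h]
      have : Nat.blt (σ i).val (σ j).val = true := Nat.ble_eq.mpr h
      rw [this]; rfl
    · rw [if_neg h]
      have : Nat.blt (σ i).val (σ j).val = false := by
        cases hb : Nat.blt (σ i).val (σ j).val with
        | false => rfl
        | true => exact absurd (Nat.ble_eq.mp hb) h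
      rw [this]; rfl
  have e0 : (Finset.Ioi (0 : V6)) = {1, 2, 3, 4, 5} := by decide
  have e1 : (Finset.Ioi (1 : V6)) = {2, 3, 4, 5} := by decide
  have e2 : (Finset.Ioi (2 : V6)) = {3, 4, 5} := by decide
  have e3 : (Finset.Ioi (3 : V6)) = {4, 5} := by decide
  have e4 : (Finset.Ioi (4 : V6)) = {5} := by decide
  have e5 : (Finset.Ioi (5 : V6)) = ∅ := by decide
  rw [h, Fin.prod_univ_six, e0, e1, e2, e3, e4, e5]
  simp only [Units.val_mul, Units.coe_prod, ← hb]
  rw [Finset.prod_insert (by decide), Finset.prod_insert (by decide), Finset.prod_insert (by decide),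
    Finset.prod_insert (by decide), Finset.prod_singleton,
    Finset.prod_insert (by decide), Finset.prod_insert (by decide), Finset.prod_insert (by decide), Finset.prod_singleton,
    Finset.prod_insert (by decide), Finset.prod_insert (by decide), Finset.prod_singleton,
    Finset.prod_insert (by decide), Finset.prod_singleton, Finset.prod_singleton, Finset.prod_empty]
  simp only [imgs, i6, List.map_cons, List.map_nil, sgnL, List.prod_cons, List.prod_nil, mul_one]
  simp only [← mul_assoc]
  rfl
def enP (P : ℕ → ℕ → Bool) : List ℕ → ℕ → List ℕ → List (List ℕ)
  | [], _, _ => [[]]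
  | i :: is, b, used => (i6.filter fun j => !memN j used).flatMap fun j =>
      bif P i j then (enP P is b (j :: used)).map (j :: ·) else
        match b with
        | 0 => []
        | b + 1 => (enP P is b (j :: used)).map (j :: ·)
theorem mem_enP {P : ℕ → ℕ → Bool} {f : ℕ → ℕ} (hf : ∀ i, f i < 6) {is : List ℕ} {b : ℕ} {used : List ℕ}
    (hu : ∀ i ∈ is, f i ∉ used) (hnd : (is.map f).Nodup) (hb : is.countP (fun i => !P i (f i)) ≤ b) :
    is.map f ∈ enP P is b used := by
  induction is generalizing b used with
  | nil => simp [enP]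
  | cons i is ih =>
    rw [List.map_cons, List.nodup_cons] at hnd
    have hu' : ∀ k ∈ is, f k ∉ f i :: used := by
      intro k hk h
      rcases List.mem_cons.mp h with h | h
      · exact hnd.1 (h ▸ List.mem_map_of_mem hk)
      · exact hu k (List.mem_cons_of_mem _ hk) h
    rw [enP, List.mem_flatMap]
    refine ⟨f i, List.mem_filter.mpr ⟨mem_i6.mpr (hf i), ?_⟩, ?_⟩
    · cases h : memN (f i) used with
      | false => rfl
      | true => exact absurd (memN_iff.mp h) (hu i List.mem_cons_self)
    · rw [List.countP_cons] at hb
      cases hP : P i (f i) with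
      | true =>
        simp only [hP, Bool.not_true, Bool.false_eq_true, if_false, add_zero] at hb
        rw [cond_true]
        exact List.mem_map_of_mem (ih hu' hnd.2 hb)
      | false =>
        simp only [hP, Bool.not_false, if_true] at hb
        rw [cond_false]
        cases b with
        | zero => omega
        | succ b => exact List.mem_map_of_mem (ih hu' hnd.2 (by omega))
end perms
section eis
abbrev EI := ℤ × ℤ
def zeta : ℂ := ⟨-1 / 2, Real.sqrt 3 / 2⟩
theorem zeta_sq : zeta ^ 2 = -1 - zeta := by
  have h : Real.sqrt 3 * Real.sqrt 3 = 3 := Real.mul_self_sqrt (by norm_num)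
  apply Complex.ext
  · simp only [pow_two, Complex.mul_re, Complex.sub_re, Complex.neg_re, Complex.one_re, zeta]
    nlinarith
  · simp only [pow_two, Complex.mul_im, Complex.sub_im, Complex.neg_im, Complex.one_im, zeta]
    ring
def toC (x : EI) : ℂ := x.1 + x.2 * zeta
def emul (x y : EI) : EI := (x.1 * y.1 - x.2 * y.2, x.1 * y.2 + x.2 * y.1 - x.2 * y.2)
def esub (x y : EI) : EI := (x.1 - y.1, x.2 - y.2)
def eadd (x y : EI) : EI := (x.1 + y.1, x.2 + y.2)
def econj (x : EI) : EI := (x.1 - x.2, - x.2)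
def re2 (x : EI) : ℤ := 2 * x.1 - x.2
theorem toC_mul (x y : EI) : toC (emul x y) = toC x * toC y := by
  simp only [toC, emul]; push_cast
  linear_combination (-(x.2 : ℂ) * y.2) * zeta_sq
theorem toC_sub (x y : EI) : toC (esub x y) = toC x - toC y := by
  simp only [toC, esub]; push_cast; ring
theorem toC_add (x y : EI) : toC (eadd x y) = toC x + toC y := by
  simp only [toC, eadd]; push_cast; ring
theorem toC_one : toC (1, 0) = 1 := by simp [toC]
theorem toC_int (k : ℤ) : toC (k, 0) = k := by simp [toC]
theorem toC_re (x : EI) : (toC x).re = (re2 x : ℝ) / 2 := by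
  simp [toC, re2, zeta]; ring
theorem toC_conj (x : EI) : toC (econj x) = (starRingEnd ℂ) (toC x) := by
  apply Complex.ext
  · rw [Complex.conj_re, toC_re, toC_re]; simp [econj, re2]; ring
  · simp [toC, econj, zeta]
def fz {α : Type} (z : ℤ) (f : ℤ → α) : α := match z with
  | Int.ofNat n => force n fun n => f (Int.ofNat n)
  | Int.negSucc n => force n fun n => f (Int.negSucc n)
theorem fz_eq {α : Type} (z : ℤ) (f : ℤ → α) : fz z f = f z := by
  cases z <;> simp only [fz, force_eq]
def fE {α : Type} (x : EI) (f : EI → α) : α := match x with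
  | (a, b) => fz a fun a => fz b fun b => f (a, b)
theorem fE_eq {α : Type} (x : EI) (f : EI → α) : fE x f = f x := by
  obtain ⟨a, b⟩ := x
  simp only [fE, fz_eq]
def ePow (w : EI) : ℕ → EI
  | 0 => (1, 0)
  | n + 1 => fE (ePow w n) fun x => emul x w
theorem toC_pow (w : EI) (n : ℕ) : toC (ePow w n) = toC w ^ n := by
  induction n with
  | zero => simp [ePow, toC_one]
  | succ n ih => rw [ePow, fE_eq, toC_mul, ih, pow_succ]
abbrev EF := EI × EI
def toF (x : EF) : ℂ := toC x.1 / toC x.2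
def fF {α : Type} (x : EF) (f : EF → α) : α := match x with
  | (a, b) => fE a fun a => fE b fun b => f (a, b)
theorem fF_eq {α : Type} (x : EF) (f : EF → α) : fF x f = f x := by
  obtain ⟨a, b⟩ := x
  simp only [fF, fE_eq]
def fprod : List EF → EF
  | [] => ((1, 0), (1, 0))
  | x :: l => fF x fun x => fF (fprod l) fun y => (emul x.1 y.1, emul x.2 y.2)
theorem fprod_eq (l : List EF) : toF (fprod l) = (l.map toF).prod ∧
    ((∀ x ∈ l, toC x.2 ≠ 0) → toC (fprod l).2 ≠ 0) := by
  induction l with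
  | nil => simp [fprod, toF, toC_one]
  | cons x l ih =>
    rw [fprod, fF_eq, fF_eq, List.map_cons, List.prod_cons, ← ih.1]
    refine ⟨?_, fun h => ?_⟩
    · simp only [toF, toC_mul, div_mul_div_comm]
    · simp only [toC_mul]
      exact mul_ne_zero (h x List.mem_cons_self) (ih.2 fun y hy => h y (List.mem_cons_of_mem _ hy))
def fsum : List (ℤ × EF) → EF
  | [] => ((0, 0), (1, 0))
  | (k, x) :: l => fF x fun x => fF (fsum l) fun y =>
      (eadd (emul (k, 0) (emul x.1 y.2)) (emul x.2 y.1), emul x.2 y.2)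
theorem fsum_eq (l : List (ℤ × EF)) (h : ∀ x ∈ l, toC x.2.2 ≠ 0) :
    toF (fsum l) = (l.map fun x => (x.1 : ℂ) * toF x.2).sum ∧ toC (fsum l).2 ≠ 0 := by
  induction l with
  | nil => simp [fsum, toF, toC]
  | cons x l ih =>
    obtain ⟨k, x⟩ := x
    have hx := h (k, x) List.mem_cons_self
    have ih := ih fun y hy => h y (List.mem_cons_of_mem _ hy)
    rw [fsum, fF_eq, fF_eq, List.map_cons, List.sum_cons, ← ih.1]
    have h2 := ih.2
    simp only at hx
    refine ⟨?_, ?_⟩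
    · simp only [toF, toC_mul, toC_add, toC_int]
      field_simp
    · simp only [toC_mul]
      exact mul_ne_zero hx h2
theorem re_pos_of {μ : EI} {x : EF} (h : 0 < re2 (emul μ (emul x.1 (econj x.2)))) : 0 < (toC μ * toF x).re := by
  have h1 : 0 < (toC (emul μ (emul x.1 (econj x.2)))).re := by
    rw [toC_re]
    have : (0 : ℝ) < re2 (emul μ (emul x.1 (econj x.2))) := by exact_mod_cast h
    linarith
  rw [toC_mul, toC_mul, toC_conj] at h1
  have hx : toC x.2 ≠ 0 := by
    intro h0
    rw [h0] at h1
    simp at h1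
  have : toC μ * toF x = ((Complex.normSq (toC x.2))⁻¹ : ℝ) * (toC μ * (toC x.1 * (starRingEnd ℂ) (toC x.2))) := by
    rw [toF, div_eq_mul_inv, Complex.inv_def]
    push_cast
    ring
  rw [this, Complex.re_ofReal_mul]
  exact mul_pos (inv_pos.mpr (Complex.normSq_pos.mpr hx)) h1
end eis
structure Pt where
  A : ℕ
  B : ℕ
  g : ℕ
  off : ℕ
  m : ℕ
  w : EI
  η : EI
  μ : EI
  tb : List (ℕ × ℤ)
structure PtOK (D : Pt) : Prop where
  hw : 1 < ‖toC D.w‖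
  hη : IsPrimitiveRoot (toC D.η) D.g
  hg : 0 < D.g
  hA : D.g ∣ D.A
  hB : D.g ∣ D.B
  hfin : finOK D.A D.B D.g
  hoff : D.g ∣ D.off
  hA0 : 0 < D.A
def PtOK.loc {D : Pt} (h : PtOK D) : Loc ℂ := mkLoc h.hw h.hη h.hg h.hA h.hB h.hfin
section chk
variable (D : Pt)
def vE (n : ℕ) : EI := fE (ePow D.w (n / D.g)) fun x => fE (ePow D.η (n % D.g)) fun y => emul x y
def NF (a b : ℕ) : EF := bif Nat.beq a b then ((1, 0), (1, 0)) else
  fE (vE D a) fun x => fE (vE D b) fun y => (x, esub x y)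
def cx (l : List ℕ) (i j : ℕ) : Bool := Nat.beq (l.getD j 0) (xsN D.B (l.getD i 0))
def cy (l : List ℕ) (i j : ℕ) : Bool := Nat.beq (l.getD j 0) (ysN D.A D.g (l.getD i 0))
def EX (l p : List ℕ) : List ℕ := (i6.filter fun i => cx D l i (p.getD i 0)).map fun i => 6 * i + p.getD i 0
def EY (l : List ℕ) : List ℕ := ((List.range 36).filter fun n => cy D l (n / 6) (n % 6)).map fun n => 36 + n
def FX (l p : List ℕ) : EF := fprod (i6.map fun i => NF D (l.getD (p.getD i 0) 0) (xsN D.B (l.getD i 0)))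
def FY (l : List ℕ) : EF :=
  fprod ((List.range 36).map fun n => NF D (l.getD (n % 6) 0) (ysN D.A D.g (l.getD (n / 6) 0)))
def PP (l : List ℕ) : List (List ℕ) := (enP (cx D l) i6 (6 + (EY D l).length - (D.m + 5)) []).filter
  fun p => Nat.beq ((EX D l p).length + (EY D l).length) (D.m + 5)
def lk (G : ℕ) : List (ℕ × ℤ) → Option ℤ
  | [] => none
  | (G', z) :: tb => bif Nat.beq G G' then some z else lk G tb
def msk (l p : List ℕ) : ℕ := mkMask (EX D l p ++ EY D l)
def RR (l : List ℕ) : EF := fprod [FY D l, fsum ((PP D l).map fun p =>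
  (sgnL p * (lk (msk D l p) D.tb).getD 0, FX D l p))]
def posL (l : List ℕ) : Bool := decide (PP D l).Nodup && ((PP D l).all fun p => decide (p.Perm i6) &&
  (lk (msk D l p) D.tb).isSome) && fF (RR D l) fun R => decide (0 < re2 (emul D.μ (emul R.1 (econj R.2))))
def cfn (l : List ℕ) (i : V6) : ℤ := sh D.off (l.getD i.val 0)
theorem testBit_mkMask (l : List ℕ) (n : ℕ) : (mkMask l).testBit n = true ↔ n ∈ l := by
  induction l with
  | nil => simp [mkMask]
  | cons a l ih =>
    have : mkMask (a :: l) = 2 ^ a ||| mkMask l := rfl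
    rw [this, Nat.testBit_or, Bool.or_eq_true, ih, Nat.testBit_two_pow, List.mem_cons, decide_eq_true_eq, eq_comm]
variable {D}
variable (h : PtOK D)
theorem toC_vE (hη : toC D.η ^ D.g = 1) (n : ℕ) : toC (vE D n) = toC D.w ^ (n / D.g) * toC D.η ^ n := by
  rw [vE, fE_eq, fE_eq, toC_mul, toC_pow, toC_pow]
  congr 1
  conv_rhs => rw [← Nat.mod_add_div n D.g, pow_add, pow_mul, hη, one_pow, mul_one]
include h
theorem val_sh (n : ℕ) : h.loc.val (sh D.off n) = toC (vE D n) * (toC D.w ^ (D.off / D.g))⁻¹ := by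
  have hη := h.hη.pow_eq_one
  have hη0 := h.hη.ne_zero h.hg.ne'
  have hw0 : toC D.w ≠ 0 := fun h' => by have := h.hw; rw [h', norm_zero] at this; linarith
  have hgz : (D.g : ℤ) ≠ 0 := by exact_mod_cast h.hg.ne'
  obtain ⟨o, ho⟩ := h.hoff
  rw [toC_vE hη]
  show pval D.g (toC D.w) (toC D.η) (sh D.off n) = _
  rw [pval, sh, ho, Nat.mul_div_cancel_left _ h.hg]
  have e1 : ((n : ℤ) - ((D.g * o : ℕ) : ℤ)) / D.g = ((n / D.g : ℕ) : ℤ) - o := by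
    push_cast
    rw [sub_eq_add_neg, ← mul_neg, Int.add_mul_ediv_left _ _ hgz]; ring
  rw [e1, zpow_sub₀ hw0, zpow_sub₀ hη0, zpow_natCast, zpow_natCast, zpow_natCast, zpow_natCast, pow_mul, hη, one_pow]
  field_simp
theorem NF_ne (a b : ℕ) : toC (NF D a b).2 ≠ 0 := by
  rw [NF]
  cases hb : Nat.beq a b with
  | true => rw [cond_true]; simp [toC_one]
  | false =>
    rw [cond_false, fE_eq, fE_eq, toC_sub, sub_ne_zero]
    intro h'
    have : h.loc.val (sh D.off a) = h.loc.val (sh D.off b) := by rw [val_sh, val_sh, h']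
    have := sh_inj (h.loc.valinj this)
    rw [this] at hb
    simp at hb
theorem NF_eq (a b : ℕ) : toF (NF D a b) = if sh D.off a = sh D.off b then 1 else
    (1 - h.loc.val (sh D.off b) / h.loc.val (sh D.off a))⁻¹ := by
  have hw0 : toC D.w ≠ 0 := fun h' => by have := h.hw; rw [h', norm_zero] at this; linarith
  have hne := NF_ne h a b
  have hva := h.loc.valne (sh D.off a)
  rw [NF] at hne ⊢
  cases hb : Nat.beq a b with
  | true =>
    rw [Nat.eq_of_beq_eq_true hb, if_pos rfl, cond_true, toF]
    simp [toC_one]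
  | false =>
    have hab : a ≠ b := fun h' => by rw [h'] at hb; simp at hb
    rw [if_neg (fun h' => hab (sh_inj h')), cond_false, fE_eq, fE_eq, toF, toC_sub]
    rw [hb, cond_false, fE_eq, fE_eq, toC_sub] at hne
    rw [val_sh] at hva
    have hva' := left_ne_zero_of_mul hva
    have hw1 := pow_ne_zero (D.off / D.g) hw0
    rw [val_sh, val_sh, mul_div_mul_right _ _ (inv_ne_zero hw1)]
    rw [one_sub_div hva', inv_div]
variable {l : List ℕ} (hl : ∀ n ∈ l, D.A ≤ n) (hl6 : l.length = 6)
include hl hl6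
theorem getD_le {i : ℕ} (hi : i < 6) : D.A ≤ l.getD i 0 := by
  rw [List.getD_eq_getElem _ _ (by omega)]
  exact hl _ (List.getElem_mem _)
theorem cx_iff (i j : V6) : cx D l i.val j.val = true ↔ cfn D l j = h.loc.xs (cfn D l i) := by
  rw [cx, Nat.beq_eq, cfn, cfn]
  show _ ↔ _ = xsZ D.B _
  rw [← sh_xs, sh_inj.eq_iff]
theorem cy_iff (i j : V6) : cy D l i.val j.val = true ↔ cfn D l j = h.loc.ys (cfn D l i) := by
  rw [cy, Nat.beq_eq, cfn, cfn]
  show _ ↔ _ = ysZ D.A D.g _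
  rw [← sh_ys h.hg h.hoff h.hA (getD_le h hl hl6 i.isLt), sh_inj.eq_iff]
theorem mem_ES (σ : Equiv.Perm V6) (e : E6) : idx e ∈ EX D l (imgs σ) ++ EY D l ↔ e ∈ Cc h.loc σ (cfn D l) := by
  rw [mem_Cc, List.mem_append, EX, EY, List.mem_map, List.mem_map]
  simp only [List.mem_filter, mem_i6, List.mem_range]
  rcases e with ⟨i, j⟩ | ⟨i, j⟩
  · rw [mem_Gs_inl]
    have key := cx_iff h hl hl6 i (σ i)
    simp only [idx]
    constructor
    · rintro (⟨a, ⟨ha, h1⟩, h2⟩ | ⟨a, -, h2⟩)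
      · rw [imgs_getD σ ha] at h1 h2
        have h3 := nf_val σ ⟨a, ha⟩
        simp only at h3
        have h4 : a = i.val := by omega
        subst h4
        rw [nf_val] at h1 h2
        have h5 : j = σ i := Fin.ext (by omega)
        subst h5
        exact ⟨by first | rfl | trivial, key.mp h1⟩
      · omega
    · rintro ⟨h1, h2⟩
      have h1 : σ i = j := by first | exact h1 | exact h1.symm
      subst h1
      left
      refine ⟨i.val, ⟨i.isLt, ?_⟩, ?_⟩ <;> rw [imgs_getD σ i.isLt, nf_val]
      exact key.mpr h2
  · have key := cy_iff h hl hl6 i j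
    simp only [idx, mem_Gs_inr, true_and]
    constructor
    · rintro (⟨a, ⟨ha, h1⟩, h2⟩ | ⟨a, ⟨ha, h1⟩, h2⟩)
      · rw [imgs_getD σ ha] at h1 h2
        have h3 := nf_val σ ⟨a, ha⟩
        simp only at h3
        omega
      · have h3 : a / 6 = i.val := by omega
        have h4 : a % 6 = j.val := by omega
        rw [h3, h4] at h1
        exact key.mp h1
    · intro h2
      right
      refine ⟨6 * i.val + j.val, ⟨by omega, ?_⟩, rfl⟩
      have h3 : (6 * i.val + j.val) / 6 = i.val := by omega
      have h4 : (6 * i.val + j.val) % 6 = j.val := by omega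
      rw [h3, h4]
      exact key.mpr h2
theorem setOf'_msk (σ : Equiv.Perm V6) : setOf' (msk D l (imgs σ)) = Cc h.loc σ (cfn D l) := by
  ext e
  rw [mem_setOf', msk, testBit_mkMask, mem_ES h hl hl6]
theorem card_ES (σ : Equiv.Perm V6) : (Cc h.loc σ (cfn D l)).card = (EX D l (imgs σ)).length + (EY D l).length := by
  have hlt : ∀ n ∈ EX D l (imgs σ), n < 36 := by
    intro n hn
    obtain ⟨a, ha, rfl⟩ := List.mem_map.mp hn
    have ha := mem_i6.mp (List.mem_filter.mp ha).1
    rw [imgs_getD σ ha]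
    have h3 := nf_val σ ⟨a, ha⟩
    simp only at h3
    omega
  have hge : ∀ n ∈ EY D l, 36 ≤ n ∧ n < 72 := by
    intro n hn
    obtain ⟨a, ha, rfl⟩ := List.mem_map.mp hn
    have := List.mem_range.mp (List.mem_filter.mp ha).1
    omega
  have hnd : (EX D l (imgs σ) ++ EY D l).Nodup := by
    rw [List.nodup_append]
    refine ⟨?_, ?_, ?_⟩
    · refine List.Nodup.map_on ?_ (List.Nodup.filter _ (by decide))
      intro a ha b hb hab
      have ha := mem_i6.mp (List.mem_filter.mp ha).1
      have hb := mem_i6.mp (List.mem_filter.mp hb).1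
      rw [imgs_getD σ ha, imgs_getD σ hb] at hab
      have h3 := nf_val σ ⟨a, ha⟩
      have h4 := nf_val σ ⟨b, hb⟩
      simp only at h3 h4
      omega
    · exact (List.nodup_range.filter _).map (fun a b hab => by simpa using hab)
    · intro a ha b hb hab
      have := hlt a ha
      have := hge b hb
      omega
  rw [← List.length_append, ← List.toFinset_card_of_nodup hnd,
    ← Finset.card_image_of_injective _ (fun a b => idx_inj : Function.Injective idx)]
  congr 1
  ext n
  rw [Finset.mem_image, List.mem_toFinset]
  constructor
  · rintro ⟨e, he, rfl⟩
    exact (mem_ES h hl hl6 σ e).mpr he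
  · intro hn
    have hn72 : n < 72 := by
      rcases List.mem_append.mp hn with h' | h'
      · have := hlt n h'; omega
      · exact (hge n h').2
    exact ⟨dec n, (mem_ES h hl hl6 σ _).mp (by rwa [idx_dec hn72]), idx_dec hn72⟩
theorem FX_eq (σ : Equiv.Perm V6) : toF (FX D l (imgs σ)) = ∏ i, iv h.loc (cfn D l) (Sum.inl (i, σ i)) := by
  have key : ∀ i : V6, toF (NF D (l.getD ((imgs σ).getD i.val 0) 0) (xsN D.B (l.getD i.val 0))) =
      iv h.loc (cfn D l) (Sum.inl (i, σ i)) := by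
    intro i
    rw [NF_eq h, iv_inl, imgs_getD σ i.isLt, nf_val, ← h.loc.valx]
    have : sh D.off (xsN D.B (l.getD i.val 0)) = h.loc.xs (cfn D l i) := sh_xs _
    rw [this]
    rfl
  rw [FX, (fprod_eq _).1, Fin.prod_univ_six]
  simp only [← key, i6, List.map_cons, List.map_nil, List.prod_cons, List.prod_nil, mul_one, mul_assoc]
  rfl
theorem FY_eq : toF (FY D l) = ∏ ij, iv h.loc (cfn D l) (Sum.inr ij) := by
  have key : ∀ i j : V6, toF (NF D (l.getD j.val 0) (ysN D.A D.g (l.getD i.val 0))) =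
      iv h.loc (cfn D l) (Sum.inr (i, j)) := by
    intro i j
    rw [NF_eq h, iv_inr, ← h.loc.valy]
    have : sh D.off (ysN D.A D.g (l.getD i.val 0)) = h.loc.ys (cfn D l i) :=
      sh_ys h.hg h.hoff h.hA (getD_le h hl hl6 i.isLt)
    rw [this]
    rfl
  rw [FY, (fprod_eq _).1, List.map_map, ← Equiv.prod_comp (finProdFinEquiv (m := 6) (n := 6)).symm]
  have h2 : ∀ k : Fin (6 * 6), iv h.loc (cfn D l) (Sum.inr (finProdFinEquiv.symm k)) =
      (toF ∘ fun n => NF D (l.getD (n % 6) 0) (ysN D.A D.g (l.getD (n / 6) 0))) k.val := by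
    intro k
    rw [Function.comp_apply, ← key]
    · rfl
  rw [Finset.prod_congr rfl fun k _ => h2 k, Fin.prod_univ_eq_prod_range
    (fun n => (toF ∘ fun n => NF D (l.getD (n % 6) 0) (ysN D.A D.g (l.getD (n / 6) 0))) n) (6 * 6)]
  rfl
end chk
def TBOK (D : Pt) : Prop := ∀ x ∈ D.tb, ∃ cs : List (List ℕ × ℤ × ℕ),
  (∀ c ∈ cs, okC D.A D.B c = true) ∧ Wv cs D.m x.1 = some x.2
theorem lk_mem {G : ℕ} {z : ℤ} {tb : List (ℕ × ℤ)} (h : lk G tb = some z) : (G, z) ∈ tb := by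
  induction tb with
  | nil => simp [lk] at h
  | cons a tb ih =>
    obtain ⟨G', z'⟩ := a
    rw [lk] at h
    cases hb : Nat.beq G G' with
    | true =>
      rw [hb, cond_true] at h
      rw [Nat.eq_of_beq_eq_true hb]
      simp at h
      simp [h]
    | false =>
      rw [hb, cond_false] at h
      exact List.mem_cons_of_mem _ (ih h)
section chk
variable {D : Pt} (h : PtOK D) (htab : TableOK h.loc.xs h.loc.ys D.m) (htb : TBOK D)
variable {l : List ℕ} (hl : ∀ n ∈ l, D.A ≤ n) (hl6 : l.length = 6)
include h htab htb hl hl6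
theorem Ctr_pos (hp : posL D l = true) : 0 < (toC D.μ * Ctr h.loc D.m (cfn D l)).re := by
  rw [posL, fF_eq] at hp
  simp only [Bool.and_eq_true, decide_eq_true_eq, List.all_eq_true] at hp
  obtain ⟨⟨hnd, hall⟩, hpos⟩ := hp
  let F : List ℕ → ℂ := fun p => if (EX D l p).length + (EY D l).length = D.m + 5 then
    (sgnL p : ℂ) * ((((lk (msk D l p) D.tb).getD 0 : ℤ) / 6 ^ D.m : ℂ) * (toF (FX D l p) * toF (FY D l))) else 0
  have hPP : ∀ σ, (EX D l (imgs σ)).length + (EY D l).length = D.m + 5 → imgs σ ∈ PP D l := by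
    intro σ hσ
    rw [PP, List.mem_filter]
    refine ⟨mem_enP (fun i => ?_) (by simp) ?_ ?_, by rw [Nat.beq_eq]; exact hσ⟩
    · exact (σ _).isLt
    · refine List.Nodup.map_on ?_ (by decide)
      intro a ha b hb
      exact nf_inj σ (mem_i6.mp ha) (mem_i6.mp hb)
    · have h1 := List.length_eq_countP_add_countP (fun i => cx D l i (nf σ i)) (l := i6)
      have h2 : (EX D l (imgs σ)).length = i6.countP (fun i => cx D l i (nf σ i)) := by
        rw [EX, List.length_map, List.countP_eq_length_filter]
        congr 1
      have h3 : i6.countP (fun i => !cx D l i (nf σ i)) = i6.countP (fun i => decide ¬ (cx D l i (nf σ i) = true)) := by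
        congr 1
        funext i
        simp
      have h4 : i6.length = 6 := rfl
      rw [h3]
      omega
  have hC : Ctr h.loc D.m (cfn D l) = ∑ σ, F (imgs σ) := by
    rw [Ctr]
    refine Finset.sum_congr rfl fun σ _ => ?_
    rw [wC_full, card_ES h hl hl6]
    simp only [F]
    split_ifs with hc
    · have hm := hPP σ hc
      obtain ⟨z, hz⟩ := Option.isSome_iff_exists.mp (hall _ hm).2
      obtain ⟨cs, hcs, hW⟩ := htb _ (lk_mem hz)
      have hL := Wv_lead (L := h.loc) (A := D.A) (B := D.B) rfl h.hA0 hcs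
        (by rw [setOf'_msk h hl hl6]; exact (main_bound htab (Cc_sub σ _) (Cc_good σ _)).1) hW
      rw [setOf'_msk h hl hl6] at hL
      rw [vC_eq hL, hz, sgnL_imgs, FX_eq h hl hl6, FY_eq h hl hl6]
      rfl
    · simp
  rw [sum_perm F hnd (fun p hp => (hall p hp).1) fun σ hσ => by
    simp only [F]; rw [if_neg fun hc => hσ (hPP σ hc)]] at hC
  have hFX : ∀ p, toC (FX D l p).2 ≠ 0 := fun p => (fprod_eq _).2 fun x hx => by
    obtain ⟨i, _, rfl⟩ := List.mem_map.mp hx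
    exact NF_ne h _ _
  have hR : toF (RR D l) = 6 ^ D.m * Ctr h.loc D.m (cfn D l) := by
    rw [hC, RR, (fprod_eq _).1]
    simp only [List.map_cons, List.map_nil, List.prod_cons, List.prod_nil, mul_one]
    rw [(fsum_eq _ fun x hx => by obtain ⟨p, _, rfl⟩ := List.mem_map.mp hx; exact hFX p).1, List.map_map]
    rw [← List.sum_map_mul_left, ← List.sum_map_mul_left]
    congr 1
    refine List.map_congr_left fun p hp => ?_
    have hc : (EX D l p).length + (EY D l).length = D.m + 5 := by
      have := (List.mem_filter.mp hp).2
      rwa [Nat.beq_eq] at this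
    simp only [F, if_pos hc, Function.comp_apply]
    push_cast
    field_simp
  have := re_pos_of hpos
  rw [hR, mul_left_comm] at this
  have h6 : ((6 : ℂ) ^ D.m) = ((6 ^ D.m : ℝ) : ℂ) := by push_cast; rfl
  rw [h6, Complex.re_ofReal_mul] at this
  exact (pos_iff_pos_of_mul_pos this).mp (by positivity)
omit htab htb in
theorem map_cfn : Finset.univ.val.map (cfn D l) = ((l.map (sh D.off) : List ℤ) : Multiset ℤ) := by
  rw [Fin.univ_val_map, ← List.ofFn_getElem (xs := l)]
  congr 1
  apply List.ext_getElem <;> simp [hl6, cfn]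
end chk
def TN (D : Pt) : ℕ → List (List ℕ)
  | 0 => [[D.off]]
  | k + 1 => stN D.A D.B D.g (dedN (TN D k))
def dupk (D : Pt) (l : List ℕ) : Bool := i6.any fun i => i6.any fun j => Nat.blt i j &&
  Nat.beq (l.getD i 0) (l.getD j 0) &&
    (!(memN (l.getD i 0) (l.map (xsN D.B))) || !(memN (xsN D.B (l.getD i 0)) l))
def lvl (D : Pt) (k : ℕ) : Bool := (TN D k).all fun l => (l.all fun n => Nat.ble D.A n) &&
  (!(Nat.beq k 0 || okN D.A D.B D.g l) || force (cntN D.A D.B D.g l) fun c =>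
    (Nat.ble 5 k || Nat.blt (6 * (c + 1)) (D.m * (k + 1) + 6 * (k + 1))) && Nat.ble c (D.m + 5))
def tgt (D : Pt) : List (List ℕ) := dedN ((TN D 5).filter fun l => okN D.A D.B D.g l &&
  Nat.beq (cntN D.A D.B D.g l) (D.m + 5) && !dupk D l)
def chkP (D : Pt) : Bool := (i6.all (lvl D)) && ((tgt D).all (posL D)) &&
  (tgt D).any fun l => Nat.beq (l.getD 0 0) D.off
theorem TN_len (D : Pt) : ∀ k, ∀ l ∈ TN D k, l.length = k + 1
  | 0, l, hl => by
    rw [TN, List.mem_singleton] at hl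
    rw [hl]; rfl
  | k + 1, l, hl => by
    have hi : ∀ a (l : List ℕ), (insN a l).length = l.length + 1 := by
      intro a l
      induction l with
      | nil => rfl
      | cons b l ih => rw [insN]; cases Nat.ble a b <;> simp [ih]
    rw [TN, stN] at hl
    simp only [List.mem_flatMap, mem_dedN, List.mem_cons, List.not_mem_nil, or_false] at hl
    obtain ⟨l', hl', a, _, rfl | rfl⟩ := hl <;> rw [hi, TN_len D k l' hl']
section fin
variable {D : Pt} (h : PtOK D) (htb : TBOK D) (hc : chkP D = true)
include h htb hc
theorem chk_lead : ∃ c, c ≠ 0 ∧ Lead h.loc.ev h.loc.p0 D.m SS c := by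
  rw [chkP, Bool.and_eq_true, Bool.and_eq_true, List.all_eq_true, List.all_eq_true, List.any_eq_true] at hc
  obtain ⟨⟨hlv, hps⟩, l0, hl0, hl0'⟩ := hc
  have hge : ∀ k < 6, ∀ l ∈ TN D k, ∀ n ∈ l, D.A ≤ n := by
    intro k hk l hl n hn
    have := List.all_eq_true.mp (hlv k (mem_i6.mpr hk)) l hl
    rw [Bool.and_eq_true, List.all_eq_true] at this
    exact Nat.le_of_ble_eq_true (this.1 n hn)
  have hcov : ∀ k < 6, Cov D.A D.B D.g D.off k (TN D k) := by
    intro k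
    induction k with
    | zero => intro _; exact Cov_zero
    | succ k ih =>
      intro hk
      refine Cov_succ h.hg h.hoff h.hA (Cov_ded (ih (by omega))) ?_
      simp only [List.all_eq_true, mem_dedN]
      exact fun l hl n hn => Nat.ble_eq.mpr (hge k (by omega) l hl n hn)
  have htab : TableOK h.loc.xs h.loc.ys D.m := by
    intro k hk l hl hok
    obtain ⟨n, hn, rfl⟩ := (hcov k hk l).mp hl
    have hn' := hge k hk n hn
    have := List.all_eq_true.mp (hlv k (mem_i6.mpr hk)) n hn
    have e1 := okN_of (B := D.B) h.hg h.hoff h.hA hn'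
    have e2 := cntN_eq (B := D.B) h.hg h.hoff h.hA hn'
    have hok' : (Nat.beq k 0 || okN D.A D.B D.g n) = true := by
      rw [Bool.or_eq_true, Nat.beq_eq]
      by_cases hk0 : k = 0
      · exact Or.inl hk0
      · exact Or.inr (by rw [← e1]; exact hok (by omega))
    rw [hok', force_eq] at this
    change (k < 5 → 6 * (cntM (xsZ D.B) (ysZ D.A D.g) _ + 1) < _) ∧ cntM (xsZ D.B) (ysZ D.A D.g) _ ≤ _
    rw [e2]
    simp only [Bool.and_eq_true, Bool.not_true, Bool.false_or, Bool.or_eq_true, Nat.ble_eq, Nat.blt_eq] at this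
    refine ⟨fun hk5 => ?_, this.2.2⟩
    rcases this.2.1 with h' | h'
    · omega
    · exact h'
  have htg : ∀ l ∈ tgt D, l ∈ TN D 5 ∧ okN D.A D.B D.g l = true ∧ 0 < (toC D.μ * Ctr h.loc D.m (cfn D l)).re := by
    intro l hl
    have h1 := List.mem_filter.mp (mem_dedN.mp hl)
    simp only [Bool.and_eq_true] at h1
    exact ⟨h1.1, h1.2.1.1, Ctr_pos h htab htb (hge 5 (by omega) l h1.1) (TN_len D 5 l h1.1) (hps l hl)⟩
  refine ⟨_, ?_, lead_SS htab⟩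
  have hnn : ∀ c ∈ Phi h.loc, 0 ≤ (toC D.μ * Ctr h.loc D.m c).re := by
    intro c hcP
    obtain ⟨_, l, hl, hok, hlc⟩ := mem_Phi.mp hcP
    obtain ⟨n, hn, rfl⟩ := (hcov 5 (by omega) l).mp hl
    have hn' := hge 5 (by omega) n hn
    have hn6 := TN_len D 5 n hn
    obtain ⟨π, rfl⟩ := exists_perm_of_map_eq (hlc.symm.trans (map_cfn h hn' hn6).symm)
    rw [Ctr_map]
    by_cases h1 : cntN D.A D.B D.g n = D.m + 5
    · cases hd : dupk D n with
      | false =>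
        refine (htg n (mem_dedN.mpr (List.mem_filter.mpr ⟨hn, ?_⟩))).2.2.le
        rw [hd, h1]
        have e1 := okN_of (B := D.B) h.hg h.hoff h.hA hn'
        have : okN D.A D.B D.g n = true := by rw [← e1]; exact hok
        simp [this]
      | true =>
        suffices Ctr h.loc D.m (cfn D n) = 0 by rw [this]; simp
        simp only [dupk, List.any_eq_true, Bool.and_eq_true, Bool.or_eq_true, Nat.blt_eq, Nat.beq_eq, mem_i6,
          Bool.not_eq_true', ← Bool.not_eq_true, memN_iff, List.mem_map] at hd
        obtain ⟨i, hi, j, hj, ⟨hij, he⟩, hd⟩ := hd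
        have hmem : ∀ k : V6, n.getD k.val 0 ∈ n := fun k => by
          rw [List.getD_eq_getElem _ _ (by omega)]
          exact List.getElem_mem _
        have hne : (⟨i, hi⟩ : V6) ≠ ⟨j, hj⟩ := fun h' => by simp at h'; omega
        have heq : cfn D n ⟨i, hi⟩ = cfn D n ⟨j, hj⟩ := by simp only [cfn]; rw [he]
        have hxs : ∀ k, h.loc.xs (cfn D n k) = sh D.off (xsN D.B (n.getD k.val 0)) := fun k => (sh_xs _).symm
        rcases hd with hd | hd
        · refine Ctr_zero1 hne heq fun k hk => hd ⟨_, hmem k, ?_⟩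
          rw [hxs] at hk
          exact sh_inj hk
        · refine Ctr_zero2 hne heq fun k hk => hd ?_
          rw [hxs] at hk
          have := sh_inj hk
          simp only at this
          rw [← this]
          exact hmem k
    · suffices Ctr h.loc D.m (cfn D n) = 0 by rw [this]; simp
      rw [Ctr]
      refine Finset.sum_eq_zero fun σ _ => ?_
      rw [wC_full, if_neg, mul_zero]
      intro h2
      have h3 := card_compat_le (L := h.loc) σ (cfn D n) Finset.univ
      simp only [Finset.mem_univ, and_self, Finset.filter_true] at h3
      rw [map_cfn h hn' hn6, h2] at h3
      have h4 := (htab 5 (by omega) _ hl fun _ => hok).2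
      have h5 := cntN_eq (B := D.B) h.hg h.hoff h.hA hn'
      change _ ≤ cntM (xsZ D.B) (ysZ D.A D.g) _ at h3
      change cntM (xsZ D.B) (ysZ D.A D.g) _ ≤ _ at h4
      omega
  have hl0P : cfn D l0 ∈ Phi h.loc := by
    obtain ⟨h1, h2, _⟩ := htg l0 hl0
    have hn' := hge 5 (by omega) l0 h1
    refine mem_Phi.mpr ⟨?_, l0.map (sh D.off), (hcov 5 (by omega) _).mpr ⟨l0, h1, rfl⟩, ?_,
      (map_cfn h hn' (TN_len D 5 l0 h1)).symm⟩
    · have : l0.getD 0 0 = D.off := Nat.eq_of_beq_eq_true hl0'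
      show sh D.off (l0.getD 0 0) = 0
      rw [this, sh, sub_self]
    · rw [← h2, ← okN_of h.hg h.hoff h.hA hn']
      rfl
  intro h0
  have h1 : (toC D.μ * ∑ c ∈ Phi h.loc, Ctr h.loc D.m c).re = 0 := by rw [h0]; simp
  rw [Finset.mul_sum, Complex.re_sum] at h1
  have h2 := (Finset.sum_eq_zero_iff_of_nonneg hnn).mp h1 _ hl0P
  have h3 := (htg l0 hl0).2.2
  linarith
end fin
def pths (es : List ℕ) : ℕ → List (List ℕ)
  | 0 => es.map fun e => [e]
  | n + 1 => (pths es n).flatMap fun p => match p with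
    | [] => []
    | h :: _ => (es.filter fun e => Nat.beq (nsrc e) (ntgt h) &&
        !(p.any fun q => Nat.beq (nsrc q) (nsrc e))).map fun e => e :: p
def isMn (l : List ℕ) : Bool := match l.getLast? with
  | none => false
  | some e => l.all fun n => Nat.ble (nsrc e) (nsrc n)
def cds (A B G : ℕ) : List (List ℕ × ℤ × ℕ) :=
  ((List.range 6).flatMap fun k => (pths ((List.range 72).filter fun n => G.testBit n) k).filter isMn).filterMap fun l =>
    force (mkMask l) fun M => force (6 * A / l.countP fun n => Nat.blt n 36) fun k =>
      bif okC A B (l, Int.ofNat k, M) then some (l, Int.ofNat k, M) else none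
def eqO : Option ℤ → ℤ → Bool
  | none, _ => false
  | some a, b => decide (a = b)
def tbB (D : Pt) : Bool := D.tb.all fun x => eqO (Wv (cds D.A D.B x.1) D.m x.1) x.2
theorem tbB_ok {D : Pt} (h : tbB D = true) : TBOK D := by
  intro x hx
  refine ⟨cds D.A D.B x.1, fun c hc => ?_, ?_⟩
  · rw [cds, List.mem_filterMap] at hc
    obtain ⟨l, -, hl⟩ := hc
    rw [force_eq, force_eq] at hl
    revert hl
    cases hb : okC D.A D.B (l, Int.ofNat (6 * D.A / l.countP fun n => Nat.blt n 36), mkMask l)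
    · simp
    · rw [cond_true]
      intro hl
      rw [← Option.some_inj.mp hl]
      exact hb
  · have := List.all_eq_true.mp h x hx
    revert this
    cases Wv (cds D.A D.B x.1) D.m x.1 with
    | none => simp [eqO]
    | some a => simp [eqO]
def D51 : Pt := ⟨5, 1, 1, 30, 1, (2, 0), (1, 0), (1, 0), [(73786976295379304706, 6)]⟩
def D41 : Pt := ⟨4, 1, 1, 24, 2, (2, 0), (1, 0), (-1, 0), [(148726874094824358146, 36)]⟩
def D31 : Pt := ⟨3, 1, 1, 18, 3, (2, 0), (1, 0), (-1, 0), [(297471762587617100034, 216)]⟩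
def D32 : Pt := ⟨3, 2, 1, 18, 2, (2, 0), (1, 0), (1, 0), [(297454029663551685122, 36), (297471762587084456452, 36), (592619667766965764612, 36)]⟩
def D21 : Pt := ⟨2, 1, 1, 12, 4, (-2, 0), (1, 0), (1, 0), [(594943806649669812482, 1296), (887767854421299429634, 0), (887767854421295300866, 648), (887767854421299429890, 648), (887767854421295301122, 0)]⟩
def D11 : Pt := ⟨1, 1, 1, 6, 7, (2, 0), (1, 0), (-1, 0), [(1777913332368375087618, 34992), (1777913332367846605314, 58320), (1777913332368375055362, 58320), (1777913332367846573058, 34992), (1777913332368375087620, 58320), (1777913332367846605316, 34992), (1777913332368375055364, 34992), (1777913332367846573060, 58320)]⟩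
def D42 : Pt := ⟨4, 2, 2, 24, 1, (2, 0), (-1, 0), (1, 0), [(295148186654870602242, 6), (147591966988722831876, 6), (76092819304060355076, 6), (296300826683968127490, 6), (590313824757752070402, 6)]⟩
def D22 : Pt := ⟨2, 2, 2, 12, 3, (-2, -1), (-1, 0), (0, -1), [(592673992437470921218, 216), (592673715360540721668, 216), (1182969802795648090626, 216), (304389854564678959620, 432), (1182969525718717891076, 216)]⟩
def D33 : Pt := ⟨3, 3, 3, 18, 1, (3, 0), (0, 1), (0, -1), [(1182897468124679929860, 6), (156797329024586153988, 6), (1181745105171979960836, 6), (295184215451885372424, 6), (78434691110284690440, 6), (594925510775642653698, 6), (590331843554308063236, 6), (152185920083088901128, 6), (591484760660331594756, 6), (1185203588210823791106, 6)]⟩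
theorem D51_c : (chkP D51 && tbB D51) = true := by decide +kernel
theorem D41_c : (chkP D41 && tbB D41) = true := by decide +kernel
theorem D31_c : (chkP D31 && tbB D31) = true := by decide +kernel
theorem D32_c : (chkP D32 && tbB D32) = true := by decide +kernel
theorem D21_c : (chkP D21 && tbB D21) = true := by decide +kernel
theorem D11_c : (chkP D11 && tbB D11) = true := by decide +kernel
theorem D42_c : (chkP D42 && tbB D42) = true := by decide +kernel
theorem D22_c : (chkP D22 && tbB D22) = true := by decide +kernel
theorem D33_c : (chkP D33 && tbB D33) = true := by decide +kernel
def OrdF (f : RQ) (m : ℕ) (h : PSQ) : Prop := ∃ (ev : RQ →+* ℂ) (u a b : RQ), ev f = 0 ∧ ev u ≠ 0 ∧ ev a ≠ 0 ∧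
  ev b ≠ 0 ∧ toPS ((f * u) ^ m * b) * h = toPS a
theorem one_lt_norm {z : ℂ} (h : 1 < z.re * z.re + z.im * z.im) : 1 < ‖z‖ := by
  rw [← Complex.normSq_apply, Complex.normSq_eq_norm_sq] at h
  nlinarith [norm_nonneg z]
theorem ord_of {D : Pt} (h : PtOK D) (hc : (chkP D && tbB D) = true) {f u : RQ}
    (hf : pev D.A D.B D.g (toC D.w) (toC D.η) f = 0) (hu : pev D.A D.B D.g (toC D.w) (toC D.η) u ≠ 0)
    (hfu : 1 - qs ^ D.A * qt ^ D.B = f * u) : OrdF f D.m SS := by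
  rw [Bool.and_eq_true] at hc
  obtain ⟨c, hc0, a, b, hb, e, ea⟩ := chk_lead h (tbB_ok hc.2) hc.1
  refine ⟨h.loc.ev, u, a, b, hf, hu, ?_, hb, ?_⟩
  · rw [ea]; exact mul_ne_zero hc0 hb
  · rw [← hfu]; exact e
theorem prim3 : IsPrimitiveRoot zeta 3 := by
  have h := zeta_sq
  refine IsPrimitiveRoot.mk_of_lt _ (by norm_num) ?_ ?_
  · linear_combination (zeta - 1) * h
  · intro l h1 h2
    have him : zeta.im ≠ 0 := by simp [zeta]
    interval_cases l
    · intro h'; rw [pow_one] at h'; rw [h'] at him; simp at him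
    · intro h'; rw [h] at h'
      have := congrArg Complex.im h'
      simp at this; exact him this
theorem okOne {D : Pt} (hg : D.g = 1) (hη : D.η = (1, 0)) (hw : 1 < ‖toC D.w‖) (hA : 0 < D.A)
    (hfin : finOK D.A D.B D.g) : PtOK D where
  hw := hw
  hη := by rw [hg, hη, toC_one]; exact IsPrimitiveRoot.one
  hg := by rw [hg]; exact one_pos
  hA := by rw [hg]; exact one_dvd _
  hB := by rw [hg]; exact one_dvd _
  hfin := hfin
  hoff := by rw [hg]; exact one_dvd _
  hA0 := hA
theorem nw2 : 1 < ‖toC (2, 0)‖ := one_lt_norm (by norm_num [toC, zeta])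
theorem nw2' : 1 < ‖toC (-2, 0)‖ := one_lt_norm (by norm_num [toC, zeta])
theorem one_ord {D : Pt} (hg : D.g = 1) (hη : D.η = (1, 0)) (hw : 1 < ‖toC D.w‖) (hA : 0 < D.A)
    (hfin : finOK D.A D.B D.g) (hc : (chkP D && tbB D) = true) : OrdF (1 - qs ^ D.A * qt ^ D.B) D.m SS :=
  ord_of (okOne hg hη hw hA hfin) hc (okOne hg hη hw hA hfin).loc.h0 (by simp) (mul_one _).symm
theorem ord51 : OrdF (1 - qs ^ 5 * qt ^ 1) 1 SS :=
  one_ord (D := D51) rfl rfl nw2 (by decide) (show finOK 5 1 1 from fun a ha b hb h1 h2 h3 h4 => ⟨b / 1, by omega⟩) D51_c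
theorem ord41 : OrdF (1 - qs ^ 4 * qt ^ 1) 2 SS :=
  one_ord (D := D41) rfl rfl nw2 (by decide) (show finOK 4 1 1 from fun a ha b hb h1 h2 h3 h4 => ⟨b / 1, by omega⟩) D41_c
theorem ord31 : OrdF (1 - qs ^ 3 * qt ^ 1) 3 SS :=
  one_ord (D := D31) rfl rfl nw2 (by decide) (show finOK 3 1 1 from fun a ha b hb h1 h2 h3 h4 => ⟨b / 1, by omega⟩) D31_c
theorem ord32 : OrdF (1 - qs ^ 3 * qt ^ 2) 2 SS :=
  one_ord (D := D32) rfl rfl nw2 (by decide) (show finOK 3 2 1 from fun a ha b hb h1 h2 h3 h4 => ⟨b / 2, by omega⟩) D32_c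
theorem ord21 : OrdF (1 - qs ^ 2 * qt ^ 1) 4 SS :=
  one_ord (D := D21) rfl rfl nw2' (by decide) (show finOK 2 1 1 from fun a ha b hb h1 h2 h3 h4 => ⟨b / 1, by omega⟩) D21_c
theorem ord11 : OrdF (1 - qs ^ 1 * qt ^ 1) 7 SS :=
  one_ord (D := D11) rfl rfl nw2 (by decide) (show finOK 1 1 1 from fun a ha b hb h1 h2 h3 h4 => ⟨b / 1, by omega⟩) D11_c
theorem ord42 : OrdF (1 + qs ^ 2 * qt) 1 SS := by
  have h : PtOK D42 := ⟨nw2, by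
    simpa [D42, toC] using IsPrimitiveRoot.neg_one 0 (by norm_num), by decide, by decide, by decide,
    (show finOK 4 2 2 from fun a ha b hb h1 h2 h3 h4 => ⟨b / 2, by omega⟩), by decide, by decide⟩
  refine ord_of h D42_c (u := 1 - qs ^ 2 * qt) ?_ ?_ (by simp only [D42]; ring) <;>
  · simp only [map_add, map_sub, map_mul, map_pow, map_one, pev_s, pev_t]
    norm_num [D42, toC]
theorem ord22 : OrdF (1 + qs * qt) 3 SS := by
  have h : PtOK D22 := ⟨one_lt_norm (by norm_num [D22, toC, zeta]; nlinarith [Real.mul_self_sqrt (show (0 : ℝ) ≤ 3 by norm_num)]), by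
    simpa [D22, toC] using IsPrimitiveRoot.neg_one 0 (by norm_num), by decide, by decide, by decide,
    (show finOK 2 2 2 from fun a ha b hb h1 h2 h3 h4 => ⟨b / 2, by omega⟩), by decide, by decide⟩
  have h0 : toC D22.w ≠ 0 := fun h' => by have := h.hw; rw [h', norm_zero] at this; linarith
  have hη : toC D22.η = -1 := by norm_num [D22, toC]
  refine ord_of h D22_c (u := 1 - qs * qt) ?_ ?_ (by simp only [D22]; ring) <;>
  · simp only [map_add, map_sub, map_mul, map_pow, map_one, pev_s, pev_t, hη]
    have h1 : D22.B / D22.g = 1 := rfl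
    have h2 : D22.A / D22.g = 1 := rfl
    rw [h1, h2, pow_one, mul_left_comm, mul_inv_cancel₀ h0]
    norm_num
theorem ord33 : OrdF (1 + qs * qt + qs ^ 2 * qt ^ 2) 1 SS := by
  have hη : toC D33.η = zeta := by norm_num [D33, toC]
  have h : PtOK D33 := ⟨one_lt_norm (by norm_num [D33, toC, zeta]), by
    rw [hη]; exact prim3, by decide, by decide, by decide,
    (show finOK 3 3 3 from fun a ha b hb h1 h2 h3 h4 => ⟨b / 3, by omega⟩), by decide, by decide⟩
  have h0 : toC D33.w ≠ 0 := fun h' => by have := h.hw; rw [h', norm_zero] at this; linarith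
  have h1 : D33.B / D33.g = 1 := rfl
  have h2 : D33.A / D33.g = 1 := rfl
  have h3 : pev D33.A D33.B D33.g (toC D33.w) (toC D33.η) (qs * qt) = zeta := by
    simp only [map_mul, pev_s, pev_t, hη, h1, h2, pow_one]
    rw [mul_left_comm, mul_inv_cancel₀ h0, mul_one]
  refine ord_of h D33_c (u := 1 - qs * qt) ?_ ?_ (by simp only [D33]; ring)
  · rw [← mul_pow]
    simp only [map_add, map_pow, map_one, h3]
    linear_combination zeta_sq
  · rw [map_sub, map_one, h3]
    intro h'
    have := congrArg Complex.im h'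
    simp [zeta] at this
section laurent
variable {R : Type*} [CommRing R]
theorem cauchy_vdm {n : ℕ} (s : R) (z w : Fin n → R) (h : ∀ i, z i * w i = 1) :
    ∑ σ : Equiv.Perm (Fin n), ((Equiv.Perm.sign σ : ℤ) : R) *
      ∏ i, ∏ j ∈ {σ i}ᶜ, (1 - s * z i * w j) =
    (∏ j : Fin n, s ^ (j : ℕ)) * ((vandermonde z).det * (vandermonde w).det) := by
  let P : Fin n → Polynomial R := fun j => ∏ k ∈ {j}ᶜ, (1 - Polynomial.X * Polynomial.C (w k))
  let Cm : Matrix (Fin n) (Fin n) R := Matrix.of fun l j => (P j).coeff l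
  have hdeg : ∀ j, (P j).natDegree < n := by
    intro j
    have h1 : (P j).natDegree ≤ ∑ k ∈ ({j}ᶜ : Finset (Fin n)), 1 := by
      refine (Polynomial.natDegree_prod_le _ _).trans (Finset.sum_le_sum fun k _ => ?_)
      compute_degree
    rw [Finset.sum_const, smul_eq_mul, mul_one, Finset.card_compl, Finset.card_singleton,
      Fintype.card_fin] at h1
    have := j.pos
    omega
  have hP : ∀ (x : R) j, (P j).eval x = ∏ k ∈ {j}ᶜ, (1 - x * w k) := by
    intro x j
    simp only [P, Polynomial.eval_prod, Polynomial.eval_sub, Polynomial.eval_one, Polynomial.eval_mul, Polynomial.eval_X, Polynomial.eval_C]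
  have hV : ∀ v : Fin n → R, vandermonde v * Cm = Matrix.of fun i j => ∏ k ∈ {j}ᶜ, (1 - v i * w k) := by
    intro v
    ext i j
    rw [Matrix.mul_apply, Matrix.of_apply, ← hP, Polynomial.eval_eq_sum_range' (hdeg j),
      Finset.sum_range]
    exact Finset.sum_congr rfl fun l _ => by simp [vandermonde_apply, Cm, mul_comm]
  have h1 := congrArg Matrix.det (hV fun i => s * z i)
  have h2 := congrArg Matrix.det (hV z)
  have h3 : (Matrix.of fun i j => ∏ k ∈ {j}ᶜ, (1 - z i * w k)) =
      Matrix.diagonal fun j => ∏ k ∈ {j}ᶜ, (1 - z j * w k) := by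
    ext i j
    rw [Matrix.of_apply, Matrix.diagonal_apply]
    split_ifs with hij
    · rw [hij]
    · exact Finset.prod_eq_zero (i := i) (by simpa using hij) (by rw [h]; ring)
  have h4 : (vandermonde fun i => s * z i) = vandermonde z * Matrix.diagonal fun j : Fin n => s ^ (j : ℕ) := by
    ext i j
    rw [Matrix.mul_diagonal]
    simp [vandermonde_apply, mul_pow, mul_comm]
  rw [h3, Matrix.det_mul, Matrix.det_diagonal] at h2
  rw [h4, Matrix.det_mul, Matrix.det_mul, Matrix.det_diagonal] at h1
  have h5 : (vandermonde z).det * (vandermonde w).det = ∏ j, ∏ k ∈ {j}ᶜ, (1 - z j * w k) := by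
    rw [det_vandermonde, det_vandermonde]
    simp_rw [← Finset.prod_mul_distrib]
    have := Finset.prod_prod_Ioi_mul_eq_prod_prod_off_diag (fun k j : Fin n => 1 - z j * w k)
    rw [← this]
    refine Finset.prod_congr rfl fun i _ => Finset.prod_congr rfl fun j _ => ?_
    have e1 := h i
    have e2 := h j
    linear_combination (1 - z j * w j) * e1 
  rw [h5, ← h2, ← mul_assoc, mul_comm (∏ j : Fin n, s ^ (j : ℕ)), h1, ← Matrix.det_transpose, Matrix.det_apply']
  rfl
abbrev Lau (R : Type*) [CommRing R] := AddMonoidAlgebra R (V6 → ℤ)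
def LF (F : (V6 → ℤ) → R) : Lau R →ₗ[R] R :=
  (Finsupp.linearCombination R F) ∘ₗ (AddMonoidAlgebra.coeffLinearEquiv R).toLinearMap
theorem LF_single (F : (V6 → ℤ) → R) (μ : V6 → ℤ) (c : R) :
    LF F (AddMonoidAlgebra.single μ c) = c * F μ := by
  simp [LF]
def zm (R : Type*) [CommRing R] (μ : V6 → ℤ) : Lau R := AddMonoidAlgebra.single μ 1
theorem zm_mul (μ ν : V6 → ℤ) : zm R μ * zm R ν = zm R (μ + ν) := by
  rw [zm, zm, AddMonoidAlgebra.single_mul_single, mul_one, zm]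
theorem zm_zero : zm R 0 = 1 := rfl
theorem zm_pow (μ : V6 → ℤ) (n : ℕ) : zm R μ ^ n = zm R (n • μ) := by
  rw [zm, AddMonoidAlgebra.single_pow, one_pow, zm]
theorem zm_prod {ι : Type*} (s : Finset ι) (μ : ι → V6 → ℤ) :
    ∏ i ∈ s, zm R (μ i) = zm R (∑ i ∈ s, μ i) := by
  classical
  induction s using Finset.induction_on with
  | empty => rfl
  | insert i s hi ih => rw [Finset.prod_insert hi, ih, zm_mul, Finset.sum_insert hi]
theorem LF_zm (F : (V6 → ℤ) → R) (μ : V6 → ℤ) : LF F (zm R μ) = F μ := by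
  rw [zm, LF_single, one_mul]
theorem vdm_zm (k : ℤ) : (vandermonde fun i : V6 => zm R (Pi.single i k)).det =
    ∑ σ : Equiv.Perm V6, ((Equiv.Perm.sign σ : ℤ) : R) • zm R (fun v => k * (σ⁻¹ v : ℕ)) := by
  rw [Matrix.det_apply']
  refine Finset.sum_congr rfl fun σ _ => ?_
  have : ∏ i, vandermonde (fun i : V6 => zm R (Pi.single i k)) (σ i) i =
      zm R (fun v => k * (σ⁻¹ v : ℕ)) := by
    simp only [vandermonde_apply, zm_pow]
    rw [zm_prod]
    congr 1
    funext v
    rw [Finset.sum_apply, Finset.sum_eq_single (σ⁻¹ v)]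
    · simp [mul_comm]
    · intro i _ hi
      have : σ i ≠ v := fun h => hi (by rw [← h]; simp)
      simp [this.symm]
    · simp
  rw [this, Algebra.smul_def, map_intCast]
end laurent
open Classical in
def wf (G : Finset E6) (μ : V6 → ℤ) (p q : ℕ) : Finset (E6 → ℕ) :=
  (monos p q).filter fun f => bd f = -μ ∧ ∀ e, e ∉ G → f e = 0
theorem mem_wf {G : Finset E6} {μ : V6 → ℤ} {p q : ℕ} {f : E6 → ℕ} :
    f ∈ wf G μ p q ↔ (dgx f = p ∧ dgy f = q) ∧ bd f = -μ ∧ ∀ e, e ∉ G → f e = 0 := by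
  simp only [wf, Finset.mem_filter, mem_monos]
def Wf (G : Finset E6) (μ : V6 → ℤ) : PSQ := fun d => ((wf G μ (d 0) (d 1)).card : ℚ)
theorem coeff_Wf (G : Finset E6) (μ : V6 → ℤ) (d : Fin 2 →₀ ℕ) :
    MvPowerSeries.coeff d (Wf G μ) = ((wf G μ (d 0) (d 1)).card : ℚ) := rfl
theorem Wf_zero (G : Finset E6) : Wf G 0 = Hf G := by
  ext d
  rw [coeff_Wf, coeff_Hf]
  congr 2
  ext f
  rw [mem_wf, mem_flowsOf, neg_zero]
theorem dgx_single (e : E6) : dgx (Pi.single e 1) = isX e := by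
  rw [dgx, Finset.sum_eq_single e]
  · simp
  · intro b _ hb; simp [hb]
  · simp
theorem dgy_single (e : E6) : dgy (Pi.single e 1) = isY e := by
  rw [dgy, Finset.sum_eq_single e]
  · simp
  · intro b _ hb; simp [hb]
  · simp
def xe (e : E6) : PSQ := toPS (qs ^ isX e * qt ^ isY e)
theorem Wf_rec {G : Finset E6} {e : E6} (he : e ∈ G) (μ : V6 → ℤ) :
    Wf (G.erase e) μ = Wf G μ - xe e * Wf G (μ + inc e) := by
  rw [eq_sub_iff_add_eq]
  ext d
  rw [map_add, xe, coeff_mon_mul, coeff_Wf, coeff_Wf _ μ d]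
  have h1 : (wf G μ (d 0) (d 1)).filter (fun f => f e = 0) = wf (G.erase e) μ (d 0) (d 1) := by
    ext f
    simp only [Finset.mem_filter, mem_wf, Finset.mem_erase, not_and_or, not_not]
    constructor
    · rintro ⟨⟨h1, h2, h3⟩, h4⟩
      exact ⟨h1, h2, fun e' he' => he'.elim (fun h => h ▸ h4) (h3 e')⟩
    · rintro ⟨h1, h2, h3⟩
      exact ⟨⟨h1, h2, fun e' he' => h3 e' (Or.inr he')⟩, h3 e (Or.inl rfl)⟩
  rw [← Finset.card_filter_add_card_filter_not (s := wf G μ (d 0) (d 1)) (fun f => f e = 0), h1,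
    Nat.cast_add]
  congr 1
  have key : ∀ f : E6 → ℕ, f e ≠ 0 → f = (f - Pi.single e 1) + Pi.single e 1 := by
    intro f hf
    funext e'
    by_cases h : e' = e
    · subst h; simp; omega
    · simp [h]
  split_ifs with h
  · rw [coeff_Wf]
    congr 1
    simp only [Finsupp.tsub_apply, Finsupp.add_apply, Finsupp.single_apply]
    norm_num
    refine Finset.card_bij' (fun g _ => g + Pi.single e 1) (fun f _ => f - Pi.single e 1) ?_ ?_ ?_ ?_
    · intro g hg
      obtain ⟨⟨h1, h2⟩, h3, h4⟩ := mem_wf.mp hg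
      refine Finset.mem_filter.mpr ⟨mem_wf.mpr ⟨⟨?_, ?_⟩, ?_, ?_⟩, by simp⟩
      · rw [dgx_add, dgx_single]; omega
      · rw [dgy_add, dgy_single]; omega
      · funext v; rw [bd_add, bd_single, h3]; simp
      · intro e' he'
        have : e' ≠ e := fun h => he' (h ▸ he)
        simp [h4 e' he', this]
    · intro f hf
      obtain ⟨hf, hfe⟩ := Finset.mem_filter.mp hf
      obtain ⟨⟨h1, h2⟩, h3, h4⟩ := mem_wf.mp hf
      have hk := key f hfe
      refine mem_wf.mpr ⟨⟨?_, ?_⟩, ?_, ?_⟩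
      · have := congrArg dgx hk; rw [dgx_add, dgx_single] at this; omega
      · have := congrArg dgy hk; rw [dgy_add, dgy_single] at this; omega
      · funext v
        have := congrFun (congrArg bd hk) v
        rw [bd_add, bd_single, h3] at this
        simp only [Pi.neg_apply, Pi.add_apply] at this ⊢
        omega
      · intro e' he'; simp [h4 e' he']
    · intro g _
      funext e'; simp
    · intro f hf
      exact (key f (Finset.mem_filter.mp hf).2).symm
  · symm
    rw [Nat.cast_eq_zero, Finset.card_eq_zero, Finset.filter_eq_empty_iff]
    intro f hf hfc
    obtain ⟨⟨h1, h2⟩, h3, h4⟩ := mem_wf.mp hf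
    have hk := key f hfc
    apply h
    constructor
    · have := congrArg dgx hk; rw [dgx_add, dgx_single] at this; omega
    · have := congrArg dgy hk; rw [dgy_add, dgy_single] at this; omega
theorem LF_erase {G : Finset E6} {e : E6} (he : e ∈ G) (x : Lau PSQ) :
    LF (Wf (G.erase e)) x = LF (Wf G) ((1 - xe e • zm PSQ (inc e)) * x) := by
  induction x using AddMonoidAlgebra.induction_linear with
  | zero => simp
  | add x y hx hy => rw [map_add, hx, hy, mul_add, map_add]
  | single μ c =>
    rw [sub_mul, one_mul, map_sub, smul_mul_assoc, map_smul, zm,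
      AddMonoidAlgebra.single_mul_single, LF_single, LF_single, LF_single, Wf_rec he,
      add_comm (inc e)]
    simp only [smul_eq_mul]
    ring
theorem LF_sdiff (S G : Finset E6) (hS : S ⊆ G) (x : Lau PSQ) :
    LF (Wf (G \ S)) x = LF (Wf G) ((∏ e ∈ S, (1 - xe e • zm PSQ (inc e))) * x) := by
  induction S using Finset.induction_on generalizing x with
  | empty => simp
  | insert e S he ih =>
    have h1 : G \ insert e S = (G \ S).erase e := by
      ext; simp; tauto
    rw [h1, LF_erase (Finset.mem_sdiff.mpr ⟨hS (Finset.mem_insert_self _ _), he⟩),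
      ih ((Finset.subset_insert _ _).trans hS), Finset.prod_insert he]
    congr 1
    ring
theorem Wf_symm (π : Equiv.Perm V6) (μ : V6 → ℤ) :
    Wf Finset.univ (μ ∘ π) = Wf Finset.univ μ := by
  ext d
  rw [coeff_Wf, coeff_Wf]
  congr 1
  refine Finset.card_equiv (Equiv.arrowCongr (pE π) (Equiv.refl ℕ)) fun f => ?_
  rw [mem_wf, mem_wf]
  set f' : E6 → ℕ := Equiv.arrowCongr (pE π) (Equiv.refl ℕ) f with hf'
  have hf : ∀ e, f' (pE π e) = f e := fun e => by simp [hf', Equiv.arrowCongr]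
  have h1 : dgx f' = dgx f := by
    rw [dgx, dgx, ← Equiv.sum_comp (pE π)]
    simp only [hf, isX_pE]
  have h2 : dgy f' = dgy f := by
    rw [dgy, dgy, ← Equiv.sum_comp (pE π)]
    simp only [hf, isY_pE]
  have h3 : ∀ v, bd f' (π v) = bd f v := fun v => by
    rw [bd, bd, ← Equiv.sum_comp (pE π)]
    simp only [hf, inc_pE]
  have h4 : bd f' = -μ ↔ bd f = -(μ ∘ π) := by
    constructor
    · intro h; funext v; rw [← h3, h]; rfl
    · intro h; funext v
      have := h3 (π.symm v)
      rw [Equiv.apply_symm_apply] at this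
      rw [this, h]; simp
  simp [h1, h2, h4]
theorem prod_not_Gs (σ : Equiv.Perm V6) :
    ∏ e ∈ Finset.univ \ Gs σ, (1 - xe e • zm PSQ (inc e)) =
    ∏ i, ∏ j ∈ {σ i}ᶜ, (1 - algebraMap PSQ (Lau PSQ) (toPS qs) * zm PSQ (Pi.single i 1) *
      zm PSQ (Pi.single j (-1))) := by
  rw [Finset.prod_sigma']
  symm
  refine Finset.prod_bij (fun a _ => Sum.inl (a.1, a.2)) ?_ ?_ ?_ ?_
  · rintro ⟨i, j⟩ h
    simp only [Finset.mem_sigma, Finset.mem_compl, Finset.mem_singleton] at h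
    simp [mem_Gs_inl, h.2]
  · rintro ⟨i, j⟩ _ ⟨i', j'⟩ _ h
    simp only [Sum.inl.injEq, Prod.mk.injEq] at h
    obtain ⟨rfl, rfl⟩ := h
    rfl
  · rintro (⟨i, j⟩ | ij) h
    · refine ⟨⟨i, j⟩, ?_, rfl⟩
      simpa [mem_Gs_inl] using h
    · exact absurd mem_Gs_inr (Finset.mem_sdiff.mp h).2
  · rintro ⟨i, j⟩ _
    rw [mul_assoc, zm_mul, ← Algebra.smul_def]
    have : (Pi.single i 1 + Pi.single j (-1) : V6 → ℤ) = inc (Sum.inl (i, j)) := by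
      funext v
      simp only [Pi.add_apply, Pi.single_apply, inc, esrc, etgt, eq_comm (a := v)]
      split_ifs <;> simp_all
    rw [this, xe, isX, isY, pow_one, pow_zero, mul_one]
theorem SS_eq : SS = toPS (C 720 * qs ^ 15) *
    ∑ w : Equiv.Perm V6, toPS ((Equiv.Perm.sign w : ℤ) : RQ) *
      Wf Finset.univ (fun v => (v : ℕ) - (w v : ℕ)) := by
  have h1 : SS = LF (Wf Finset.univ) (∑ σ : Equiv.Perm V6, ((Equiv.Perm.sign σ : ℤ) : Lau PSQ) *
      ∏ i, ∏ j ∈ {σ i}ᶜ, (1 - algebraMap PSQ (Lau PSQ) (toPS qs) * zm PSQ (Pi.single i 1) *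
      zm PSQ (Pi.single j (-1)))) := by
    rw [SS, map_sum]
    refine Finset.sum_congr rfl fun σ _ => ?_
    have h2 := LF_sdiff (Finset.univ \ Gs σ) Finset.univ (Finset.subset_univ _) 1
    rw [sdiff_sdiff_right_self, Finset.inf_eq_inter, Finset.univ_inter, mul_one, prod_not_Gs,
      ← zm_zero, LF_zm, Wf_zero, zm_zero] at h2
    rw [h2]
    have h3 : ((Equiv.Perm.sign σ : ℤ) : Lau PSQ) = algebraMap PSQ _ ((Equiv.Perm.sign σ : ℤ) : PSQ) := by
      rw [map_intCast]
    rw [h3, ← Algebra.smul_def, map_smul, map_intCast, smul_eq_mul]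
  rw [h1, cauchy_vdm _ _ _ (fun i => by
    rw [zm_mul, ← Pi.single_add]; simp [zm_zero]), vdm_zm, vdm_zm]
  have h4 : (∏ j : Fin 6, algebraMap PSQ (Lau PSQ) (toPS qs) ^ (j : ℕ)) =
      algebraMap PSQ (Lau PSQ) (toPS (qs ^ 15)) := by
    rw [Finset.prod_pow_eq_pow_sum, map_pow, map_pow]
    rfl
  rw [h4, ← Algebra.smul_def, map_smul, Finset.sum_mul, map_sum, smul_eq_mul, mul_comm (C 720), map_mul,
    mul_assoc]
  congr 1
  have h5 : ∀ σ : Equiv.Perm V6, LF (Wf Finset.univ)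
      ((((Equiv.Perm.sign σ : ℤ) : PSQ) • zm PSQ fun v => 1 * (σ⁻¹ v : ℕ)) *
      ∑ τ : Equiv.Perm V6, ((Equiv.Perm.sign τ : ℤ) : PSQ) • zm PSQ fun v => -1 * (τ⁻¹ v : ℕ)) =
      ∑ w : Equiv.Perm V6, toPS ((Equiv.Perm.sign w : ℤ) : RQ) *
      Wf Finset.univ (fun v => (v : ℕ) - (w v : ℕ)) := by
    intro σ
    rw [Finset.mul_sum, map_sum]
    refine Fintype.sum_equiv ((Equiv.inv _).trans (Equiv.mulRight σ)) _ _ fun τ => ?_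
    rw [smul_mul_smul_comm, zm_mul, map_smul, LF_zm, smul_eq_mul, ← Wf_symm σ]
    congr 1
    · simp [mul_comm]
    · congr 1
      funext v
      simp [sub_eq_add_neg]
  rw [Finset.sum_congr rfl fun σ _ => h5 σ, Finset.sum_const, Finset.card_univ, Fintype.card_perm,
    Fintype.card_fin, nsmul_eq_mul]
  congr 1
  have : (C 720 : RQ) = ((Nat.factorial 6 : ℕ) : RQ) := by
    rw [← map_natCast (C : ℚ →+* RQ)]; norm_num [Nat.factorial]
  rw [this, map_natCast]
section weyl
def Pos : Finset (V6 × V6) := Finset.univ.filter fun p => p.1 < p.2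
def rt (p : V6 × V6) : V6 → ℤ := Pi.single p.1 1 - Pi.single p.2 1
def hh (μ : V6 → ℤ) : ℤ := ∑ a : V6, (5 - 2 * (a : ℕ)) * μ a
theorem hh_eq (μ : V6 → ℤ) : ∑ p ∈ Pos, (μ p.1 - μ p.2) = hh μ := by
  simp only [Pos, hh, Finset.sum_filter, Fintype.sum_prod_type, Fin.sum_univ_six]
  simp [Fin.lt_def]
  ring
theorem hh_add (μ ν : V6 → ℤ) : hh (μ + ν) = hh μ + hh ν := by
  simp [hh, mul_add, Finset.sum_add_distrib]
theorem hh_rt (p : V6 × V6) : hh (rt p) = 2 * (p.2 : ℕ) - 2 * (p.1 : ℕ) := by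
  simp only [hh, rt, Pi.sub_apply, mul_sub, Finset.sum_sub_distrib, Pi.single_apply, mul_ite,
    mul_one, mul_zero, Finset.sum_ite_eq', Finset.mem_univ, if_true]
  ring
def wr (w : Equiv.Perm V6) : V6 → ℤ := fun v => (w v : ℕ) - (v : ℕ)
theorem hh_wr (w : Equiv.Perm V6) : hh (wr w) = ∑ a, wr w a * wr w a := by
  have h1 : ∑ a, ((w a : ℕ) : ℤ) = ∑ a : V6, ((a : ℕ) : ℤ) := Equiv.sum_comp w fun a => ((a : ℕ) : ℤ)
  have h2 : ∑ a, ((w a : ℕ) : ℤ) * (w a : ℕ) = ∑ a : V6, ((a : ℕ) : ℤ) * (a : ℕ) :=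
    Equiv.sum_comp w fun a => ((a : ℕ) : ℤ) * (a : ℕ)
  rw [← sub_eq_zero, hh, ← Finset.sum_sub_distrib]
  have : ∀ a : V6, (5 - 2 * ((a : ℕ) : ℤ)) * wr w a - wr w a * wr w a =
    5 * ((w a : ℕ) : ℤ) - 5 * ((a : ℕ) : ℤ) + (((a : ℕ) : ℤ) * (a : ℕ) - ((w a : ℕ) : ℤ) * (w a : ℕ)) := by
    intro a; simp only [wr]; ring
  rw [Finset.sum_congr rfl fun a _ => this a, Finset.sum_add_distrib, Finset.sum_sub_distrib,
    Finset.sum_sub_distrib, ← Finset.mul_sum, ← Finset.mul_sum, h1, h2]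
  ring
variable {K : Type*} [Field K]
theorem prod_Pos : ∏ p ∈ Pos, (1 - zm K (rt p)) =
    ∑ w : Equiv.Perm V6, ((Equiv.Perm.sign w : ℤ) : K) • zm K (wr w) := by
  have h1 : ∏ p ∈ Pos, (1 - zm K (rt p)) = ∏ i : V6, ∏ j ∈ Finset.Ioi i, (1 - zm K (rt (i, j))) := by
    rw [Finset.prod_sigma']
    refine Finset.prod_bij' (fun p _ => ⟨p.1, p.2⟩) (fun p _ => (p.1, p.2)) ?_ ?_ ?_ ?_ ?_ <;>
      simp [Pos]
  have h2 := det_vandermonde (fun i : V6 => zm K (Pi.single i 1))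
  have h3 : ∀ i j : V6, zm K (Pi.single j 1) - zm K (Pi.single i 1) =
      zm K (Pi.single j 1) * (1 - zm K (rt (i, j))) := by
    intro i j
    rw [mul_sub, mul_one, zm_mul, rt]
    congr 2
    simp
  simp_rw [h3, Finset.prod_mul_distrib, zm_prod] at h2
  rw [← h1, vdm_zm] at h2
  have h4 : (∑ i : V6, ∑ j ∈ Finset.Ioi i, Pi.single j 1 : V6 → ℤ) = fun v : V6 => ((v : ℕ) : ℤ) := by
    decide
  rw [h4] at h2
  have h5 := congrArg (fun x => zm K (fun v : V6 => -((v : ℕ) : ℤ)) * x) h2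
  rw [← mul_assoc, zm_mul] at h5
  have h6 : (fun v : V6 => -((v : ℕ) : ℤ)) + (fun v : V6 => ((v : ℕ) : ℤ)) = 0 := by
    funext v; simp
  rw [h6, zm_zero, one_mul, Finset.mul_sum] at h5
  rw [← h5]
  refine Fintype.sum_equiv (Equiv.inv _) _ _ fun w => ?_
  rw [mul_smul_comm, zm_mul]
  congr 2
  · simp
  · funext v; simp [wr]; ring
def Lw (F : (V6 → ℤ) → K) : K := ∑ w : Equiv.Perm V6, ((Equiv.Perm.sign w : ℤ) : K) * F (wr w)
theorem Lw_eq (F : (V6 → ℤ) → K) :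
    Lw F = ∑ S ∈ Pos.powerset, (-1) ^ S.card * F (∑ p ∈ S, rt p) := by
  have h := congrArg (LF F) (prod_Pos (K := K))
  rw [map_sum] at h
  simp only [map_smul, LF_zm, smul_eq_mul] at h
  rw [Lw, ← h]
  have := Finset.prod_add (fun p => -zm K (rt p)) (fun _ => 1) Pos
  simp only [Finset.prod_const_one, mul_one, neg_add_eq_sub] at this
  rw [this, map_sum]
  refine Finset.sum_congr rfl fun S _ => ?_
  rw [Finset.prod_neg, zm_prod]
  have h3 : (-1 : Lau K) ^ S.card = algebraMap K _ ((-1) ^ S.card) := by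
    rw [map_pow, map_neg, map_one]
  rw [h3, ← Algebra.smul_def, map_smul, LF_zm, smul_eq_mul]
theorem dot_rt (ν : V6 → ℤ) (S : Finset (V6 × V6)) :
    ∑ p ∈ S, (ν p.1 - ν p.2) = ∑ a, ν a * (∑ q ∈ S, rt q) a := by
  simp_rw [Finset.sum_apply, Finset.mul_sum]
  rw [Finset.sum_comm]
  refine Finset.sum_congr rfl fun p _ => ?_
  simp [rt, mul_sub, Finset.sum_sub_distrib, Pi.single_apply]
theorem Lw_T (T : V6 × V6 → (V6 → ℤ) → K) (M : (V6 → ℤ) → K)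
    (hT : ∀ p μ, T p μ - T p (μ + rt p) = ((μ p.1 - μ p.2 : ℤ) : K) * M μ) :
    Lw (fun μ => ∑ p ∈ Pos, T p μ) = Lw (fun μ => ((hh μ - ∑ a, μ a * μ a : ℤ) : K) * M μ) := by
  rw [Lw_eq, Lw_eq]
  simp_rw [Finset.mul_sum]
  rw [Finset.sum_comm]
  have h1 : ∀ p ∈ Pos, ∑ S ∈ Pos.powerset, (-1 : K) ^ S.card * T p (∑ q ∈ S, rt q) =
      ∑ S ∈ Pos.powerset, if p ∉ S then (-1 : K) ^ S.card *
        ((((∑ q ∈ S, rt q) p.1 - (∑ q ∈ S, rt q) p.2 : ℤ) : K) * M (∑ q ∈ S, rt q)) else 0 := by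
    intro p hp
    rw [← Finset.insert_erase hp, Finset.sum_powerset_insert (Finset.notMem_erase p _),
      Finset.sum_powerset_insert (Finset.notMem_erase p _), ← Finset.sum_add_distrib,
      ← Finset.sum_add_distrib]
    refine Finset.sum_congr rfl fun S hS => ?_
    have hpS : p ∉ S := fun h => Finset.notMem_erase p _ (Finset.mem_powerset.mp hS h)
    rw [if_pos hpS, if_neg (by simp), ← hT, Finset.sum_insert hpS, Finset.card_insert_of_notMem hpS,
      add_comm (rt p)]
    ring
  rw [Finset.sum_congr rfl h1, Finset.sum_comm]
  refine Finset.sum_congr rfl fun S hS => ?_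
  rw [← Finset.sum_filter, ← Finset.mul_sum, ← Finset.sum_mul, ← Int.cast_sum]
  congr 3
  rw [Finset.filter_notMem_eq_sdiff, ← hh_eq]
  rw [eq_sub_iff_add_eq, ← Finset.sum_sdiff (Finset.mem_powerset.mp hS)]
  congr 1
  exact (dot_rt _ S).symm
theorem Lw_zero (M : (V6 → ℤ) → K) :
    Lw (fun μ => ((hh μ - ∑ a, μ a * μ a : ℤ) : K) * M μ) = 0 := by
  refine Finset.sum_eq_zero fun w _ => ?_
  simp only [hh_wr, sub_self, Int.cast_zero, zero_mul, mul_zero]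
theorem sum_split {A : Type*} [AddCommMonoid A] (f : V6 → V6 → A) :
    ∑ a, ∑ b, f a b = ∑ a, f a a + ∑ p ∈ Pos, (f p.1 p.2 + f p.2 p.1) := by
  simp only [Pos, Finset.sum_filter, Fintype.sum_prod_type, Fin.sum_univ_six]
  simp [Fin.lt_def]
  abel
theorem eq_zero_of_pow {x : K} {k : ℕ} (h : x ^ k = 0) : x = 0 := by
  by_contra h0
  exact pow_ne_zero k h0 h
theorem aeval_comm {A : Type*} [Ring A] [Algebra K A] (f : Polynomial K) {x y : A} (h : Commute x y) :
    Commute x (Polynomial.aeval y f) := by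
  rw [Polynomial.aeval_eq_sum_range]
  exact Commute.sum_right _ _ _ fun i _ => (h.pow_right i).smul_right _
section rep
set_option linter.unusedSectionVars false
variable [CharZero K] {V : Type*} [AddCommGroup V] [Module K V] [FiniteDimensional K V]
  (R : V6 → V6 → Module.End K V) (π : (V6 → ℤ) → Module.End K V)
def Om : Module.End K V := ∑ a, ∑ b, R a b * R b a
variable {R π}
variable (hbr : ∀ a b c d, R a b * R c d - R c d * R a b =
    (if b = c then R a d else 0) - (if d = a then R c b else 0))
  (hR : ∀ a b μ, R a b * π μ = π (μ + rt (a, b)) * R a b)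
  (hd : ∀ a μ, R a a * π μ = ((μ a : ℤ) : K) • π μ)
include hbr in
theorem Om_comm (c d : V6) : R c d * Om R = Om R * R c d := by
  rw [← sub_eq_zero, Om, Finset.mul_sum, Finset.sum_mul, ← Finset.sum_sub_distrib]
  simp_rw [Finset.mul_sum, Finset.sum_mul, ← Finset.sum_sub_distrib]
  have h : ∀ a b, R c d * (R a b * R b a) - R a b * R b a * R c d =
      (R c d * R a b - R a b * R c d) * R b a + R a b * (R c d * R b a - R b a * R c d) := by
    intro a b; noncomm_ring
  simp_rw [h, hbr, sub_mul, mul_sub, ite_mul, mul_ite, zero_mul, mul_zero, Finset.sum_add_distrib,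
    Finset.sum_sub_distrib]
  simp only [Finset.sum_ite_eq, Finset.sum_ite_eq', Finset.mem_univ, if_true]
  rw [Finset.sum_comm, Finset.sum_comm (f := fun x y => if x = c then _ else _)]
  simp only [Finset.sum_ite_eq, Finset.sum_ite_eq', Finset.mem_univ, if_true]
  abel
include hR in
theorem Om_pi (μ : V6 → ℤ) : Om R * π μ = π μ * Om R := by
  simp only [Om, Finset.mul_sum, Finset.sum_mul]
  refine Finset.sum_congr rfl fun a _ => Finset.sum_congr rfl fun b _ => ?_
  rw [mul_assoc, hR, ← mul_assoc, hR, mul_assoc]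
  congr 2
  simp [rt]
  abel
include hbr in
theorem Om_eq : Om R = ∑ a, R a a * R a a + ∑ p ∈ Pos, (2 • (R p.1 p.2 * R p.2 p.1) - (R p.1 p.1 - R p.2 p.2)) := by
  rw [Om, sum_split]
  congr 1
  refine Finset.sum_congr rfl fun p _ => ?_
  have := hbr p.1 p.2 p.2 p.1
  rw [if_pos rfl, if_pos rfl] at this
  rw [← this]
  abel
include hbr hR hd in
theorem Lw_Om (θ : Module.End K V) (hθ : ∀ a b, R a b * θ = θ * R a b) :
    Lw (fun μ => LinearMap.trace K V (Om R * θ * π μ)) = 0 := by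
  let M : (V6 → ℤ) → K := fun μ => LinearMap.trace K V (θ * π μ)
  let T : V6 × V6 → (V6 → ℤ) → K := fun p μ => LinearMap.trace K V (R p.1 p.2 * R p.2 p.1 * θ * π μ)
  have hdiag : ∀ a μ, R a a * (θ * π μ) = ((μ a : ℤ) : K) • (θ * π μ) := by
    intro a μ
    rw [← mul_assoc, hθ, mul_assoc, hd, mul_smul_comm]
  have hT : ∀ p μ, T p μ - T p (μ + rt p) = ((μ p.1 - μ p.2 : ℤ) : K) * M μ := by
    intro p μ
    have h1 : T p (μ + rt p) = LinearMap.trace K V (R p.2 p.1 * R p.1 p.2 * θ * π μ) := by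
      simp only [T]
      rw [mul_assoc, mul_assoc, LinearMap.trace_mul_comm, mul_assoc, mul_assoc, ← hR, ← mul_assoc θ, ← hθ]
      simp only [mul_assoc]
    have h2 := hbr p.1 p.2 p.2 p.1
    rw [if_pos rfl, if_pos rfl] at h2
    rw [h1, ← map_sub, ← sub_mul, ← sub_mul, h2, mul_assoc, sub_mul, hdiag, hdiag, ← sub_smul, map_smul]
    simp [M]
  have h3 : (fun μ => LinearMap.trace K V (Om R * θ * π μ)) = fun μ =>
      -(((hh μ - ∑ a, μ a * μ a : ℤ) : K) * M μ) + 2 * ∑ p ∈ Pos, T p μ := by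
    funext μ
    rw [Om_eq hbr, mul_assoc, add_mul, map_add, Finset.sum_mul, Finset.sum_mul, map_sum, map_sum]
    have e1 : ∀ a, LinearMap.trace K V (R a a * R a a * (θ * π μ)) = ((μ a * μ a : ℤ) : K) * M μ := by
      intro a
      rw [mul_assoc, hdiag, mul_smul_comm, hdiag, smul_smul, map_smul]
      simp [M]
    have e2 : ∀ p : V6 × V6, LinearMap.trace K V ((2 • (R p.1 p.2 * R p.2 p.1) - (R p.1 p.1 - R p.2 p.2)) * (θ * π μ)) =
        2 * T p μ - ((μ p.1 - μ p.2 : ℤ) : K) * M μ := by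
      intro p
      rw [sub_mul, sub_mul, hdiag, hdiag, ← sub_smul, map_sub, map_smul, smul_mul_assoc, map_nsmul]
      simp [T, M, mul_assoc]
    simp_rw [e1, e2]
    rw [Finset.sum_sub_distrib, ← Finset.sum_mul, ← Finset.sum_mul, ← Finset.mul_sum, ← Int.cast_sum,
      ← Int.cast_sum, hh_eq]
    push_cast
    ring
  have h4 := Lw_T T M hT
  rw [Lw_zero] at h4
  have h5 := Lw_zero M
  rw [h3]
  simp only [Lw, mul_add, Finset.sum_add_distrib, mul_neg, Finset.sum_neg_distrib] at h4 h5 ⊢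
  rw [h5, neg_zero, zero_add]
  simp_rw [mul_left_comm _ (2 : K)]
  rw [← Finset.mul_sum, h4, mul_zero]
include hbr hR hd in
theorem wt_zero {e : Module.End K V} (he : ∀ a b, R a b * e = e * R a b) (heπ : ∀ μ, π μ * e = e * π μ)
    {k : ℕ} (hk : Om R ^ k * e = 0) (S : Finset (V6 → ℤ)) (hS0 : ∀ μ, μ ∉ S → π μ = 0)
    (ν : V6 → ℤ) (hν : π ν * e ≠ 0) : ν = 0 := by
  classical
  let S' := S.filter fun μ => π μ * e ≠ 0
  have hS' : ∀ μ, π μ * e ≠ 0 → μ ∈ S' := fun μ h =>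
    Finset.mem_filter.mpr ⟨by by_contra h'; exact h (by rw [hS0 μ h', zero_mul]), h⟩
  have hne : S'.Nonempty := ⟨ν, hS' ν hν⟩
  have hdiag : ∀ a μ, R a a * (π μ * e) = ((μ a : ℤ) : K) • (π μ * e) := by
    intro a μ
    rw [← mul_assoc, hd, smul_mul_assoc]
  have hext : ∀ μ, π μ * e ≠ 0 → ∀ c : ℤ, Om R * (π μ * e) = (c : K) • (π μ * e) → c = 0 := by
    intro μ hμ c hc
    by_contra hc0
    have h1 : ∀ j : ℕ, Om R ^ j * (π μ * e) = (c : K) ^ j • (π μ * e) := by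
      intro j
      induction j with
      | zero => simp
      | succ j ih => rw [pow_succ', mul_assoc, ih, mul_smul_comm, hc, smul_smul, pow_succ]
    have h2 := h1 k
    rw [heπ, ← mul_assoc, hk, zero_mul, ← heπ, eq_comm, smul_eq_zero] at h2
    rcases h2 with h2 | h2
    · exact hc0 (Int.cast_eq_zero.mp (eq_zero_of_pow h2))
    · exact hμ h2
  have hroot : ∀ p μ, π (μ + rt p) * e = 0 → R p.1 p.2 * (π μ * e) = 0 := by
    intro p μ h
    rw [← mul_assoc, hR, mul_assoc, he, ← mul_assoc, h, zero_mul]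
  have hcomm : ∀ p : V6 × V6, R p.1 p.2 * R p.2 p.1 = R p.2 p.1 * R p.1 p.2 + (R p.1 p.1 - R p.2 p.2) := by
    intro p
    have h2 := hbr p.1 p.2 p.2 p.1
    rw [if_pos rfl, if_pos rfl] at h2
    rw [← h2]; abel
  have hsq : ∀ μ, (∑ a, R a a * R a a) * (π μ * e) = ((∑ a, μ a * μ a : ℤ) : K) • (π μ * e) := by
    intro μ
    rw [Finset.sum_mul, Int.cast_sum, Finset.sum_smul]
    refine Finset.sum_congr rfl fun a _ => ?_
    rw [mul_assoc, hdiag, mul_smul_comm, hdiag, smul_smul, Int.cast_mul]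
  have hlin : ∀ μ, ∑ p ∈ Pos, (R p.1 p.1 - R p.2 p.2) * (π μ * e) = ((hh μ : ℤ) : K) • (π μ * e) := by
    intro μ
    rw [← hh_eq, Int.cast_sum, Finset.sum_smul]
    refine Finset.sum_congr rfl fun p _ => ?_
    rw [sub_mul, hdiag, hdiag, ← sub_smul, Int.cast_sub]
  have hup : ∀ μ, (∀ ν ∈ S', hh ν ≤ hh μ) → π μ * e ≠ 0 → (∑ a, μ a * μ a) + hh μ = 0 := by
    intro μ hmax hμ
    refine hext μ hμ _ ?_
    rw [Om_eq hbr, add_mul, hsq, Int.cast_add, add_smul, ← hlin, Finset.sum_mul]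
    congr 1
    refine Finset.sum_congr rfl fun p hp => ?_
    have h0 : R p.1 p.2 * (π μ * e) = 0 := hroot p μ (by
      by_contra h
      have := hmax _ (hS' _ h)
      rw [hh_add, hh_rt] at this
      have hp' : p.1 < p.2 := (Finset.mem_filter.mp hp).2
      have : (p.1 : ℕ) < (p.2 : ℕ) := hp'
      omega)
    rw [hcomm, sub_mul, smul_mul_assoc, add_mul, mul_assoc, h0]
    simp only [mul_zero, zero_add]
    rw [two_smul]; abel
  have hdn : ∀ μ, (∀ ν ∈ S', hh μ ≤ hh ν) → π μ * e ≠ 0 → (∑ a, μ a * μ a) - hh μ = 0 := by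
    intro μ hmin hμ
    refine hext μ hμ _ ?_
    rw [Om_eq hbr, add_mul, hsq, Int.cast_sub, sub_smul, ← hlin, Finset.sum_mul, sub_eq_add_neg,
      ← Finset.sum_neg_distrib]
    congr 1
    refine Finset.sum_congr rfl fun p hp => ?_
    have h0 : R p.2 p.1 * (π μ * e) = 0 := hroot (p.2, p.1) μ (by
      by_contra h
      have := hmin _ (hS' _ h)
      rw [hh_add, hh_rt] at this
      have hp' : p.1 < p.2 := (Finset.mem_filter.mp hp).2
      have : (p.1 : ℕ) < (p.2 : ℕ) := hp'
      simp only at *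
      omega)
    rw [sub_mul, smul_mul_assoc, mul_assoc, h0]
    simp
  obtain ⟨μ1, h11, h12⟩ := S'.exists_max_image hh hne
  obtain ⟨μ2, h21, h22⟩ := S'.exists_min_image hh hne
  have k1 := hup μ1 h12 (Finset.mem_filter.mp h11).2
  have k2 := hdn μ2 h22 (Finset.mem_filter.mp h21).2
  have hnn : ∀ μ : V6 → ℤ, 0 ≤ ∑ a, μ a * μ a := fun μ =>
    Finset.sum_nonneg fun a _ => mul_self_nonneg _
  have k3 : ∀ μ ∈ S', hh μ = 0 := by
    intro μ hμ
    have := h12 μ hμ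
    have := h22 μ hμ
    have := hnn μ1
    have := hnn μ2
    omega
  have k4 := hup ν (fun μ hμ => by rw [k3 μ hμ, k3 ν (hS' ν hν)]) hν
  rw [k3 ν (hS' ν hν), add_zero, Finset.sum_eq_zero_iff_of_nonneg (fun a _ => mul_self_nonneg _)] at k4
  funext a
  simpa using k4 a (Finset.mem_univ a)
include hbr hR hd in
theorem weyl_dim (S : Finset (V6 → ℤ)) (hS : ∑ μ ∈ S, π μ = 1) (hS0 : ∀ μ, μ ∉ S → π μ = 0) :
    (Module.finrank K (⨅ a, ⨅ b, LinearMap.ker (R a b) : Submodule K V) : K) =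
      Lw (fun μ => LinearMap.trace K V (π μ)) := by
  obtain ⟨q, hq, hnd⟩ := Polynomial.exists_eq_pow_rootMultiplicity_mul_and_not_dvd
    (minpoly K (Om R)) (minpoly.ne_zero (Algebra.IsIntegral.isIntegral (Om R))) 0
  set k := (minpoly K (Om R)).rootMultiplicity 0
  rw [map_zero, sub_zero] at hq hnd
  have hco : IsCoprime (Polynomial.X ^ (k + 1)) q :=
    ((Polynomial.irreducible_X.coprime_iff_not_dvd).mpr hnd).pow_left
  obtain ⟨u, v, huv⟩ := hco
  set e := Polynomial.aeval (Om R) (v * q) with he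
  set θ := Polynomial.aeval (Om R) (u * Polynomial.X ^ k) with hθ
  have hcR : ∀ (f : Polynomial K) a b, R a b * Polynomial.aeval (Om R) f = Polynomial.aeval (Om R) f * R a b := by
    intro f a b
    have h1 : Commute (R a b) (Om R) := Om_comm hbr a b
    exact (aeval_comm f h1)
  have hcπ : ∀ (f : Polynomial K) μ, π μ * Polynomial.aeval (Om R) f = Polynomial.aeval (Om R) f * π μ := by
    intro f μ
    have h1 : Commute (π μ) (Om R) := (Om_pi hR μ).symm
    exact (aeval_comm f h1)
  have h1 : e + Om R * θ = 1 := by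
    have h : v * q + Polynomial.X * (u * Polynomial.X ^ k) = 1 := by rw [← huv]; ring
    have := congrArg (Polynomial.aeval (Om R)) h
    rwa [map_add, map_mul _ Polynomial.X, Polynomial.aeval_X, map_one] at this
  have h2 : Om R ^ k * e = 0 := by
    have h := minpoly.aeval K (Om R)
    have h' : Polynomial.X ^ k * (v * q) = v * minpoly K (Om R) := by rw [hq]; ring
    have := congrArg (Polynomial.aeval (Om R)) h'
    rwa [map_mul, map_pow, Polynomial.aeval_X, map_mul _ v (minpoly K (Om R)), h, mul_zero] at this
  have h3 := wt_zero hbr hR hd (hcR _) (hcπ _) h2 S hS0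
  have h4 : π 0 * e = e := by
    conv_rhs => rw [← one_mul e, ← hS, Finset.sum_mul]
    by_cases h0 : (0 : V6 → ℤ) ∈ S
    · rw [Finset.sum_eq_single_of_mem 0 h0]
      intro μ _ hμ
      by_contra h
      exact hμ (h3 μ h)
    · rw [hS0 0 h0, zero_mul, Finset.sum_eq_zero]
      intro μ hμ
      by_contra h
      exact h0 (h3 μ h ▸ hμ)
  have h5 : ∀ a b, R a b * e = 0 := by
    intro a b
    by_cases hab : a = b
    · subst hab
      rw [← h4, ← mul_assoc, hd]; simp
    · have : rt (a, b) ≠ 0 := by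
        intro h
        have := congrFun h a
        simp [rt, hab] at this
      have h6 : π (0 + rt (a, b)) * e = 0 := by
        by_contra h
        exact this (by simpa using h3 _ h)
      rw [← h4, ← mul_assoc, hR, mul_assoc, hcR, ← mul_assoc, h6, zero_mul]
  have hproj : LinearMap.IsProj (⨅ a, ⨅ b, LinearMap.ker (R a b) : Submodule K V) e := by
    constructor
    · intro x
      simp only [Submodule.mem_iInf, LinearMap.mem_ker]
      intro a b
      exact congrArg (fun f : Module.End K V => f x) (h5 a b)
    · intro x hx
      simp only [Submodule.mem_iInf, LinearMap.mem_ker] at hx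
      have h6 := congrArg (fun f : Module.End K V => f x) h1
      have h7 : Om R x = 0 := by
        simp [Om, hx]
      have h8 : Om R * θ = θ * Om R := by
        rw [hθ]
        exact aeval_comm _ (Commute.refl (Om R))
      rw [h8] at h6
      simpa [h7] using h6
  rw [← hproj.trace]
  have h9 : ∀ μ, LinearMap.trace K V (π μ) = LinearMap.trace K V (π μ * e) + LinearMap.trace K V (Om R * θ * π μ) := by
    intro μ
    rw [hcπ, ← map_add, ← add_mul, h1, one_mul]
  simp_rw [h9, Lw, mul_add, Finset.sum_add_distrib]
  have h10 := Lw_Om hbr hR hd θ (hcR _)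
  rw [Lw] at h10
  rw [h10, add_zero, Finset.sum_eq_single 1]
  · have : wr 1 = 0 := by funext v; simp [wr]
    rw [this, h4]; simp
  · intro w _ hw
    have : π (wr w) * e = 0 := by
      by_contra h
      apply hw
      have := h3 _ h
      ext v
      have := congrFun this v
      simp only [wr, Pi.zero_apply] at this
      simp only [Equiv.Perm.one_apply]
      omega
    rw [this]; simp
  · simp
end rep
end weyl
section conc
variable {K : Type*} [Field K]
theorem weight_inc (d : E6 →₀ ℕ) : Finsupp.weight inc d = bd d := by
  funext v
  rw [Finsupp.weight_apply, Finsupp.sum_fintype _ _ (by simp)]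
  simp [bd, Finset.sum_apply]
theorem weight_bideg (d : E6 →₀ ℕ) : Finsupp.weight (bideg 6) d = (dgx d, dgy d) := by
  rw [Finsupp.weight_apply, Finsupp.sum_fintype _ _ (by simp)]
  have : ∀ e, bideg 6 e = (isX e, isY e) := by rintro (e | e) <;> rfl
  simp only [this, dgx, dgy]
  ext <;> simp [Prod.fst_sum, Prod.snd_sum]
theorem wh_mono {M : Type*} [AddCommMonoid M] {w : E6 → M} {α : M}
    (D : Derivation K (MvPolynomial E6 K) (MvPolynomial E6 K))
    (h : ∀ e, (D (X e)).IsWeightedHomogeneous w (w e + α)) (d : E6 →₀ ℕ) :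
    (D (monomial d 1)).IsWeightedHomogeneous w (Finsupp.weight w d + α) := by
  induction d using Finsupp.induction_linear with
  | zero => 
    have : (monomial 0 1 : MvPolynomial E6 K) = 1 := rfl
    rw [this, Derivation.map_one_eq_zero]; exact isWeightedHomogeneous_zero _ _ _
  | add d e hd he =>
    have : (monomial (d + e) 1 : MvPolynomial E6 K) = monomial d 1 * monomial e 1 := by
      rw [monomial_mul, one_mul]
    rw [this, Derivation.leibniz, map_add, smul_eq_mul, smul_eq_mul]
    apply IsWeightedHomogeneous.add
    · rw [add_assoc]; exact (isWeightedHomogeneous_monomial w d _ rfl).mul he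
    · rw [add_right_comm, add_comm]
      rw [add_comm]
      have := (isWeightedHomogeneous_monomial w e (1 : K) rfl).mul hd
      convert this using 1
      abel
  | single e n =>
    have : (monomial (Finsupp.single e n) 1 : MvPolynomial E6 K) = X e ^ n := by
      rw [X_pow_eq_monomial]
    rw [this, Derivation.leibniz_pow, Finsupp.weight_single]
    cases n with
    | zero => simpa using isWeightedHomogeneous_zero _ _ _
    | succ n =>
      have h2 := ((isWeightedHomogeneous_X K w e).pow n).mul (h e)
      rw [← add_assoc, ← succ_nsmul] at h2
      rw [Nat.add_sub_cancel, smul_eq_mul]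
      exact (weightedHomogeneousSubmodule K w _).nsmul_mem h2 _
theorem mono_smul (d : E6 →₀ ℕ) (r : K) : monomial d r = r • monomial d 1 := by
  rw [smul_monomial, smul_eq_mul, mul_one]
theorem wh_deriv {M : Type*} [AddCommMonoid M] {w : E6 → M} {α : M}
    (D : Derivation K (MvPolynomial E6 K) (MvPolynomial E6 K))
    (h : ∀ e, (D (X e)).IsWeightedHomogeneous w (w e + α)) {f : MvPolynomial E6 K} {μ : M}
    (hf : f.IsWeightedHomogeneous w μ) : (D f).IsWeightedHomogeneous w (μ + α) := by
  rw [f.as_sum, map_sum]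
  apply IsWeightedHomogeneous.sum
  intro d hd
  rw [mono_smul, Derivation.map_smul, ← hf (mem_support_iff.1 hd)]
  exact (weightedHomogeneousSubmodule K w _).smul_mem _ (wh_mono D h d)
def mkE : E6 → V6 → V6 → E6
  | Sum.inl _, i, j => Sum.inl (i, j)
  | Sum.inr _, i, j => Sum.inr (i, j)
theorem mkE_self (e : E6) : mkE e (esrc e) (etgt e) = e := by rcases e with e | e <;> rfl
theorem esrc_mkE (e : E6) (i j) : esrc (mkE e i j) = i := by rcases e with e | e <;> rfl
theorem etgt_mkE (e : E6) (i j) : etgt (mkE e i j) = j := by rcases e with e | e <;> rfl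
theorem mkE_mkE (e : E6) (i j k l) : mkE (mkE e i j) k l = mkE e k l := by rcases e with e | e <;> rfl
theorem bideg_mkE (e : E6) (i j) : bideg 6 (mkE e i j) = bideg 6 e := by rcases e with e | e <;> rfl
variable (K) in
def DD (a b : V6) : Derivation K (MvPolynomial E6 K) (MvPolynomial E6 K) :=
  mkDerivation K fun e => (if esrc e = b then X (mkE e a (etgt e)) else 0) -
    (if etgt e = a then X (mkE e (esrc e) b) else 0)
theorem DD_X (a b : V6) (e : E6) : DD K a b (X e) = (if esrc e = b then X (mkE e a (etgt e)) else 0) -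
    (if etgt e = a then X (mkE e (esrc e) b) else 0) := mkDerivation_X _ _ _
theorem DD_bideg (a b : V6) {f : MvPolynomial E6 K} {μ : ℕ × ℕ}
    (hf : f.IsWeightedHomogeneous (bideg 6) μ) : (DD K a b f).IsWeightedHomogeneous (bideg 6) μ := by
  have := wh_deriv (α := 0) (DD K a b) (fun e => ?_) hf
  · simpa using this
  rw [DD_X, add_zero]
  apply IsWeightedHomogeneous.sub <;> split_ifs
  · conv => arg 3; rw [← bideg_mkE e a (etgt e)]
    exact isWeightedHomogeneous_X _ _ _
  · exact isWeightedHomogeneous_zero _ _ _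
  · conv => arg 3; rw [← bideg_mkE e (esrc e) b]
    exact isWeightedHomogeneous_X _ _ _
  · exact isWeightedHomogeneous_zero _ _ _
theorem inc_mkE (e : E6) (i j) (v : V6) : inc (mkE e i j) v = (if i = v then 1 else 0) - (if j = v then 1 else 0) := by
  rw [inc, esrc_mkE, etgt_mkE]
theorem DD_inc_X (a b : V6) (e : E6) : (DD K a b (X e)).IsWeightedHomogeneous inc (inc e + rt (a, b)) := by
  rw [DD_X]
  apply IsWeightedHomogeneous.sub <;> split_ifs with h
  · have : inc e + rt (a, b) = inc (mkE e a (etgt e)) := by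
      funext v
      rw [inc_mkE, ← h]
      simp [inc, rt, Pi.single_apply, eq_comm]
    rw [this]; exact isWeightedHomogeneous_X _ _ _
  · exact isWeightedHomogeneous_zero _ _ _
  · have : inc e + rt (a, b) = inc (mkE e (esrc e) b) := by
      funext v
      rw [inc_mkE, ← h]
      simp [inc, rt, Pi.single_apply, eq_comm]
    rw [this]; exact isWeightedHomogeneous_X _ _ _
  · exact isWeightedHomogeneous_zero _ _ _
variable (K) in
def bb (a b : V6) : MvPolynomial E6 K := if a = b then 1 else 0
theorem bb_comm (a b : V6) : bb K a b = bb K b a := by simp [bb, eq_comm]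
theorem DD_X' (a b : V6) (e : E6) : DD K a b (X e) = bb K (esrc e) b * X (mkE e a (etgt e)) -
    bb K (etgt e) a * X (mkE e (esrc e) b) := by
  rw [DD_X]; simp [bb]
theorem DD_bb (a b c d : V6) (f : MvPolynomial E6 K) : DD K a b (bb K c d * f) = bb K c d * DD K a b f := by
  unfold bb; split_ifs <;> simp
theorem DD_comm (a b c d : V6) : ⁅DD K a b, DD K c d⁆ =
    (if b = c then DD K a d else 0) - (if d = a then DD K c b else 0) := by
  apply derivation_ext
  intro e
  rw [Derivation.commutator_apply]
  have h1 : ((if b = c then DD K a d else 0) - (if d = a then DD K c b else 0) : Derivation K (MvPolynomial E6 K) (MvPolynomial E6 K)) (X e) =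
      bb K b c * DD K a d (X e) - bb K d a * DD K c b (X e) := by
    unfold bb; split_ifs <;> simp
  rw [h1]
  simp only [DD_X', map_sub, DD_bb, esrc_mkE, etgt_mkE, mkE_mkE]
  rw [bb_comm c b, bb_comm a d]
  ring
theorem DD_diag (a : V6) (d : E6 →₀ ℕ) : DD K a a (monomial d 1) = ((bd d a : ℤ) : K) • monomial d 1 := by
  induction d using Finsupp.induction_linear with
  | zero => 
    have : (monomial 0 1 : MvPolynomial E6 K) = 1 := rfl
    rw [this, Derivation.map_one_eq_zero]; simp [bd_zero]
  | add d e hd he =>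
    have : (monomial (d + e) 1 : MvPolynomial E6 K) = monomial d 1 * monomial e 1 := by
      rw [monomial_mul, one_mul]
    rw [this, Derivation.leibniz, hd, he, Finsupp.coe_add, bd_add, smul_eq_mul, smul_eq_mul, Int.cast_add, add_smul,
      mul_smul_comm, mul_smul_comm, add_comm, mul_comm (monomial e 1)]
  | single e n =>
    have : (monomial (Finsupp.single e n) 1 : MvPolynomial E6 K) = X e ^ n := by
      rw [X_pow_eq_monomial]
    have h1 : DD K a a (X e) = ((inc e a : ℤ) : K) • X e := by
      rw [DD_X, inc]
      by_cases h1 : esrc e = a <;> by_cases h2 : etgt e = a <;> simp [h1, h2] <;>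
        first | (rw [← h1, mkE_self]) | (rw [← h2, mkE_self])
    have h2 : bd (Finsupp.single e n) a = n * inc e a := by
      simp only [bd, Finsupp.single_apply]
      rw [Finset.sum_eq_single e] <;> simp +contextual [eq_comm]
    rw [this, Derivation.leibniz_pow, h2, h1]
    cases n with
    | zero => simp
    | succ n => 
      rw [Nat.add_sub_cancel, smul_eq_mul, mul_smul_comm, ← pow_succ]
      push_cast
      rw [mul_smul, ← Nat.cast_smul_eq_nsmul K]
      push_cast
      rfl
end conc
section conc2
variable (K : Type*) [Field K]
abbrev VV (p q : ℕ) : Submodule K (MvPolynomial E6 K) := weightedHomogeneousSubmodule K (bideg 6) (p, q)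
abbrev pj (μ : V6 → ℤ) : MvPolynomial E6 K →ₗ[K] MvPolynomial E6 K := weightedHomogeneousComponent inc μ
variable {K}
theorem coeff_pj (μ : V6 → ℤ) (f : MvPolynomial E6 K) (d : E6 →₀ ℕ) :
    coeff d (pj K μ f) = if bd d = μ then coeff d f else 0 := by
  rw [coeff_weightedHomogeneousComponent, weight_inc]
theorem mem_VV {p q : ℕ} {f : MvPolynomial E6 K} : f ∈ VV K p q ↔
    ∀ d, coeff d f ≠ 0 → dgx d = p ∧ dgy d = q := by
  rw [mem_weightedHomogeneousSubmodule]
  refine forall_congr' fun d => ?_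
  rw [weight_bideg, Prod.mk.injEq]
theorem pj_VV {p q : ℕ} (μ : V6 → ℤ) (f : MvPolynomial E6 K) (h : f ∈ VV K p q) : pj K μ f ∈ VV K p q := by
  rw [mem_VV] at h ⊢
  intro d
  rw [coeff_pj]
  split_ifs <;> simp_all
theorem pj_mono (μ : V6 → ℤ) (d : E6 →₀ ℕ) (r : K) : pj K μ (monomial d r) = if bd d = μ then monomial d r else 0 := by
  ext e
  rw [coeff_pj]
  split_ifs with h1 h2 h2 <;> simp_all [coeff_monomial] <;> rintro rfl <;> simp_all
theorem DD_pj (a b : V6) (μ : V6 → ℤ) :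
    (DD K a b : MvPolynomial E6 K →ₗ[K] MvPolynomial E6 K) ∘ₗ pj K μ = pj K (μ + rt (a, b)) ∘ₗ (DD K a b : MvPolynomial E6 K →ₗ[K] MvPolynomial E6 K) := by
  refine MvPolynomial.linearMap_ext fun d => LinearMap.ext_ring ?_
  simp only [LinearMap.comp_apply, Derivation.coeFn_coe]
  have h := wh_mono (DD K a b) (fun e => DD_inc_X a b e) d
  rw [weight_inc] at h
  rw [pj_mono, pj, weightedHomogeneousComponent_of_mem h]
  by_cases h1 : bd d = μ
  · simp [h1]
  · rw [if_neg h1, if_neg, map_zero]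
    exact fun h2 => h1 (add_right_cancel h2).symm
theorem DD_aa (a : V6) (f : MvPolynomial E6 K) (d : E6 →₀ ℕ) :
    coeff d (DD K a a f) = ((bd d a : ℤ) : K) * coeff d f := by
  induction f using MvPolynomial.induction_on' with
  | monomial e r =>
    rw [mono_smul, Derivation.map_smul, DD_diag, coeff_smul, coeff_smul, coeff_smul, coeff_monomial]
    split_ifs with h
    · subst h; simp; ring
    · simp
  | add p q hp hq => simp [hp, hq, mul_add]
theorem DD_pj_aa (a : V6) (μ : V6 → ℤ) (f : MvPolynomial E6 K) :
    DD K a a (pj K μ f) = ((μ a : ℤ) : K) • pj K μ f := by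
  ext d
  rw [DD_aa, coeff_smul, coeff_pj, smul_eq_mul]
  split_ifs with h
  · rw [h]
  · simp
def Rr (p q : ℕ) (a b : V6) : Module.End K (VV K p q) :=
  (DD K a b : MvPolynomial E6 K →ₗ[K] MvPolynomial E6 K).restrict fun _ hf => DD_bideg a b hf
def pr (p q : ℕ) (μ : V6 → ℤ) : Module.End K (VV K p q) := (pj K μ).restrict fun f hf => pj_VV μ f hf
theorem coe_Rr (p q : ℕ) (a b : V6) (f : VV K p q) : (Rr p q a b f : MvPolynomial E6 K) = DD K a b f := rfl
theorem coe_pr (p q : ℕ) (μ : V6 → ℤ) (f : VV K p q) : (pr p q μ f : MvPolynomial E6 K) = pj K μ f := rfl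
abbrev dset (p q : ℕ) : Set (E6 →₀ ℕ) := {d | Finsupp.weight (bideg 6) d = (p, q)}
theorem mem_dset {p q : ℕ} {d : E6 →₀ ℕ} : d ∈ dset p q ↔ dgx d = p ∧ dgy d = q := by
  change Finsupp.weight (bideg 6) d = (p, q) ↔ _
  rw [weight_bideg, Prod.mk.injEq]
def dsetEquiv (p q : ℕ) : dset p q ≃ monos p q where
  toFun d := ⟨d.1, mem_monos.2 (mem_dset.1 d.2)⟩
  invFun f := ⟨Finsupp.equivFunOnFinite.symm f.1, mem_dset.2 (mem_monos.1 f.2)⟩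
  left_inv d := by ext; simp
  right_inv f := by ext; simp
instance (p q : ℕ) : Fintype (dset p q) := Fintype.ofEquiv _ (dsetEquiv p q).symm
def bVV (p q : ℕ) : Module.Basis (dset p q) K (VV K p q) :=
  (basisRestrictSupport K (dset p q)).map
    (LinearEquiv.ofEq _ _ (weightedHomogeneousSubmodule_eq_finsupp_supported K (bideg 6) (p, q)).symm)
theorem bVV_repr (p q : ℕ) (f : VV K p q) (d : dset p q) : (bVV p q).repr f d = coeff d.1 (f : MvPolynomial E6 K) := rfl
theorem coe_bVV (p q : ℕ) (d : dset p q) : ((bVV p q d : VV K p q) : MvPolynomial E6 K) = monomial d.1 1 := by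
  have h : monomial d.1 1 ∈ VV K p q := isWeightedHomogeneous_monomial _ _ _ d.2
  have : bVV p q d = ⟨monomial d.1 1, h⟩ := by
    apply (bVV p q).repr.injective
    ext e
    rw [Module.Basis.repr_self, bVV_repr, coeff_monomial, Finsupp.single_apply]
    simp [Subtype.ext_iff]
  rw [this]
instance (p q : ℕ) : FiniteDimensional K (VV K p q) := Module.Finite.of_basis (bVV p q)
theorem trace_pr (p q : ℕ) (μ : V6 → ℤ) : LinearMap.trace K _ (pr p q μ) = ((wf Finset.univ (-μ) p q).card : K) := by
  classical
  rw [LinearMap.trace_eq_matrix_trace K (bVV p q), Matrix.trace]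
  have h1 : ∀ d : dset p q, pr p q μ (bVV p q d) = (if bd d.1 = μ then (1:K) else 0) • (bVV p q d : VV K p q) := by
    intro d
    apply Subtype.ext
    rw [coe_pr, Submodule.coe_smul, coe_bVV, pj_mono]
    split_ifs <;> simp
  simp only [Matrix.diag_apply, LinearMap.toMatrix_apply, h1, map_smul, Module.Basis.repr_self, Finsupp.smul_apply,
    Finsupp.single_eq_same, smul_eq_mul, mul_one]
  have h2 := (dsetEquiv p q).sum_comp (fun f => if bd f.1 = μ then (1:K) else 0)
  rw [show (∑ i : dset p q, if bd i.1 = μ then (1:K) else 0) = _ from h2, Finset.sum_boole]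
  congr 1
  refine Finset.card_bij (fun f _ => f.1) ?_ ?_ ?_
  · intro f hf
    rw [mem_wf]
    exact ⟨mem_monos.1 f.2, by simpa using hf, by simp⟩
  · intro f _ g _ h; exact Subtype.ext h
  · intro f hf
    rw [mem_wf] at hf
    exact ⟨⟨f, mem_monos.2 hf.1⟩, by simpa using hf.2.1, rfl⟩
theorem dim_ker [CharZero K] (p q : ℕ) : (Module.finrank K (⨅ a, ⨅ b, LinearMap.ker (Rr (K := K) p q a b) : Submodule K (VV K p q)) : K) =
    ∑ w : Equiv.Perm V6, ((Equiv.Perm.sign w : ℤ) : K) * ((wf Finset.univ (-wr w) p q).card : K) := by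
  rw [weyl_dim (π := pr p q) (S := (monos p q).image bd)]
  · simp only [Lw, trace_pr]
  · intro a b c d
    apply LinearMap.ext; intro f; apply Subtype.ext
    have := congrArg (fun D => D (f : MvPolynomial E6 K)) (DD_comm (K := K) a b c d)
    simp only [Derivation.commutator_apply, Derivation.sub_apply] at this
    simp only [LinearMap.sub_apply, Module.End.mul_apply, Submodule.coe_sub, coe_Rr]
    rw [this]
    congr 1 <;> split_ifs <;> rfl
  · intro a b μ
    apply LinearMap.ext; intro f; apply Subtype.ext
    have := LinearMap.congr_fun (DD_pj a b μ) (f : MvPolynomial E6 K)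
    simp only [LinearMap.comp_apply, Derivation.coeFn_coe] at this
    rw [Module.End.mul_apply, Module.End.mul_apply, coe_Rr, coe_pr, coe_pr, coe_Rr, this]
  · intro a μ
    apply LinearMap.ext; intro f; apply Subtype.ext
    rw [Module.End.mul_apply, coe_Rr, LinearMap.smul_apply, Submodule.coe_smul, coe_pr, DD_pj_aa]
  · apply LinearMap.ext; intro f; apply Subtype.ext; ext d
    simp only [LinearMap.sum_apply, Submodule.coe_sum, coe_pr, coeff_sum, coeff_pj, Module.End.one_apply]
    rw [Finset.sum_ite_eq]
    split_ifs with h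
    · rfl
    · by_contra h2
      exact h (Finset.mem_image_of_mem _ (mem_monos.2 (mem_VV.1 f.2 d (Ne.symm h2))))
  · intro μ hμ
    apply LinearMap.ext; intro f; apply Subtype.ext; ext d
    rw [coe_pr, coeff_pj]
    simp only [LinearMap.zero_apply, Submodule.coe_zero, coeff_zero, ite_eq_right_iff]
    rintro rfl
    by_contra h2
    exact hμ (Finset.mem_image_of_mem _ (mem_monos.2 (mem_VV.1 f.2 d h2)))
end conc2
section invt
variable {K : Type*} [Field K]
def pth (a b : V6) (x : E6 → K) (e : E6) : Polynomial K :=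
  Polynomial.C (x e) + Polynomial.X * ((if esrc e = b then Polynomial.C (x (mkE e a (etgt e))) else 0) -
    (if etgt e = a then Polynomial.C (x (mkE e (esrc e) b)) else 0)) -
  Polynomial.X ^ 2 * (if esrc e = b then (if etgt e = a then Polynomial.C (x (mkE e a b)) else 0) else 0)
theorem pth_deriv {a b : V6} (hab : a ≠ b) (x : E6 → K) (e : E6) : Polynomial.derivative (pth a b x e) =
    (if esrc e = b then pth a b x (mkE e a (etgt e)) else 0) - (if etgt e = a then pth a b x (mkE e (esrc e) b) else 0) := by
  simp only [pth, esrc_mkE, etgt_mkE, mkE_mkE]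
  by_cases h1 : esrc e = b <;> by_cases h2 : etgt e = a <;> simp [h1, h2, hab, hab.symm]
  ring
theorem aeval_deriv {a b : V6} (hab : a ≠ b) (x : E6 → K) (f : MvPolynomial E6 K) :
    Polynomial.derivative (aeval (pth a b x) f) = aeval (pth a b x) (DD K a b f) := by
  induction f using MvPolynomial.induction_on with
  | C r => simp [Polynomial.derivative_C]
  | add p q hp hq => simp [hp, hq]
  | mul_X p e hp =>
    rw [map_mul, Polynomial.derivative_mul, hp, aeval_X, pth_deriv hab, Derivation.leibniz, DD_X, smul_eq_mul, smul_eq_mul,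
      map_add, map_mul, map_mul, aeval_X, map_sub]
    by_cases h1 : esrc e = b <;> by_cases h2 : etgt e = a <;> simp [h1, h2] <;> ring
theorem eval_pth (a b : V6) (x : E6 → K) (f : MvPolynomial E6 K) (τ : K) :
    Polynomial.eval τ (aeval (pth a b x) f) = eval (fun e => Polynomial.eval τ (pth a b x e)) f := by
  induction f using MvPolynomial.induction_on with
  | C r => simp
  | add p q hp hq => simp [hp, hq]
  | mul_X p e hp => simp [hp]
def MInv (f : MvPolynomial E6 K) (M : Matrix V6 V6 K) : Prop := ∀ A B : Matrix V6 V6 K,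
  eval (pairSub (M * A * M⁻¹) (M * B * M⁻¹)) f = eval (pairSub A B) f
theorem conj_transv {a b : V6} (hab : a ≠ b) (A : Matrix V6 V6 K) (τ : K) (i j : V6) :
    (transvection b a τ * A * (transvection b a τ)⁻¹) i j = A i j + τ * ((if i = b then A a j else 0) -
      (if j = a then A i b else 0)) - τ ^ 2 * (if i = b then (if j = a then A a b else 0) else 0) := by
  have : (transvection b a τ)⁻¹ = transvection b a (-τ) := by
    apply Matrix.inv_eq_right_inv
    rw [transvection_mul_transvection_same _ _ hab.symm, add_neg_cancel, transvection_zero]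
  rw [this]
  simp only [transvection, add_mul, mul_add, one_mul, mul_one, Matrix.add_apply]
  by_cases h1 : i = b <;> by_cases h2 : j = a <;> simp [h1, h2] <;> ring
theorem eval_pth' {a b : V6} (hab : a ≠ b) (A B : Matrix V6 V6 K) (τ : K) :
    (fun e => Polynomial.eval τ (pth a b (pairSub A B) e)) =
      pairSub (transvection b a τ * A * (transvection b a τ)⁻¹) (transvection b a τ * B * (transvection b a τ)⁻¹) := by
  funext e
  rcases e with ⟨i, j⟩ | ⟨i, j⟩ <;> simp only [pairSub, conj_transv hab, pth, esrc, etgt, mkE] <;>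
  by_cases h1 : i = b <;> by_cases h2 : j = a <;> simp [h1, h2] <;> ring
theorem pairSub_surj (x : E6 → K) : ∃ A B : Matrix V6 V6 K, pairSub A B = x :=
  ⟨fun i j => x (Sum.inl (i, j)), fun i j => x (Sum.inr (i, j)), by funext e; rcases e with e | e <;> rfl⟩
theorem inv_transv [CharZero K] {a b : V6} (hab : a ≠ b) (f : MvPolynomial E6 K) :
    (∀ τ, MInv f (transvection b a τ)) ↔ DD K a b f = 0 := by
  constructor
  · intro h
    apply MvPolynomial.funext
    intro x
    obtain ⟨A, B, rfl⟩ := pairSub_surj x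
    have h1 : aeval (pth a b (pairSub A B)) f = Polynomial.C (eval (pairSub A B) f) := by
      apply Polynomial.funext
      intro τ
      rw [eval_pth, eval_pth' hab, h τ, Polynomial.eval_C]
    have h2 := aeval_deriv hab (pairSub A B) f
    rw [h1, Polynomial.derivative_C] at h2
    have h3 := congrArg (Polynomial.eval 0) h2
    rw [eval_pth, eval_pth' hab] at h3
    simpa using h3.symm
  · intro h τ A B
    have h2 := aeval_deriv hab (pairSub A B) f
    rw [h, map_zero] at h2
    have h3 := Polynomial.eq_C_of_derivative_eq_zero h2
    have h4 : ∀ τ, Polynomial.eval τ (aeval (pth a b (pairSub A B)) f) = (aeval (pth a b (pairSub A B)) f).coeff 0 := by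
      intro τ; rw [h3]; simp
    have h5 := h4 0
    rw [← h4 τ, eval_pth, eval_pth, eval_pth' hab, eval_pth' hab] at h5
    simpa using h5.symm
theorem inv_diag (f : MvPolynomial E6 K) (hf : ∀ d, coeff d f ≠ 0 → bd d = 0) (D : V6 → K) (hD : ∀ i, D i ≠ 0) :
    MInv f (diagonal D) := by
  intro A B
  have hi : (diagonal D)⁻¹ = diagonal (fun i => (D i)⁻¹) := by
    apply Matrix.inv_eq_right_inv
    rw [diagonal_mul_diagonal]
    simp [hD]
  have h1 : pairSub (diagonal D * A * (diagonal D)⁻¹) (diagonal D * B * (diagonal D)⁻¹) =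
      fun e => (∏ v, D v ^ (inc e v)) * pairSub A B e := by
    have h2 : ∀ e, ∏ v, D v ^ (inc e v) = D (esrc e) * (D (etgt e))⁻¹ := by
      intro e
      simp only [inc, zpow_sub₀ (hD _), div_eq_mul_inv]
      rw [Finset.prod_mul_distrib, Finset.prod_eq_single (esrc e), Finset.prod_eq_single (etgt e)] <;>
        simp +contextual [eq_comm]
    funext e
    rw [h2, hi]
    rcases e with e | e <;> simp only [pairSub, mul_diagonal, diagonal_mul, esrc, etgt] <;> ring
  rw [h1, eval_eq', eval_eq']
  refine Finset.sum_congr rfl fun d hd => ?_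
  congr 1
  simp only [mul_pow, Finset.prod_mul_distrib]
  have h3 : ∏ e, (∏ v, D v ^ (inc e v)) ^ (d e) = 1 := by
    simp only [← Finset.prod_pow]
    rw [Finset.prod_comm]
    refine Finset.prod_eq_one fun v _ => ?_
    have h4 : ∀ s : Finset E6, ∏ e ∈ s, (D v ^ (inc e v)) ^ (d e) = D v ^ (∑ e ∈ s, (d e : ℤ) * inc e v) := by
      intro s
      induction s using Finset.cons_induction with
      | empty => simp
      | cons e s he ih =>
        rw [Finset.prod_cons, Finset.sum_cons, ih, zpow_add₀ (hD v), mul_comm (d e : ℤ), _root_.zpow_mul, zpow_natCast]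
    rw [h4]
    have := congrFun (hf d (mem_support_iff.1 hd)) v
    rw [bd] at this
    rw [this]; simp
  rw [h3, one_mul]
theorem sum_bd (f : E6 → ℕ) : ∑ v, bd f v = 0 := by
  simp only [bd]
  rw [Finset.sum_comm]
  refine Finset.sum_eq_zero fun e _ => ?_
  rw [← Finset.mul_sum]
  simp [inc]
theorem inv_iff [CharZero K] (f : MvPolynomial E6 K) : IsMatInvariant f ↔ ∀ a b, DD K a b f = 0 := by
  have hI : IsMatInvariant f ↔ ∀ M : Matrix V6 V6 K, det M ≠ 0 → MInv f M := by
    constructor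
    · intro h M hM A B
      have := h (GeneralLinearGroup.mkOfDetNeZero M hM) A B
      rwa [Matrix.coe_units_inv] at this
    · intro h g A B
      rw [Matrix.coe_units_inv]
      exact h g (by simpa using (Matrix.isUnits_det_units g).ne_zero) A B
  rw [hI]
  constructor
  · intro h
    have h1 : ∀ a b, a ≠ b → DD K a b f = 0 := fun a b hab =>
      (inv_transv hab f).1 fun τ => h _ (by rw [det_transvection_of_ne _ _ hab.symm]; simp)
    have h2 : ∀ d, coeff d f ≠ 0 → ∀ a b, bd d a = bd d b := by
      intro d hd a b
      by_cases hab : a = b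
      · rw [hab]
      have := congrArg (fun D => coeff d (D f)) (DD_comm (K := K) a b b a)
      simp only [Derivation.commutator_apply, h1 a b hab, h1 b a (Ne.symm hab), map_zero, if_true,
        Derivation.sub_apply, coeff_sub, DD_aa, sub_zero, coeff_zero, ← sub_mul] at this
      have := (mul_eq_zero.1 this.symm).resolve_right hd
      exact_mod_cast sub_eq_zero.1 this
    intro a b
    by_cases hab : a = b
    · subst hab
      ext d
      rw [DD_aa, coeff_zero]
      by_cases hd : coeff d f = 0
      · rw [hd, mul_zero]
      have h3 := sum_bd d
      rw [Finset.sum_congr rfl (fun v _ => h2 d hd v a)] at h3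
      have : bd d a = 0 := by simpa using h3
      simp [this]
    · exact h1 a b hab
  · intro h M hM
    refine diagonal_transvection_induction_of_det_ne_zero (MInv f) M hM ?_ ?_ ?_
    · intro D hD
      rw [det_diagonal, Finset.prod_ne_zero_iff] at hD
      refine inv_diag f (fun d hd => ?_) D (fun i => hD i (Finset.mem_univ _))
      funext a
      have := congrArg (coeff d) (h a a)
      rw [DD_aa, coeff_zero] at this
      exact_mod_cast (mul_eq_zero.1 this).resolve_right hd
    · intro t
      exact (inv_transv t.hij.symm f).2 (h _ _) t.c
    · intro M N _ _ hM hN A B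
      rw [Matrix.mul_inv_rev]
      have := hM (N * A * N⁻¹) (N * B * N⁻¹)
      rw [hN] at this
      simpa only [Matrix.mul_assoc] using this
theorem pureDim_eq [CharZero K] (p q : ℕ) : (pureDim K 6 p q : ℤ) =
    ∑ w : Equiv.Perm V6, (Equiv.Perm.sign w : ℤ) * ((wf Finset.univ (-wr w) p q).card : ℤ) := by
  have h1 : pureComponent K 6 p q =
      (((⨅ a, ⨅ b, LinearMap.ker (Rr (K := K) p q a b)).map (VV K p q).subtype : Submodule K _) : Set _) := by
    ext f
    simp only [pureComponent, Set.mem_ofPred_eq, inv_iff, Submodule.map_coe, Set.mem_image, SetLike.mem_coe,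
      Submodule.mem_iInf, LinearMap.mem_ker]
    constructor
    · rintro ⟨h1, h2⟩
      exact ⟨⟨f, h2⟩, fun a b => Subtype.ext (h1 a b), rfl⟩
    · rintro ⟨g, h1, rfl⟩
      exact ⟨fun a b => congrArg Subtype.val (h1 a b), g.2⟩
  have h2 := dim_ker (K := K) p q
  rw [pureDim, Set.finrank, h1, Submodule.span_eq, Submodule.finrank_map_subtype_eq]
  exact_mod_cast h2
theorem SS_pure [CharZero K] : toPS (C 720 * qs ^ 15) * purePS2 K 6 = SS := by
  rw [SS_eq]
  congr 1
  ext d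
  rw [map_sum]
  have h := pureDim_eq (K := K) (d 0) (d 1)
  have : MvPowerSeries.coeff d (purePS2 K 6) = ((pureDim K 6 (d 0) (d 1) : ℤ) : ℚ) := by
    rw [Int.cast_natCast]; rfl
  rw [this, h, Int.cast_sum]
  refine Finset.sum_congr rfl fun w _ => ?_
  have hw : -wr w = fun v : V6 => ((v : ℕ) : ℤ) - ((w v : ℕ) : ℤ) := by funext v; simp [wr]
  rw [map_intCast, ← zsmul_eq_mul, map_zsmul, coeff_Wf, hw, zsmul_eq_mul]
  push_cast
  rfl
end invt
section pure
def Bd (m : ℕ) (h : PSQ) : Prop := ∀ d : Fin 2 →₀ ℕ, m + 6 * d 1 < d 0 → MvPowerSeries.coeff d h = 0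
theorem Bd.mono {m n : ℕ} (hmn : m ≤ n) {h : PSQ} (H : Bd m h) : Bd n h := fun d hd => H d (by omega)
theorem Bd.sum {ι : Type*} {s : Finset ι} {m : ℕ} {h : ι → PSQ} (H : ∀ i ∈ s, Bd m (h i)) : Bd m (∑ i ∈ s, h i) :=
  fun d hd => by rw [map_sum]; exact Finset.sum_eq_zero fun i hi => H i hi d hd
theorem Bd.int {m : ℕ} {h : PSQ} (H : Bd m h) (z : ℤ) : Bd m (toPS ((z : ℤ) : RQ) * h) := fun d hd => by
  rw [map_intCast, ← zsmul_eq_mul, map_zsmul, H d hd, smul_zero]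
theorem coeff_spow (k : ℕ) (h : PSQ) (d : Fin 2 →₀ ℕ) : MvPowerSeries.coeff d (toPS (qs ^ k) * h) =
    if k ≤ d 0 then MvPowerSeries.coeff (d - Finsupp.single 0 k) h else 0 := by
  have : (qs ^ k : RQ) = qs ^ k * qt ^ 0 := by simp
  rw [this, coeff_mon_mul]
  simp
theorem Bd.step {m : ℕ} (k : ℕ) {h : PSQ} (H : Bd m h) : Bd (m + k) (toPS (1 - qs ^ k) * h) := fun d hd => by
  rw [map_sub, map_one, sub_mul, one_mul, map_sub, H d (by omega), coeff_spow, if_pos (by omega), H, sub_zero]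
  simp
  omega
def pn (n : ℕ) : RQ := ∏ i ∈ Finset.range n, (1 - qs ^ (i + 1))
def tri (n : ℕ) : ℕ := ∑ i ∈ Finset.range n, i
theorem Bd.up {k : ℕ} {h : PSQ} (H : Bd (tri k) (toPS (pn k) * h)) {n : ℕ} (hn : k ≤ n) :
    Bd (tri (n + 1)) (toPS (pn n) * h) := by
  induction n, hn using Nat.le_induction with
  | base => exact H.mono (by simp [tri, Finset.sum_range_succ])
  | succ n hn ih =>
    have := ih.step (n + 1)
    rw [pn, Finset.prod_range_succ, ← pn, map_mul, mul_assoc, mul_left_comm]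
    rwa [tri, Finset.sum_range_succ, ← tri]
variable (σ : Equiv.Perm V6)
def Zs (G : Finset E6) : Finset V6 := by
  classical exact Finset.univ.filter fun v => ∀ n : ℕ, (Sum.inl ((σ ^ n) v, σ ((σ ^ n) v)) : E6) ∈ G
theorem mem_Zs {G : Finset E6} {v : V6} : v ∈ Zs σ G ↔ ∀ n : ℕ, (Sum.inl ((σ ^ n) v, σ ((σ ^ n) v)) : E6) ∈ G := by
  simp [Zs]
theorem Zs_img (G : Finset E6) : (Zs σ G).image σ = Zs σ G := by
  apply Finset.eq_of_subset_of_card_le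
  · rw [Finset.image_subset_iff]
    intro v hv
    rw [mem_Zs] at hv ⊢
    intro n
    have := hv (n + 1)
    rwa [pow_succ, Equiv.Perm.mul_apply] at this
  · rw [Finset.card_image_of_injective _ σ.injective]
def Zc (G : Finset E6) : Finset E6 := (Zs σ G).image fun v => Sum.inl (v, σ v)
theorem sum_Zc (G : Finset E6) (F : E6 → ℤ) : ∑ e, ((ind (Zc σ G) e : ℕ) : ℤ) * F e = ∑ v ∈ Zs σ G, F (Sum.inl (v, σ v)) := by
  rw [sum_ind_mul, Zc, Finset.sum_image]
  intro a _ b _ h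
  exact congrArg esrc h
theorem bd_Zc (G : Finset E6) : bd (ind (Zc σ G)) = 0 := by
  funext v
  rw [bd, sum_Zc]
  simp only [inc, Finset.sum_sub_distrib, esrc, etgt, Pi.zero_apply, sub_eq_zero]
  nth_rewrite 1 [← Zs_img]
  rw [Finset.sum_image σ.injective.injOn]
  rfl
theorem xm_Zc (G : Finset E6) : xm (Zc σ G) = qs ^ (Zs σ G).card := by
  have h1 := sum_Zc σ G (fun e => isX e)
  have h2 := sum_Zc σ G (fun e => isY e)
  have h3 : dgx (ind (Zc σ G)) = (Zs σ G).card := by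
    zify; rw [dgx]; push_cast; rw [h1]; simp [isX]
  have h4 : dgy (ind (Zc σ G)) = 0 := by
    zify; rw [dgy]; push_cast; rw [h2]; simp [isY]
  rw [xm, h3, h4]; simp
theorem PC_next {c : Finset E6} (hc : IsPC c) {e : E6} (he : e ∈ c) : ∃ e' ∈ c, esrc e' = etgt e := by
  by_contra! hcon
  have h1 := bd_eq (ind c) (etgt e)
  rw [hc.2.1] at h1
  have h2 : ∑ e' with esrc e' = etgt e, ((ind c e' : ℕ) : ℤ) = 0 :=
    Finset.sum_eq_zero fun e' he' => by
      have h3 : e' ∉ c := fun h3 => hcon e' h3 (Finset.mem_filter.mp he').2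
      simp [ind, h3]
  have h3 : ((ind c e : ℕ) : ℤ) ≤ ∑ e' with etgt e' = etgt e, ((ind c e' : ℕ) : ℤ) :=
    Finset.single_le_sum (f := fun e' => ((ind c e' : ℕ) : ℤ)) (fun _ _ => by positivity)
      (Finset.mem_filter.mpr ⟨Finset.mem_univ _, rfl⟩)
  have h4 : ind c e = 1 := if_pos he
  rw [h2] at h1
  rw [h4] at h3
  simp only [Pi.zero_apply] at h1
  simp only [Nat.cast_one] at h3
  linarith
theorem PC_Zs {G : Finset E6} (hG : G ⊆ Gs σ) (hZ : Zs σ G = ∅) {c : Finset E6} (hc : IsPC c) (hcG : c ⊆ G) : 1 ≤ dgy (ind c) := by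
  by_contra h
  have h0 : dgy (ind c) = 0 := by omega
  have hx : ∀ e ∈ c, ∃ v, e = Sum.inl (v, σ v) := by
    intro e he
    rcases e with ⟨i, j⟩ | e
    · exact ⟨i, by rw [mem_Gs_inl.1 (hG (hcG he))]⟩
    · rw [dgy, Finset.sum_eq_zero_iff] at h0
      have := h0 (Sum.inr e) (Finset.mem_univ _)
      simp [ind, he, isY] at this
  have hs : ∀ v, (Sum.inl (v, σ v) : E6) ∈ c → (Sum.inl (σ v, σ (σ v)) : E6) ∈ c := by
    intro v hv
    obtain ⟨e', h1, h2⟩ := PC_next hc hv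
    obtain ⟨u, rfl⟩ := hx _ h1
    have : u = σ v := h2
    rwa [this] at h1
  obtain ⟨e, he⟩ := hc.1
  obtain ⟨v, rfl⟩ := hx e he
  have : v ∈ Zs σ G := by
    rw [mem_Zs]
    intro n
    apply hcG
    induction n with
    | zero => simpa using he
    | succ n ih => rw [pow_succ', Equiv.Perm.mul_apply]; exact hs _ ih
  simp [hZ] at this
theorem Bd_Hf (n : ℕ) : ∀ G : Finset E6, G ⊆ Gs σ → (Zs σ G).card = n → Bd (tri n) (toPS (pn n) * Hf G) := by
  induction n using Nat.strong_induction_on with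
  | _ n ih =>
  intro G hG hn
  rcases Nat.eq_zero_or_pos n with h0 | hpos
  · subst h0
    intro d hd
    rw [Finset.card_eq_zero] at hn
    simp only [pn, Finset.range_zero, Finset.prod_empty, map_one, one_mul, coeff_Hf]
    rw [Nat.cast_eq_zero, Finset.card_eq_zero, Finset.eq_empty_iff_forall_notMem]
    intro f hf
    rw [mem_flowsOf] at hf
    have := flow_induction' (P := fun f => dgx f ≤ 6 * dgy f) G (by simp [dgx, dgy]) (fun c f hc hcG h => by
      have h1 := PC_Zs σ hG hn hc hcG
      have h2 := hc.dg_le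
      rw [dgx_add, dgy_add]; omega) f hf.2.1 hf.2.2
    simp [tri] at hd
    omega
  · obtain ⟨n, rfl⟩ : ∃ k, n = k + 1 := ⟨n - 1, by omega⟩
    have hcG : Zc σ G ⊆ G := by
      rw [Zc, Finset.image_subset_iff]
      intro v hv
      simpa using (mem_Zs σ).1 hv 0
    have h1 := Hf_rec (bd_Zc σ G) hcG
    rw [xm_Zc, hn] at h1
    rw [pn, Finset.prod_range_succ, ← pn, map_mul, mul_assoc, h1, Finset.mul_sum]
    apply Bd.sum
    intro S hS
    have h2 : (((-1) ^ (S.card + 1) : ℤ) : RQ) = (-1) ^ (S.card + 1) := by push_cast; rfl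
    rw [← h2, mul_left_comm]
    apply Bd.int
    obtain ⟨hS1, hS2⟩ := Finset.mem_erase.1 hS
    have h3 : (Zs σ (G \ S)).card < n + 1 := by
      rw [← hn]
      apply Finset.card_lt_card
      rw [Finset.ssubset_iff_of_subset]
      · obtain ⟨e, he⟩ := Finset.nonempty_iff_ne_empty.2 hS1
        obtain ⟨v, hv, rfl⟩ := Finset.mem_image.1 (Finset.mem_powerset.1 hS2 he)
        refine ⟨v, hv, fun h => ?_⟩
        have := (mem_Zs σ).1 h 0
        simp at this
        exact this.2 he
      · intro v hv
        rw [mem_Zs] at hv ⊢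
        exact fun k => (Finset.mem_sdiff.1 (hv k)).1
    exact (ih _ h3 (G \ S) (Finset.sdiff_subset.trans hG) rfl).up (by omega)
theorem Bd_SS : Bd 15 (toPS (pn 6) * SS) := by
  rw [SS, Finset.mul_sum]
  apply Bd.sum
  intro σ _
  rw [mul_left_comm]
  apply Bd.int
  refine Bd_Hf σ 6 (Gs σ) subset_rfl ?_
  have : Zs σ (Gs σ) = Finset.univ := by
    ext v; simp [mem_Zs, mem_Gs_inl]
  rw [this]; rfl
theorem pure_pn (K : Type*) [Field K] [CharZero K] : Bd 0 (toPS (pn 6) * purePS2 K 6) := by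
  intro d hd
  have h := Bd_SS (d + Finsupp.single 0 15) (by simp; omega)
  rw [← SS_pure (K := K), map_mul toPS, mul_assoc, mul_left_comm, mul_left_comm _ (toPS (qs ^ 15)), toPS_apply, coe_C,
    MvPowerSeries.coeff_C_mul, coeff_spow] at h
  simpa using h
end pure
section fin
def sw : RQ ≃ₐ[ℚ] RQ := MvPolynomial.renameEquiv ℚ (Equiv.swap 0 1)
def rho : RQ →ₐ[ℚ] RQ := aeval ![qs, 0]
@[simp] theorem sw_s : sw qs = qt := by simp [sw, qs, qt]
@[simp] theorem sw_t : sw qt = qs := by simp [sw, qs, qt]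
@[simp] theorem rho_s : rho qs = qs := by simp [rho, qs]
@[simp] theorem rho_t : rho qt = 0 := by simp [rho, qt]
@[simp] theorem sw_sw (a : RQ) : sw (sw a) = a := by simp [sw, rename_rename, ← Equiv.coe_trans]
theorem coeff_sw0 (a : RQ) : coeff 0 (sw a) = coeff 0 a := by
  exact constantCoeff_rename (Equiv.swap (0 : Fin 2) 1) a
theorem nvar {a : RQ} {i : Fin 2} (hi : i ∈ a.vars) : degreeOf i a ≠ 0 := by
  rw [vars_def, Multiset.mem_toFinset] at hi
  rwa [degreeOf_def, Ne, Multiset.count_eq_zero, not_not]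
theorem rho_eq_self {a : RQ} (h : degreeOf 1 a = 0) : rho a = a := by
  refine hom_congr_vars (f₁ := rho.toRingHom) (f₂ := RingHom.id _) (by ext; simp) (fun i hi _ => ?_) rfl
  have : i = 0 := by
    rcases Fin.exists_fin_two.1 ⟨i, rfl⟩ with h' | h'
    · exact h'
    · subst h'; exact absurd h (nvar hi)
  subst this
  exact rho_s
theorem rho_unit {a : RQ} (h : degreeOf 0 a = 0) : rho a = C (coeff 0 a) := by
  refine hom_congr_vars (f₁ := rho.toRingHom) (f₂ := (C : ℚ →+* RQ).comp constantCoeff) (by ext; simp) (fun i hi _ => ?_) rfl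
  have : i = 1 := by
    rcases Fin.exists_fin_two.1 ⟨i, rfl⟩ with h' | h'
    · subst h'; exact absurd h (nvar hi)
    · exact h'
  subst this
  have : rho (X 1) = 0 := rho_t
  simpa using this
theorem rho_congr {a b : RQ} (h : ∀ d : Fin 2 →₀ ℕ, d 1 = 0 → coeff d a = coeff d b) : rho a = rho b := by
  rw [← sub_eq_zero, ← map_sub, rho, aeval_def, eval₂_eq']
  refine Finset.sum_eq_zero fun d _ => ?_
  by_cases hd : d 1 = 0
  · simp [h d hd]
  · simp [Fin.prod_univ_two, hd]
theorem prime_of {f : RQ} (h0 : ¬ IsUnit f) (hr : rho f = 1)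
    (h : ∀ g k, f = g * k → degreeOf 1 g = 0 ∨ degreeOf 1 k = 0) : Prime f := by
  refine Irreducible.prime ⟨h0, fun {g k} e => ?_⟩
  have h1 : rho g * rho k = 1 := by rw [← map_mul, ← e, hr]
  rcases h g k e with h2 | h2
  · left; rw [rho_eq_self h2] at h1; exact IsUnit.of_mul_eq_one _ h1
  · right; rw [rho_eq_self h2] at h1; exact IsUnit.of_mul_eq_one_right _ h1
theorem deg_split {f g k : RQ} {n : ℕ} (hr : rho f = 1) (hd : degreeOf 1 f ≤ n) (e : f = g * k) :
    degreeOf 1 g + degreeOf 1 k ≤ n := by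
  have hf : f ≠ 0 := by rintro rfl; simp at hr
  rw [e] at hf hd
  rwa [degreeOf_mul_eq (left_ne_zero_of_mul hf) (right_ne_zero_of_mul hf)] at hd
theorem natDeg_le (z : ℚ) (g : RQ) : (aeval ![Polynomial.C z, Polynomial.X] g).natDegree ≤ degreeOf 1 g := by
  rw [aeval_def, eval₂_eq']
  refine Polynomial.natDegree_sum_le_of_forall_le _ _ fun d hd => ?_
  rw [Fin.prod_univ_two]
  have : d 1 ≤ degreeOf 1 g := monomial_le_degreeOf 1 hd
  simp only [Matrix.cons_val_zero, Matrix.cons_val_one]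
  have h2 : algebraMap ℚ (Polynomial ℚ) (coeff d g) * (Polynomial.C z ^ d 0 * Polynomial.X ^ d 1) =
    Polynomial.C (coeff d g * z ^ d 0) * Polynomial.X ^ d 1 := by
    rw [Polynomial.algebraMap_eq, Polynomial.C_mul, Polynomial.C_pow]; ring
  rw [h2]
  exact (Polynomial.natDegree_C_mul_X_pow_le _ _).trans this
theorem prime_quad {f : RQ} (h0 : ¬ IsUnit f) (hr : rho f = 1) (hd : degreeOf 1 f ≤ 2) (z β α : ℚ)
    (hf : aeval ![Polynomial.C z, Polynomial.X] f = 1 + Polynomial.C β * Polynomial.X + Polynomial.C α * Polynomial.X ^ 2)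
    (hx : ∀ x : ℚ, x ^ 2 - β * x + α ≠ 0) : Prime f := by
  refine prime_of h0 hr fun g k e => ?_
  by_contra! hc
  have h1 := deg_split hr hd e
  obtain ⟨b, a, hg⟩ := Polynomial.exists_eq_X_add_C_of_natDegree_le_one ((natDeg_le z g).trans (by omega))
  obtain ⟨d, c, hk⟩ := Polynomial.exists_eq_X_add_C_of_natDegree_le_one ((natDeg_le z k).trans (by omega))
  rw [e, map_mul, hg, hk] at hf
  have e0 := congrArg (Polynomial.eval 0) hf
  have e1 := congrArg (Polynomial.eval 1) hf
  have e2 := congrArg (Polynomial.eval (-1)) hf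
  simp at e0 e1 e2
  have hb : b * d = α := by linear_combination (e1 + e2) / 2 - e0
  have hm : a * d + b * c = β := by linear_combination (e1 - e2) / 2
  apply hx (b * c)
  linear_combination b * c * hm - hb - b * d * e0
structure Low (K : Type*) [Field K] (N D : RQ) : Prop where
  e : purePS2 K 6 * toPS D = toPS N
  c : ∀ x : RQ, x ∣ N → x ∣ D → IsUnit x
  N0 : coeff 0 N = 1
  D0 : coeff 0 D = 1
theorem pure_symm (K : Type*) [Field K] [CharZero K] (p q : ℕ) : pureDim K 6 p q = pureDim K 6 q p := by
  zify
  rw [pureDim_eq, pureDim_eq]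
  refine Finset.sum_congr rfl fun w _ => ?_
  congr 2
  refine Finset.card_equiv (Equiv.arrowCongr (Equiv.sumComm _ _) (Equiv.refl ℕ)) fun f => ?_
  rw [mem_wf, mem_wf]
  set f' : E6 → ℕ := Equiv.arrowCongr (Equiv.sumComm _ _) (Equiv.refl ℕ) f with hf'
  have hf : ∀ e, f' (Equiv.sumComm _ _ e) = f e := fun e => by simp [hf', Equiv.arrowCongr]
  have h1 : dgx f' = dgy f := by
    rw [dgx, dgy, ← Equiv.sum_comp (Equiv.sumComm _ _)]
    refine Finset.sum_congr rfl fun e _ => ?_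
    rw [hf]; cases e <;> rfl
  have h2 : dgy f' = dgx f := by
    rw [dgx, dgy, ← Equiv.sum_comp (Equiv.sumComm _ _)]
    refine Finset.sum_congr rfl fun e _ => ?_
    rw [hf]; cases e <;> rfl
  have h3 : bd f' = bd f := by
    funext v
    rw [bd, bd, ← Equiv.sum_comp (Equiv.sumComm _ _)]
    refine Finset.sum_congr rfl fun e _ => ?_
    rw [hf]; cases e <;> rfl
  rw [h1, h2, h3]
  simp [and_comm]
variable {K : Type*} [Field K] [CharZero K] {N D : RQ}
theorem Low.swap (L : Low K N D) : Low K (sw N) (sw D) := by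
  have key : ∀ a : RQ, MvPowerSeries.renameEquiv ℚ (Equiv.swap 0 1) (toPS a) = toPS (sw a) := fun a => by
    rw [toPS_apply, toPS_apply]; exact MvPowerSeries.rename_coe _ _
  have kp : MvPowerSeries.renameEquiv ℚ (Equiv.swap 0 1) (purePS2 K 6) = purePS2 K 6 := by
    ext d
    have := MvPowerSeries.coeff_embDomain_rename (Equiv.swap (0 : Fin 2) 1).toEmbedding (purePS2 K 6)
      (Finsupp.embDomain (Equiv.swap (0 : Fin 2) 1).toEmbedding d)
    have hd : Finsupp.embDomain (Equiv.swap (0 : Fin 2) 1).toEmbedding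
        (Finsupp.embDomain (Equiv.swap (0 : Fin 2) 1).toEmbedding d) = d := by
      ext i
      have e1 := Finsupp.embDomain_apply_self (Equiv.swap (0 : Fin 2) 1).toEmbedding
         (Finsupp.embDomain (Equiv.swap (0 : Fin 2) 1).toEmbedding d) (Equiv.swap (0 : Fin 2) 1 i)
      have e2 := Finsupp.embDomain_apply_self (Equiv.swap (0 : Fin 2) 1).toEmbedding d i
      simp at e1 e2
      rw [e1, e2]
    rw [hd] at this
    refine this.trans ?_
    have h0 := Finsupp.embDomain_apply_self (Equiv.swap (0 : Fin 2) 1).toEmbedding d 0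
    have h1 := Finsupp.embDomain_apply_self (Equiv.swap (0 : Fin 2) 1).toEmbedding d 1
    simp at h0 h1
    change ((pureDim K 6 _ _ : ℕ) : ℚ) = ((pureDim K 6 _ _ : ℕ) : ℚ)
    rw [h0, h1, pure_symm]
  refine ⟨?_, fun x h1 h2 => ?_, by rw [coeff_sw0, L.N0], by rw [coeff_sw0, L.D0]⟩
  · rw [← key, ← key, ← L.e, map_mul, kp]
  · have := L.c (sw x) (by simpa using map_dvd sw h1) (by simpa using map_dvd sw h2)
    simpa using this.map sw
end fin
section fin2
variable {K : Type*} [Field K] [CharZero K] {N D : RQ}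
theorem ndvd_s {f : RQ} (h1 : coeff 0 f = 1) (hp : ¬ IsUnit f) : ¬ f ∣ qs := by
  intro h
  have h3 : Irreducible (qs : RQ) := (X_prime (R := ℚ) (i := (0 : Fin 2))).irreducible
  obtain ⟨g, hg⟩ := h
  rcases h3.isUnit_or_isUnit hg with h4 | h4
  · exact hp h4
  · obtain ⟨u, rfl⟩ := h4
    have : f = qs * ((u⁻¹ : RQˣ) : RQ) := by rw [hg, mul_assoc, Units.mul_inv, mul_one]
    have h5 := congrArg constantCoeff this
    rw [constantCoeff_eq, h1, ← constantCoeff_eq, map_mul, qs, constantCoeff_X, zero_mul] at h5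
    exact one_ne_zero h5
structure Good (K : Type*) [Field K] (f : RQ) (m : ℕ) : Prop where
  p : Prime f
  c : coeff 0 f = 1
  r : rho f = 1
  r' : rho (sw f) = 1
  d : ∀ N D : RQ, Low K N D → f ^ m ∣ D ∧ ¬ f ^ (m + 1) ∣ D
theorem Good.swap {f : RQ} {m : ℕ} (h : Good K f m) : Good K (sw f) m := by
  refine ⟨(MulEquiv.prime_iff (sw : RQ ≃* RQ)).2 h.p, by rw [coeff_sw0, h.c], h.r', by rw [sw_sw, h.r], fun N D L => ?_⟩
  have := h.d _ _ L.swap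
  constructor
  · have h1 := map_dvd sw this.1
    simpa using h1
  · intro h1
    apply this.2
    have h2 := map_dvd sw h1
    simpa using h2
theorem OrdF.nu {f : RQ} {m : ℕ} (h : OrdF f m SS) : ¬ IsUnit f := by
  obtain ⟨ev, u, a, b, h1, -⟩ := h
  intro hu
  simpa [h1] using hu.map ev
theorem OrdF.good {f : RQ} {m : ℕ} (h : OrdF f m SS) (hm : m ≠ 0) (p : Prime f) (c : coeff 0 f = 1) (r : rho f = 1)
    (r' : rho (sw f) = 1) : Good K f m := by
  refine ⟨p, c, r, r', fun N D L => ?_⟩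
  have hs := ndvd_s c p.not_isUnit
  obtain ⟨ev, u, a, b, h1, h2, h3, h4, h5⟩ := h
  have nd : ∀ x, ev x ≠ 0 → ¬ f ∣ x := fun x hx hd => hx (by
    obtain ⟨y, rfl⟩ := hd
    rw [map_mul, h1, zero_mul])
  have key : (f * u) ^ m * b * (C 720 * qs ^ 15) * N = a * D := by
    apply toPS_inj
    rw [map_mul _ _ N, map_mul _ a, ← h5, ← L.e, ← SS_pure (K := K), map_mul _ _ (C 720 * qs ^ 15)]
    ring
  have d1 : f ^ m ∣ D := p.pow_dvd_of_dvd_mul_left _ (nd a h3) ⟨u ^ m * b * (C 720 * qs ^ 15) * N, by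
    rw [← key, mul_pow]; ring⟩
  refine ⟨d1, fun d2 => ?_⟩
  obtain ⟨D1, rfl⟩ := d1
  have hf0 := pow_ne_zero m p.ne_zero
  rw [pow_succ] at d2
  have d3 := (mul_dvd_mul_iff_left hf0).1 d2
  have key2 : u ^ m * b * (C 720 * qs ^ 15) * N = a * D1 := by
    apply mul_left_cancel₀ hf0
    rw [mul_left_comm _ a, ← key, mul_pow]; ring
  have d4 : f ∣ u ^ m * b * (C 720 * qs ^ 15) * N := key2 ▸ Dvd.dvd.mul_left d3 a
  have hN : f ∣ N := by
    rcases p.dvd_or_dvd d4 with d5 | d5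
    · exfalso
      rcases p.dvd_or_dvd d5 with d6 | d6
      · rcases p.dvd_or_dvd d6 with d7 | d7
        · exact nd u h2 (p.dvd_of_dvd_pow d7)
        · exact nd b h4 d7
      · rcases p.dvd_or_dvd d6 with d7 | d7
        · refine nd (C 720) ?_ d7
          have : (C 720 : RQ) = 720 := rfl
          rw [this, map_ofNat]; norm_num
        · exact hs (p.dvd_of_dvd_pow d7)
    · exact d5
  exact p.not_isUnit (L.c f hN (Dvd.dvd.mul_right (dvd_pow_self f hm) _))
theorem SS_den : ∃ (n : ℕ) (a : RQ), toPS (TT ^ n) * SS = toPS a := by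
  choose n a h using Hf_den
  refine ⟨∑ σ : Equiv.Perm V6, n (Gs σ), ∑ σ : Equiv.Perm V6, ((Equiv.Perm.sign σ : ℤ) : RQ) *
    (TT ^ (∑ σ : Equiv.Perm V6, n (Gs σ) - n (Gs σ)) * a (Gs σ)), ?_⟩
  rw [SS, Finset.mul_sum, map_sum]
  refine Finset.sum_congr rfl fun σ _ => ?_
  have : n (Gs σ) ≤ ∑ σ : Equiv.Perm V6, n (Gs σ) :=
    Finset.single_le_sum (f := fun σ => n (Gs σ)) (fun _ _ => Nat.zero_le _) (Finset.mem_univ σ)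
  rw [map_mul _ _ (_ * _), map_mul _ _ (a _), ← h, ← Nat.sub_add_cancel this, pow_add, map_mul, Nat.add_sub_cancel]
  ring
theorem dvd_TTn (L : Low K N D) : ∃ n, ∀ R, R ∣ D → R ∣ TT ^ n := by
  obtain ⟨n, a, h⟩ := SS_den
  refine ⟨n, fun R hR => ?_⟩
  have e : TT ^ n * (C 720 * qs ^ 15) * N = a * D := by
    apply toPS_inj
    rw [map_mul _ _ N, map_mul _ a, ← h, ← L.e, ← SS_pure (K := K), map_mul _ (TT ^ n)]
    ring
  have h1 : R ∣ TT ^ n * (C 720 * qs ^ 15) * N := e ▸ hR.mul_left a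
  have h2 : IsRelPrime R N := fun x h3 h4 => L.c x h4 (h3.trans hR)
  have h5 := h2.dvd_of_dvd_mul_right h1
  have h6 : IsRelPrime R (C 720 * qs ^ 15) := by
    refine IsRelPrime.mul_right ?_ (IsRelPrime.pow_right ?_)
    · exact fun x _ hx => isUnit_of_dvd_unit hx (IsUnit.map C (by norm_num : IsUnit (720 : ℚ)))
    · have h3 : Irreducible (qs : RQ) := (X_prime (R := ℚ) (i := (0 : Fin 2))).irreducible
      rw [isRelPrime_comm, h3.isRelPrime_iff_not_dvd]
      intro h4
      obtain ⟨g, hg⟩ := h4.trans hR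
      have := congrArg constantCoeff hg
      rw [constantCoeff_eq, L.D0, ← constantCoeff_eq, map_mul, qs, constantCoeff_X, zero_mul] at this
      exact one_ne_zero this
  exact h6.dvd_of_dvd_mul_right h5
theorem Bd.mulp {G : PSQ} (H : Bd 0 G) (a : RQ) : Bd (degreeOf 0 a) (G * toPS a) := fun d hd => by
  classical
  rw [MvPowerSeries.coeff_mul]
  refine Finset.sum_eq_zero fun x hx => ?_
  rw [Finset.HasAntidiagonal.mem_antidiagonal] at hx
  by_cases h1 : 0 + 6 * x.1 1 < x.1 0
  · rw [H _ h1, zero_mul]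
  · have h0 : coeff x.2 a = 0 := by
      by_contra hc
      have := monomial_le_degreeOf 0 (mem_support_iff.2 hc)
      subst hx
      simp at hd
      omega
    rw [toPS_apply, coeff_coe, h0, mul_zero]
theorem R1_lem (L : Low K N D) {M R1 R2 : RQ} (hM : rho M = 1) (h1 : degreeOf 1 R1 = 0) (h2 : degreeOf 0 R2 = 0)
    (e : D = M * (R1 * R2)) : Associated R1 (pn 6) := by
  classical
  set G := toPS (pn 6) * purePS2 K 6 with hG
  have hB : Bd 0 G := pure_pn K
  have eG : G * toPS D = toPS (pn 6 * N) := by rw [hG, mul_assoc, L.e, map_mul]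
  have hp : pn 6 ∣ R1 := by
    have hG0 : MvPowerSeries.coeff 0 G = 1 := by
      have h3 := congrArg MvPowerSeries.constantCoeff L.e
      rw [map_mul, toPS_apply, toPS_apply, ← MvPowerSeries.coeff_zero_eq_constantCoeff_apply,
        ← MvPowerSeries.coeff_zero_eq_constantCoeff_apply, ← MvPowerSeries.coeff_zero_eq_constantCoeff_apply,
        coeff_coe, coeff_coe, L.N0, L.D0, mul_one] at h3
      rw [hG, MvPowerSeries.coeff_zero_eq_constantCoeff_apply, map_mul, ← MvPowerSeries.coeff_zero_eq_constantCoeff_apply,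
        ← MvPowerSeries.coeff_zero_eq_constantCoeff_apply, h3, toPS_apply, coeff_coe, mul_one, ← constantCoeff_eq]
      simp [pn, qs, Finset.prod_range_succ]
    have h3 : rho (pn 6 * N) = rho D := rho_congr fun d hd => by
      have h4 := congrArg (MvPowerSeries.coeff d) eG
      rw [toPS_apply, toPS_apply, coeff_coe, MvPowerSeries.coeff_mul] at h4
      rw [← h4, Finset.sum_eq_single (0, d)]
      · rw [hG0, one_mul, coeff_coe]
      · intro x hx hne
        rw [Finset.HasAntidiagonal.mem_antidiagonal] at hx
        have h5 : x.1 1 = 0 := by subst hx; simp at hd; omega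
        have h6 : x.1 0 ≠ 0 := by
          intro h6
          have : x.1 = 0 := by ext i; fin_cases i <;> simp [h5, h6]
          exact hne (Prod.ext this (by rw [this, zero_add] at hx; exact hx))
        rw [hB _ (by omega), zero_mul]
      · simp
    have h4 : coeff 0 R2 ≠ 0 := by
      intro h5
      have := congrArg constantCoeff e
      rw [map_mul, map_mul, constantCoeff_eq, L.D0, h5, mul_zero, mul_zero] at this
      exact one_ne_zero this
    rw [e, map_mul, map_mul, map_mul, hM, one_mul, rho_eq_self h1, rho_unit h2] at h3
    have h5 : rho (pn 6) = pn 6 := by simp [pn]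
    rw [h5] at h3
    exact (IsUnit.dvd_mul_right (IsUnit.map C (isUnit_iff_ne_zero.2 h4))).1 ⟨_, h3.symm⟩
  refine associated_of_dvd_dvd ?_ hp
  set W := G * toPS (M * R2) with hW
  have hBW := hB.mulp (M * R2)
  rw [← hW] at hBW
  set m := degreeOf 0 (M * R2)
  set Q := degreeOf 1 (pn 6 * N) with hQ
  have e2 : toPS R1 * W = toPS (pn 6 * N) := by
    rw [← eG, hW, e]; simp only [map_mul]; ring
  have e3 : R1 * MvPowerSeries.trunc' ℚ (Finsupp.single 0 (m + 6 * Q) + Finsupp.single 1 Q) W = pn 6 * N := by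
    ext d
    rw [coeff_mul]
    have h4 := congrArg (MvPowerSeries.coeff d) e2
    rw [toPS_apply, toPS_apply, coeff_coe, MvPowerSeries.coeff_mul] at h4
    have hx1 : ∀ x ∈ Finset.HasAntidiagonal.antidiagonal d, coeff x.1 R1 ≠ 0 → x.2 1 = d 1 := fun x hx hc => by
      have := monomial_le_degreeOf 1 (mem_support_iff.2 hc)
      rw [Finset.HasAntidiagonal.mem_antidiagonal] at hx
      rw [← hx]; simp; omega
    by_cases hd : d 1 ≤ Q
    · rw [← h4]
      refine Finset.sum_congr rfl fun x hx => ?_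
      rw [coeff_coe]
      by_cases hc : coeff x.1 R1 = 0
      · simp [hc]
      · have h5 := hx1 x hx hc
        rw [MvPowerSeries.coeff_trunc']
        split_ifs with h6
        · rfl
        · rw [hBW x.2]
          by_contra h7
          apply h6
          rw [Finsupp.le_def, Fin.forall_fin_two]
          simp
          omega
    · have h6 : coeff d (pn 6 * N) = 0 := by
        by_contra hc
        exact hd (monomial_le_degreeOf 1 (mem_support_iff.2 hc))
      rw [h6]
      refine Finset.sum_eq_zero fun x hx => ?_
      by_cases hc : coeff x.1 R1 = 0
      · simp [hc]
      · have h5 := hx1 x hx hc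
        rw [MvPowerSeries.coeff_trunc', if_neg, mul_zero]
        intro h7
        have := h7 1
        simp at this
        omega
  have h5 : IsRelPrime R1 N := fun x h6 h7 => L.c x h7 (h6.trans (e ▸ (Dvd.intro _ rfl).mul_left M))
  exact h5.dvd_of_dvd_mul_right ⟨_, e3.symm⟩
end fin2
section fin3
variable {K : Type*} [Field K] [CharZero K] {N D : RQ}
theorem deg_mon (i : Fin 2) (a b : ℕ) : degreeOf i (qs ^ a * qt ^ b) ≤ if i = 0 then a else b := by
  refine (degreeOf_mul_le _ _ _).trans ((add_le_add (degreeOf_pow_le _ _ _) (degreeOf_pow_le _ _ _)).trans ?_)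
  fin_cases i <;> simp [qs, qt, degreeOf_X]
theorem deg_ab (i : Fin 2) (a b : ℕ) : degreeOf i (1 - qs ^ a * qt ^ b) ≤ if i = 0 then a else b :=
  (degreeOf_sub_le _ _ _).trans (max_le (by simp) (deg_mon i a b))
theorem OrdF.lin {f : RQ} {m : ℕ} (h : OrdF f m SS) (hm : m ≠ 0) (hd : degreeOf 1 f ≤ 1) (c : coeff 0 f = 1)
    (r : rho f = 1) (r' : rho (sw f) = 1) : Good K f m :=
  h.good hm (prime_of h.nu r fun g k e => by have := deg_split r hd e; omega) c r r'
theorem OrdF.lin1 {a m : ℕ} (h : OrdF (1 - qs ^ a * qt ^ 1) m SS) (ha : a ≠ 0) (hm : m ≠ 0) : Good K (1 - qs ^ a * qt) m := by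
  have hd := deg_ab 1 a 1
  rw [pow_one] at h hd
  exact h.lin hm hd (by simp [← constantCoeff_eq, qs, qt]) (by simp) (by simp [ha])
def pf : Fin 15 → RQ := ![1 - qs * qt, 1 - qs ^ 2 * qt, 1 - qs * qt ^ 2, 1 - qs ^ 3 * qt, 1 - qs * qt ^ 3,
  1 - qs ^ 4 * qt, 1 - qs * qt ^ 4, 1 - qs ^ 3 * qt ^ 2, 1 - qs ^ 2 * qt ^ 3, 1 - qs ^ 5 * qt, 1 - qs * qt ^ 5,
  1 + qs * qt, 1 + qs ^ 2 * qt, 1 + qs * qt ^ 2, 1 + qs * qt + qs ^ 2 * qt ^ 2]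
def pm : Fin 15 → ℕ := ![7, 4, 4, 3, 3, 2, 2, 2, 2, 1, 1, 3, 1, 1, 1]
def pz : Fin 15 → ℤ := ![-5, -11, -17, -23, -53, -47, -161, -71, -107, -95, -485, 7, 13, 19, 43]
theorem pf_inj : Function.Injective pf := by
  have h : ∀ i, eval ![2, 3] (pf i) = (pz i : ℚ) := by
    intro i; fin_cases i <;> simp [pf, pz, qs, qt] <;> norm_num
  have h2 : Function.Injective pz := by decide
  intro i j hij
  apply h2
  have := h i
  rw [hij, h j] at this
  exact_mod_cast this.symm
theorem g32 : Good K (1 - qs ^ 3 * qt ^ 2) 2 := by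
  refine ord32.good (by simp) (prime_quad ord32.nu (by simp) (deg_ab 1 3 2) (-1) 0 1 ?_ ?_)
    (by simp [← constantCoeff_eq, qs, qt]) (by simp) (by simp)
  · simp [qs, qt]; ring
  · intro x; nlinarith [sq_nonneg x]
theorem g33 : Good K (1 + qs * qt + qs ^ 2 * qt ^ 2) 1 := by
  refine ord33.good (by simp) (prime_quad ord33.nu (by simp) ?_ 1 1 1 ?_ ?_)
    (by simp [← constantCoeff_eq, qs, qt]) (by simp) (by simp)
  · have := deg_mon 1 1 1
    rw [pow_one, pow_one] at this
    refine (degreeOf_add_le _ _ _).trans (max_le ((degreeOf_add_le _ _ _).trans (max_le (by simp) ?_)) (deg_mon 1 2 2))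
    exact this.trans (by simp)
  · simp [qs, qt]
  · intro x; nlinarith [sq_nonneg (x - 1 / 2)]
theorem lin_plus (a : ℕ) : degreeOf 1 (1 + qs ^ a * qt) ≤ 1 := by
  have := deg_mon 1 a 1
  rw [pow_one] at this
  exact (degreeOf_add_le _ _ _).trans (max_le (by simp) this)
theorem good_pf (i : Fin 15) : Good K (pf i) (pm i) := by
  have g1 : Good K (1 - qs ^ 1 * qt) 7 := ord11.lin1 (by simp) (by simp)
  rw [pow_one] at g1
  have g2 : Good K (1 - qs ^ 2 * qt) 4 := ord21.lin1 (by simp) (by simp)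
  have g3 : Good K (1 - qs ^ 3 * qt) 3 := ord31.lin1 (by simp) (by simp)
  have g4 : Good K (1 - qs ^ 4 * qt) 2 := ord41.lin1 (by simp) (by simp)
  have g5 : Good K (1 - qs ^ 5 * qt) 1 := ord51.lin1 (by simp) (by simp)
  have p1 : Good K (1 + qs * qt) 3 := ord22.lin (by simp) (by simpa using lin_plus 1)
    (by simp [← constantCoeff_eq, qs, qt]) (by simp) (by simp)
  have p2 : Good K (1 + qs ^ 2 * qt) 1 := ord42.lin (by simp) (lin_plus 2)
    (by simp [← constantCoeff_eq, qs, qt]) (by simp) (by simp)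
  have s2 := g2.swap
  have s3 := g3.swap
  have s4 := g4.swap
  have s5 := g5.swap
  have t2 := p2.swap
  have s6 := (g32 (K := K)).swap
  simp only [map_sub, map_add, map_one, map_mul, map_pow, sw_s, sw_t, mul_comm _ qs, mul_comm _ (qs ^ _)] at s2 s3 s4 s5 s6 t2
  fin_cases i
  · exact g1
  · exact g2
  · exact s2
  · exact g3
  · exact s3
  · exact g4
  · exact s4
  · exact g32
  · exact s6
  · exact g5
  · exact s5
  · exact p1
  · exact p2
  · exact t2
  · exact g33
theorem rel_mixed {R : RQ} (h : ∀ i, IsRelPrime R (pf i)) (a b : ℕ) (ha : a ≠ 0) (hb : b ≠ 0) (hab : a + b ≤ 6) :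
    IsRelPrime R (1 - qs ^ a * qt ^ b) := by
  have e : ∀ {x y z : RQ}, IsRelPrime R x → IsRelPrime R y → x * y = z → IsRelPrime R z := fun h1 h2 h3 => h3 ▸ h1.mul_right h2
  have h22 : IsRelPrime R (1 - qs ^ 2 * qt ^ 2) := e (h 0) (h 11) (by simp only [pf, Matrix.cons_val]; ring)
  have h42 : IsRelPrime R (1 - qs ^ 4 * qt ^ 2) := e (h 1) (h 12) (by simp only [pf, Matrix.cons_val]; ring)
  have h24 : IsRelPrime R (1 - qs ^ 2 * qt ^ 4) := e (h 2) (h 13) (by simp only [pf, Matrix.cons_val]; ring)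
  have h33 : IsRelPrime R (1 - qs ^ 3 * qt ^ 3) := e (h 0) (h 14) (by simp only [pf, Matrix.cons_val]; ring)
  have h0 := h 0
  have h1 := h 1
  have h2 := h 2
  have h3 := h 3
  have h4 := h 4
  have h5 := h 5
  have h6 := h 6
  have h7 := h 7
  have h8 := h 8
  have h9 := h 9
  have h10 := h 10
  clear h e
  simp only [pf, Matrix.cons_val] at h0 h1 h2 h3 h4 h5 h6 h7 h8 h9 h10
  have ha' : a ≤ 5 := by omega
  have hb' : b ≤ 5 := by omega
  interval_cases a <;> interval_cases b <;> first | omega | (simp only [pow_one]; assumption)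
theorem deg_dvd {R A : RQ} {i : Fin 2} (hA : A ≠ 0) (h : R ∣ A) (hd : degreeOf i A = 0) : degreeOf i R = 0 := by
  obtain ⟨B, rfl⟩ := h
  rw [degreeOf_mul_eq (left_ne_zero_of_mul hA) (right_ne_zero_of_mul hA)] at hd
  omega
theorem D_eq (L : Low K N D) : D = (∏ i, pf i ^ pm i) * (pn 6 * sw (pn 6)) := by
  have hg := good_pf (K := K)
  have hM : ∏ i, pf i ^ pm i ∣ D := by
    refine Fintype.prod_dvd_of_isRelPrime (fun i j hij => ?_) (fun i => ((hg i).d N D L).1)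
    refine IsRelPrime.pow ?_
    rw [(hg i).p.irreducible.isRelPrime_iff_not_dvd]
    intro h
    obtain ⟨u, hu⟩ := (hg i).p.irreducible.associated_of_dvd (hg j).p.irreducible h
    obtain ⟨c, -, hc⟩ := isUnit_iff_eq_C_of_isReduced.1 u.isUnit
    have h3 := congrArg constantCoeff hu
    rw [map_mul, constantCoeff_eq, (hg i).c, (hg j).c, one_mul, hc, ← constantCoeff_eq, constantCoeff_C] at h3
    rw [hc, h3, C_1, mul_one] at hu
    exact hij (pf_inj hu)
  obtain ⟨R, hR⟩ := hM
  have hrel : ∀ i, IsRelPrime R (pf i) := fun i => by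
    rw [isRelPrime_comm, (hg i).p.irreducible.isRelPrime_iff_not_dvd]
    intro h
    apply ((hg i).d N D L).2
    rw [hR, pow_succ]
    exact mul_dvd_mul (Finset.dvd_prod_of_mem (fun i => pf i ^ pm i) (Finset.mem_univ i)) h
  obtain ⟨n, hn⟩ := dvd_TTn L
  have h1 := hn R (hR ▸ Dvd.intro_left _ rfl)
  rw [TT, ← Finset.prod_filter_mul_prod_filter_not _ (fun ab : ℕ × ℕ => ab.2 = 0),
    ← Finset.prod_filter_mul_prod_filter_not (Finset.filter (fun ab : ℕ × ℕ => ¬ ab.2 = 0) _) (fun ab : ℕ × ℕ => ab.1 = 0)] at h1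
  simp only [Finset.filter_filter] at h1
  rw [← mul_assoc, mul_pow] at h1
  have h2 := IsRelPrime.dvd_of_dvd_mul_right (IsRelPrime.pow_right (IsRelPrime.prod_right fun ab hab => by
    simp only [Finset.mem_filter] at hab
    exact rel_mixed hrel ab.1 ab.2 hab.2.2 hab.2.1.2 hab.2.1.1.2)) h1
  rw [mul_pow] at h2
  obtain ⟨R1, R2, d1, d2, e⟩ := exists_dvd_and_dvd_of_dvd_mul h2
  have ne : ∀ ab : ℕ × ℕ, 1 ≤ ab.1 + ab.2 → (1 - qs ^ ab.1 * qt ^ ab.2 : RQ) ≠ 0 := fun ab hab h => by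
    have := congrArg constantCoeff h
    have h5 : ab.1 ≠ 0 ∨ ab.2 ≠ 0 := by omega
    rcases h5 with h5 | h5 <;> simp [qs, qt, h5] at this
  have aux : ∀ (i : Fin 2) (s : Finset (ℕ × ℕ)), (∀ ab ∈ s, 1 ≤ ab.1 + ab.2 ∧ (if i = 0 then ab.1 else ab.2) = 0) → ∀ R : RQ,
      R ∣ (∏ ab ∈ s, (1 - qs ^ ab.1 * qt ^ ab.2)) ^ n → degreeOf i R = 0 := by
    intro i s hs R hd
    have hz := Finset.prod_ne_zero_iff.2 fun ab hab => ne ab (hs ab hab).1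
    refine deg_dvd (pow_ne_zero n hz) hd ?_
    rw [degreeOf_pow_eq _ _ _ hz, degreeOf_prod_eq _ _ fun ab hab => ne ab (hs ab hab).1, Finset.sum_eq_zero, mul_zero]
    intro ab hab
    have := deg_ab i ab.1 ab.2
    rw [(hs ab hab).2] at this
    omega
  have f1 : degreeOf 1 R1 = 0 := aux 1 _ (fun ab hab => by
    simp only [Finset.mem_filter] at hab
    exact ⟨hab.2.1.1, hab.2.2⟩) _ d1
  have f2 : degreeOf 0 R2 = 0 := aux 0 _ (fun ab hab => by
    simp only [Finset.mem_filter] at hab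
    exact ⟨hab.2.1.1.1, hab.2.2⟩) _ d2
  have sdeg : ∀ (i : Fin 2) (a : RQ), degreeOf (Equiv.swap 0 1 i) (sw a) = degreeOf i a := fun i a =>
    degreeOf_rename_of_injective (Equiv.swap (0 : Fin 2) 1).injective i
  have A1 : Associated R1 (pn 6) := R1_lem L (M := ∏ i, pf i ^ pm i) (by simp [(hg _).r]) f1 f2 (by rw [← e]; exact hR)
  have A2 : Associated (sw R2) (pn 6) := R1_lem L.swap (M := sw (∏ i, pf i ^ pm i)) (R2 := sw R1) (by simp [(hg _).r'])
    (by rw [← f2]; simpa using sdeg 0 R2) (by rw [← f1]; simpa using sdeg 1 R1)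
    (by rw [hR, e, map_mul, map_mul, mul_comm (sw R1)])
  have A3 : Associated R2 (sw (pn 6)) := by
    have := A2.map sw
    rwa [sw_sw] at this
  obtain ⟨u, hu⟩ : Associated D ((∏ i, pf i ^ pm i) * (pn 6 * sw (pn 6))) := by
    nth_rewrite 1 [hR]
    rw [e]
    exact (A1.mul_mul A3).mul_left _
  obtain ⟨c, -, hc⟩ := isUnit_iff_eq_C_of_isReduced.1 u.isUnit
  have h3 := congrArg constantCoeff hu
  have hpn : constantCoeff (pn 6) = 1 := by simp [pn, qs, Finset.prod_range_succ]
  have hpn' : constantCoeff (sw (pn 6)) = 1 := by rw [constantCoeff_eq, coeff_sw0, ← constantCoeff_eq, hpn]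
  have hcc : ∀ i, constantCoeff (pf i) = 1 := fun i => (hg i).c
  have hcD : constantCoeff D = 1 := L.D0
  simp only [map_mul, map_prod, map_pow, hcc, hpn, hpn', hcD, hc, constantCoeff_C] at h3
  simp only [one_pow, Finset.prod_const_one, mul_one, one_mul] at h3
  rw [← hu, hc, h3, C_1, mul_one]
theorem E_eq : (∏ i, pf i ^ pm i) * (pn 6 * sw (pn 6)) = (1 - qs * qt) * PiPoly 6 := by
  have h22 : (1 - qs ^ 2 * qt ^ 2 : RQ) = pf 0 * pf 11 := by simp only [pf, Matrix.cons_val]; ring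
  have h42 : (1 - qs ^ 4 * qt ^ 2 : RQ) = pf 1 * pf 12 := by simp only [pf, Matrix.cons_val]; ring
  have h24 : (1 - qs ^ 2 * qt ^ 4 : RQ) = pf 2 * pf 13 := by simp only [pf, Matrix.cons_val]; ring
  have h33 : (1 - qs ^ 3 * qt ^ 3 : RQ) = pf 0 * pf 14 := by simp only [pf, Matrix.cons_val]; ring
  have h0 : (1 - qs * qt : RQ) = pf 0 := rfl
  have h1 : (1 - qs ^ 2 * qt : RQ) = pf 1 := rfl
  have h2 : (1 - qs * qt ^ 2 : RQ) = pf 2 := rfl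
  have h3 : (1 - qs ^ 3 * qt : RQ) = pf 3 := rfl
  have h4 : (1 - qs * qt ^ 3 : RQ) = pf 4 := rfl
  have h5 : (1 - qs ^ 4 * qt : RQ) = pf 5 := rfl
  have h6 : (1 - qs * qt ^ 4 : RQ) = pf 6 := rfl
  have h7 : (1 - qs ^ 3 * qt ^ 2 : RQ) = pf 7 := rfl
  have h8 : (1 - qs ^ 2 * qt ^ 3 : RQ) = pf 8 := rfl
  have h9 : (1 - qs ^ 5 * qt : RQ) = pf 9 := rfl
  have h10 : (1 - qs * qt ^ 5 : RQ) = pf 10 := rfl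
  have hs : sw (pn 6) = ∏ i ∈ Finset.range 6, (1 - qt ^ (i + 1)) := by simp [pn]
  have hP : PiPoly 6 = pn 6 * sw (pn 6) *
      ∏ i ∈ Finset.range 6, ∏ j ∈ Finset.range i, (1 - qs ^ (i - j) * qt ^ (j + 1)) ^ min (i + 1) (6 - i) := by
    rw [PiPoly, hs, pn, ← Finset.prod_mul_distrib, ← Finset.prod_mul_distrib]
  have hM : ∏ i, pf i ^ pm i = pf 0 ^ 7 * (pf 1 ^ 4 * (pf 2 ^ 4 * (pf 3 ^ 3 * (pf 4 ^ 3 * (pf 5 ^ 2 * (pf 6 ^ 2 * (pf 7 ^ 2 *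
      (pf 8 ^ 2 * (pf 9 ^ 1 * (pf 10 ^ 1 * (pf 11 ^ 3 * (pf 12 ^ 1 * (pf 13 ^ 1 * (pf 14 ^ 1 * 1)))))))))))))) := by
    simp only [Fin.prod_univ_succ, Fin.prod_univ_zero]
    rfl
  rw [hP, h0, hM]
  generalize pn 6 * sw (pn 6) = z
  simp only [Finset.prod_range_succ, Finset.prod_range_zero]
  norm_num only [Nat.sub_zero, Nat.zero_add, pow_one, h0, h1, h2, h3, h4, h5, h6, h7, h8, h9, h10, h22, h42, h24, h33]
  simp only [show min 2 5 = 2 from rfl, show min 3 4 = 3 from rfl, show min 4 3 = 3 from rfl, show min 5 2 = 2 from rfl,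
    show min 6 1 = 1 from rfl]
  ring
end fin3
/-- If `P(C_{6,2}; s,t) = N/D` in lowest terms (`N`, `D` coprime polynomials with
constant term `1`), then `D = (1 − st)·Π₆(s,t)`. -/
theorem denominator_C62 (K : Type*) [Field K] [CharZero K]
    (N D : MvPolynomial (Fin 2) ℚ)
    (hPD : purePS2 K 6 * (D : MvPowerSeries (Fin 2) ℚ) = (N : MvPowerSeries (Fin 2) ℚ))
    (hcop : ∀ c : MvPolynomial (Fin 2) ℚ, c ∣ N → c ∣ D → IsUnit c)
    (hN : MvPolynomial.coeff 0 N = 1) (hD : MvPolynomial.coeff 0 D = 1) :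
    D = (1 - qs * qt) * PiPoly 6 := by
  rw [D_eq (K := K) ⟨hPD, hcop, hN, hD⟩, E_eq]
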